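/- Let X be a finitely primitive countable Markov shift, φ: X → ℝ a measurable function and μ_φ a Gibbs state for the potential φ. Fix a ∈ S and y ∈ X and for n ≥ 1 define η_{a,n} = (1/Z_n(φ,[a]∩Per_n(σ))) Σ_{x∈[a]∩Per_n(σ)} exp(S_nφ(x)) δ_{δ_x^n} and ζ_{a,y,n} = (1/Z_n(φ,[a]∩σ^{-n}y)) Σ_{x∈[a]∩σ^{-n}y} exp(S_nφ(x)) δ_{δ_x^n}. Then {η_{a,n}} and {ζ_{a,y,n}} are exponentially tight and satisfy the Large Deviation Principle with the convex good rate function I(μ) = -inf_{G ∋ μ} sup_G F (infimum over open G ⊂ M containing μ). -/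

import Mathlib

open MeasureTheory Filter Topology Set
open scoped ENNReal NNReal

namespace CMS

/-! ### Generic dynamical notions -/

variable {X : Type*}

/-- Birkhoff sum `S_n φ`. -/
noncomputable def birkhoff (T : X → X) (φ : X → ℝ) (n : ℕ) (x : X) : ℝ :=
  ∑ i ∈ Finset.range n, φ (T^[i] x)

/-- A measure is invariant under `T`. -/
def Invariant [MeasurableSpace X] (T : X → X) (μ : Measure X) : Prop :=
  Measure.map T μ = μ

/-- `∫ φ dμ > -∞`, i.e. the negative part of `φ` is integrable. -/
def IntegralGtBot [MeasurableSpace X] (φ : X → ℝ) (μ : Measure X) : Prop :=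
  (∫⁻ x, ENNReal.ofReal (-φ x) ∂μ) ≠ ⊤

/-- The integral of `φ`, with values in `EReal` (defined whenever one of the parts is finite). -/
noncomputable def eintegral [MeasurableSpace X] (φ : X → ℝ) (μ : Measure X) : EReal :=
  ((∫⁻ x, ENNReal.ofReal (φ x) ∂μ : ℝ≥0∞) : EReal) -
    ((∫⁻ x, ENNReal.ofReal (-φ x) ∂μ : ℝ≥0∞) : EReal)

/-- Entropy of the countable partition induced by a map `g` with countable range. -/
noncomputable def partitionEntropy [MeasurableSpace X] {α : Type*} (μ : Measure X) (g : X → α) :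
    ℝ≥0∞ :=
  ∑' a : α, ENNReal.ofReal (-((μ (g ⁻¹' {a})).toReal * Real.log ((μ (g ⁻¹' {a})).toReal)))

/-- Kolmogorov–Sinaĭ entropy of `T` with respect to `μ`: the supremum over finite measurable
partitions (coded by maps `X → ℕ` with finite range) of the asymptotic entropy of iterated
joins of the partition. -/
noncomputable def entropy [MeasurableSpace X] (T : X → X) (μ : Measure X) : ℝ≥0∞ :=
  ⨆ (p : X → ℕ) (_ : Measurable p ∧ (Set.range p).Finite),
    atTop.liminf fun n : ℕ =>
      ENNReal.ofReal ((n : ℝ)⁻¹) * partitionEntropy μ (fun x => fun i : Fin n => p (T^[i] x))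

/-- The empirical measure `δ_x^n = (1/n) ∑_{i<n} δ_{T^i x}` (with junk convention `n = 0 ↦ n = 1`,
irrelevant since only `n ≥ 1` is ever used). -/
noncomputable def empirical [MeasurableSpace X] (T : X → X) (x : X) (n : ℕ) :
    ProbabilityMeasure X :=
  ⟨((max n 1 : ℕ) : ℝ≥0∞)⁻¹ • ∑ i ∈ Finset.range (max n 1), Measure.dirac (T^[i] x), by
    refine ⟨?_⟩
    have h1 : (∑ i ∈ Finset.range (max n 1), Measure.dirac (T^[i] x)) Set.univ
        = ((max n 1 : ℕ) : ℝ≥0∞) := by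
      rw [Measure.finset_sum_apply]
      simp
    rw [Measure.smul_apply, h1, smul_eq_mul, ENNReal.inv_mul_cancel] <;> simp⟩

noncomputable instance [MeasurableSpace X] [TopologicalSpace X] [OpensMeasurableSpace X] :
    MeasurableSpace (ProbabilityMeasure X) := borel _

/-- Sets of periodic points. -/
def perSet (T : X → X) (n : ℕ) : Set X := {x | T^[n] x = x}

/-- Sets of iterated preimages of a point. -/
def preimSet (T : X → X) (n : ℕ) (y : X) : Set X := {x | T^[n] x = y}

/-- The partition function `Z_n(φ, C)` over a subset `C`. -/
noncomputable def Zfn [MeasurableSpace X] (T : X → X) (φ : X → ℝ) (n : ℕ) (C : Set X) : ℝ≥0∞ :=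
  ∑' x : C, ENNReal.ofReal (Real.exp (birkhoff T φ n x))

/-- The distribution of the empirical measures under `μ`. -/
noncomputable def empDistr [MeasurableSpace X] [TopologicalSpace X] [OpensMeasurableSpace X]
    (T : X → X) (μ : Measure X) (n : ℕ) : Measure (ProbabilityMeasure X) :=
  Measure.map (fun x => empirical T x n) μ

/-- The distribution `Z_n(φ,C)⁻¹ ∑_{x ∈ C} e^{S_nφ(x)} δ_{δ_x^n}` on the space of probability
measures, for a countable set `C` (of weighted periodic points or iterated preimages). -/
noncomputable def weightedDistr [MeasurableSpace X] [TopologicalSpace X] [OpensMeasurableSpace X]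
    (T : X → X) (φ : X → ℝ) (n : ℕ) (C : Set X) : Measure (ProbabilityMeasure X) :=
  (Zfn T φ n C)⁻¹ •
    Measure.sum (fun x : C =>
      ENNReal.ofReal (Real.exp (birkhoff T φ n x)) • Measure.dirac (empirical T (x : X) n))

/-! ### Large deviations notions -/

variable {Y : Type*}

/-- The large deviation principle for a sequence of (sub)probability measures with rate
function `J`. -/
def HasLDP [TopologicalSpace Y] [MeasurableSpace Y] (μ : ℕ → Measure Y) (J : Y → EReal) : Prop :=
  (∀ G : Set Y, IsOpen G →
      -(⨅ y ∈ G, J y) ≤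
        atTop.liminf fun n : ℕ => (((n : ℝ)⁻¹ : ℝ) : EReal) * ENNReal.log (μ n G)) ∧
  (∀ K : Set Y, IsClosed K →
      atTop.limsup (fun n : ℕ => (((n : ℝ)⁻¹ : ℝ) : EReal) * ENNReal.log (μ n K)) ≤
        -(⨅ y ∈ K, J y))

/-- Exponential tightness of a sequence of measures. -/
def ExpTight [TopologicalSpace Y] [MeasurableSpace Y] (μ : ℕ → Measure Y) : Prop :=
  ∀ L : ℝ, 0 < L → ∃ K : Set Y, IsCompact K ∧
    atTop.limsup (fun n : ℕ => (((n : ℝ)⁻¹ : ℝ) : EReal) * ENNReal.log (μ n Kᶜ)) ≤ ((-L : ℝ) : EReal)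

/-- A good rate function: lower semicontinuous with compact sublevel sets. -/
def GoodRate [TopologicalSpace Y] (J : Y → EReal) : Prop :=
  LowerSemicontinuous J ∧ ∀ α : ℝ, 0 ≤ α → IsCompact {y | J y ≤ (α : EReal)}

/-- The rate function `I(μ) = - inf_{G ∋ μ} sup_G F`. -/
noncomputable def rateOf [TopologicalSpace Y] (F : Y → EReal) (μ : Y) : EReal :=
  -(⨅ (G : Set Y) (_ : IsOpen G ∧ μ ∈ G), ⨆ ν ∈ G, F ν)

/-- The convex combination `t μ + (1-t) ν` of two probability measures. -/
noncomputable def mix [MeasurableSpace X] (t : ℝ) (h0 : 0 ≤ t) (h1 : t ≤ 1)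
    (μ ν : ProbabilityMeasure X) : ProbabilityMeasure X :=
  ⟨ENNReal.ofReal t • (μ : Measure X) + ENNReal.ofReal (1 - t) • (ν : Measure X), by
    refine ⟨?_⟩
    simp only [Measure.add_apply, Measure.smul_apply, smul_eq_mul, measure_univ, mul_one]
    rw [← ENNReal.ofReal_add h0 (by linarith)]
    norm_num⟩

/-- Convexity of a rate function on probability measures. -/
def ConvexRate [MeasurableSpace X] (J : ProbabilityMeasure X → EReal) : Prop :=
  ∀ μ ν : ProbabilityMeasure X, ∀ t : ℝ, ∀ (h0 : 0 ≤ t) (h1 : t ≤ 1),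
    J (mix t h0 h1 μ ν) ≤ ((t : ℝ) : EReal) * J μ + ((1 - t : ℝ) : EReal) * J ν

-- The free energy functional `F`.
open Classical in
noncomputable def freeEnergy [MeasurableSpace X] (T : X → X) (φ : X → ℝ) (P : ℝ)
    (ν : ProbabilityMeasure X) : EReal :=
  if Invariant T (ν : Measure X) ∧ IntegralGtBot φ (ν : Measure X)
  then ((entropy T (ν : Measure X) : ℝ≥0∞) : EReal) + eintegral φ (ν : Measure X) - ((P : ℝ) : EReal)
  else ⊥

/-! ### Countable Markov shifts -/

variable {S : Type*}

/-- The topological Markov shift with alphabet `S` and transition relation `A`. -/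
def Space (A : S → S → Prop) : Type _ := {x : ℕ → S // ∀ i, A (x i) (x (i + 1))}

variable (A : S → S → Prop)

instance [TopologicalSpace S] : TopologicalSpace (Space A) :=
  inferInstanceAs (TopologicalSpace {x : ℕ → S // ∀ i, A (x i) (x (i + 1))})

noncomputable instance [TopologicalSpace S] : MeasurableSpace (Space A) := borel _

instance [TopologicalSpace S] : BorelSpace (Space A) := ⟨rfl⟩

/-- The left shift. -/
def shift : Space A → Space A := fun x => ⟨fun i => x.1 (i + 1), fun i => x.2 (i + 1)⟩

/-- Admissible words. -/
def Admissible (w : List S) : Prop := w ≠ [] ∧ w.Chain' A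

/-- The cylinder set of a word. -/
def cylinder (w : List S) : Set (Space A) := {x | ∀ i : Fin w.length, x.1 i = w.get i}

variable {A}

/-- The initial word of length `n` of a point. -/
def word (x : Space A) (n : ℕ) : List S := List.ofFn (fun i : Fin n => x.1 i)

variable (A)

/-- `μ` is a Gibbs state for the potential `φ` with constants `c₀` and `P`. -/
def IsGibbsWith [TopologicalSpace S] (φ : Space A → ℝ) (μ : Measure (Space A)) (c₀ P : ℝ) :
    Prop :=
  ∀ n : ℕ, 1 ≤ n → ∀ x : Space A,
    c₀⁻¹ * Real.exp (-(P * n) + birkhoff (shift A) φ n x)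
        ≤ (μ (cylinder A (word x n))).toReal ∧
      (μ (cylinder A (word x n))).toReal
        ≤ c₀ * Real.exp (-(P * n) + birkhoff (shift A) φ n x)

/-- `μ` is a Gibbs state for `φ`. -/
def IsGibbs [TopologicalSpace S] (φ : Space A → ℝ) (μ : Measure (Space A)) : Prop :=
  ∃ c₀ P : ℝ, 1 ≤ c₀ ∧ IsGibbsWith A φ μ c₀ P

/-- The transition matrix has no row or column identically zero. -/
def NoZeroRowCol : Prop := (∀ a : S, ∃ b, A a b) ∧ ∀ b : S, ∃ a, A a b

/-- Finite irreducibility. -/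
def FinitelyIrreducible : Prop :=
  ∃ Λ : Finset (List S), ∀ v w : List S, Admissible A v → Admissible A w →
    ∃ l ∈ Λ, Admissible A (v ++ l ++ w)

/-- Finite primitiveness. -/
def FinitelyPrimitive : Prop :=
  ∃ Λ : Finset (List S), (∃ N : ℕ, ∀ l ∈ Λ, l.length = N) ∧
    ∀ v w : List S, Admissible A v → Admissible A w →
      ∃ l ∈ Λ, Admissible A (v ++ l ++ w)

/-- Topological transitivity. -/
def TopTransitive : Prop :=
  ∀ a b : S, ∃ n : ℕ, 1 ≤ n ∧
    (cylinder A [a] ∩ (shift A)^[n] ⁻¹' (cylinder A [b])).Nonempty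

/-- Varadhan's functional `Q(ψ) = sup_μ (∫ψ dμ - I(μ))`. -/
noncomputable def varQ {X : Type*} [MeasurableSpace X] (I : ProbabilityMeasure X → EReal)
    (ψ : X → ℝ) : EReal :=
  ⨆ μ : ProbabilityMeasure X, (((∫ x, ψ x ∂(μ : Measure X)) : ℝ) : EReal) - I μ

/-- `φ` is uniformly continuous for the standard metric of the shift space. -/
def UnifCont (φ : Space A → ℝ) : Prop :=
  ∀ ε : ℝ, 0 < ε → ∃ N : ℕ, ∀ x y : Space A, (∀ i < N, x.1 i = y.1 i) → |φ x - φ y| ≤ ε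

/-- `φ` is bounded. -/
def Bdd (φ : Space A → ℝ) : Prop := ∃ C : ℝ, ∀ x : Space A, |φ x| ≤ C

end CMS

namespace CMS

/-! ### Entropy of countable partitions -/

/-- The function `x ↦ -x log x` on extended nonnegative reals. -/
noncomputable def etaFn (x : ℝ≥0∞) : ℝ≥0∞ :=
  ENNReal.ofReal (-(x.toReal * Real.log x.toReal))

lemma partitionEntropy_eq {X α : Type*} [MeasurableSpace X] (μ : Measure X) (g : X → α) :
    partitionEntropy μ g = ∑' a, etaFn (μ (g ⁻¹' {a})) := rfl

lemma etaFn_eq_mul {x : ℝ≥0∞} (hx : x ≤ 1) :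
    etaFn x = x * ENNReal.ofReal (-Real.log x.toReal) := by
  have hx' : x ≠ ⊤ := (hx.trans_lt ENNReal.one_lt_top).ne
  rw [etaFn, ← mul_neg, ENNReal.ofReal_mul ENNReal.toReal_nonneg, ENNReal.ofReal_toReal hx']

lemma etaFn_tsum_le {ι : Type*} (x : ι → ℝ≥0∞) (hx : ∑' i, x i ≤ 1) :
    etaFn (∑' i, x i) ≤ ∑' i, etaFn (x i) := by
  rw [etaFn_eq_mul hx, ← ENNReal.tsum_mul_right]
  refine ENNReal.tsum_le_tsum fun i => ?_
  have h1 : x i ≤ ∑' i, x i := ENNReal.le_tsum i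
  rw [etaFn_eq_mul (h1.trans hx)]
  rcases eq_or_ne (x i) 0 with h0 | h0
  · simp [h0]
  · have ht : (∑' i, x i) ≠ ⊤ := (hx.trans_lt ENNReal.one_lt_top).ne
    have hp : 0 < (x i).toReal := ENNReal.toReal_pos h0 (h1.trans_lt ht.lt_top).ne
    have hm : (x i).toReal ≤ (∑' i, x i).toReal := ENNReal.toReal_mono ht h1
    gcongr

lemma measure_preimage_preimage_singleton {X α β : Type*} [MeasurableSpace X] [Countable α]
    (μ : Measure X) (g : X → α) (hg : ∀ a, MeasurableSet (g ⁻¹' {a})) (f : α → β) (b : β) :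
    μ ((fun x => f (g x)) ⁻¹' {b}) = ∑' a : (f ⁻¹' {b} : Set α), μ (g ⁻¹' {(a : α)}) := by
  rw [← measure_iUnion]
  · congr 1
    ext x
    simp
  · intro a a' haa'
    refine Set.disjoint_left.2 fun x hx hx' => haa' (Subtype.ext ?_)
    exact (hx : g x = a).symm.trans hx'
  · exact fun a => hg a

lemma partitionEntropy_comp_le {X α β : Type*} [MeasurableSpace X] [Countable α]
    (μ : Measure X) [IsProbabilityMeasure μ] (g : X → α) (hg : ∀ a, MeasurableSet (g ⁻¹' {a}))
    (f : α → β) : partitionEntropy μ (fun x => f (g x)) ≤ partitionEntropy μ g := by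
  rw [partitionEntropy_eq, partitionEntropy_eq]
  calc ∑' b, etaFn (μ ((fun x => f (g x)) ⁻¹' {b}))
      ≤ ∑' b, ∑' a : (f ⁻¹' {b} : Set α), etaFn (μ (g ⁻¹' {(a : α)})) := by
        refine ENNReal.tsum_le_tsum fun b => ?_
        have h := measure_preimage_preimage_singleton μ g hg f b
        rw [h]
        exact etaFn_tsum_le _ (h ▸ prob_le_one)
    _ = ∑' a, etaFn (μ (g ⁻¹' {a})) := by
        rw [← ENNReal.tsum_sigma' (fun p : Σ b, (f ⁻¹' {b} : Set α) => etaFn (μ (g ⁻¹' {(p.2 : α)})))]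
        exact (Equiv.sigmaFiberEquiv f).tsum_eq (fun a => etaFn (μ (g ⁻¹' {a})))

lemma tsum_measure_preimage_singleton {X α : Type*} [MeasurableSpace X] [Countable α]
    (μ : Measure X) (g : X → α) (hg : ∀ a, MeasurableSet (g ⁻¹' {a})) :
    ∑' a, μ (g ⁻¹' {a}) = μ univ := by
  rw [← measure_iUnion]
  · congr 1
    ext x
    simp
  · intro a a' haa'
    refine Set.disjoint_left.2 fun x hx hx' => haa' ?_
    exact (hx : g x = a).symm.trans hx'
  · exact fun a => hg a

lemma tsum_measure_inter_preimage_singleton {X α : Type*} [MeasurableSpace X] [Countable α]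
    (μ : Measure X) (g : X → α) (hg : ∀ a, MeasurableSet (g ⁻¹' {a})) (B : Set X)
    (hB : MeasurableSet B) :
    ∑' a, μ (B ∩ g ⁻¹' {a}) = μ B := by
  rw [← measure_iUnion]
  · congr 1
    ext x
    simp
  · intro a a' haa'
    refine Set.disjoint_left.2 fun x hx hx' => haa' ?_
    exact (hx.2 : g x = a).symm.trans hx'.2
  · exact fun a => hB.inter (hg a)

lemma etaFn_add_le {r p q : ℝ≥0∞} (hp : p ≤ 1) (hq : q ≤ 1) (hrp : r ≤ p) (hrq : r ≤ q) :
    etaFn r + r ≤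
      (r * ENNReal.ofReal (-Real.log p.toReal) + r * ENNReal.ofReal (-Real.log q.toReal)) + p * q := by
  rcases eq_or_ne r 0 with h0 | h0
  · simp [h0, etaFn]
  have hpt : p ≠ ⊤ := (hp.trans_lt ENNReal.one_lt_top).ne
  have hqt : q ≠ ⊤ := (hq.trans_lt ENNReal.one_lt_top).ne
  have hrt : r ≠ ⊤ := (hrp.trans_lt hpt.lt_top).ne
  have hr0 : 0 < r.toReal := ENNReal.toReal_pos h0 hrt
  have hp0 : 0 < p.toReal := hr0.trans_le (ENNReal.toReal_mono hpt hrp)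
  have hq0 : 0 < q.toReal := hr0.trans_le (ENNReal.toReal_mono hqt hrq)
  have hp1 : p.toReal ≤ 1 := ENNReal.toReal_mono ENNReal.one_ne_top hp
  have hq1 : q.toReal ≤ 1 := ENNReal.toReal_mono ENNReal.one_ne_top hq
  have hr1 : r.toReal ≤ 1 := ENNReal.toReal_mono ENNReal.one_ne_top (hrp.trans hp)
  have lp : 0 ≤ -Real.log p.toReal := by linarith [Real.log_nonpos hp0.le hp1]
  have lq : 0 ≤ -Real.log q.toReal := by linarith [Real.log_nonpos hq0.le hq1]
  have lr : 0 ≤ -Real.log r.toReal := by linarith [Real.log_nonpos hr0.le hr1]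
  have key : -(r.toReal * Real.log r.toReal) + r.toReal ≤
      (r.toReal * (-Real.log p.toReal) + r.toReal * (-Real.log q.toReal)) + p.toReal * q.toReal := by
    have h := Real.log_le_sub_one_of_pos (x := p.toReal * q.toReal / r.toReal) (by positivity)
    rw [Real.log_div (by positivity) hr0.ne', Real.log_mul hp0.ne' hq0.ne'] at h
    have h2 := mul_le_mul_of_nonneg_left h hr0.le
    have h3 : r.toReal * (p.toReal * q.toReal / r.toReal - 1) = p.toReal * q.toReal - r.toReal := by
      field_simp
    rw [h3] at h2
    nlinarith
  have := ENNReal.ofReal_le_ofReal key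
  rw [ENNReal.ofReal_add (by nlinarith) hr0.le, ENNReal.ofReal_add (by positivity) (by positivity),
    ENNReal.ofReal_add (by positivity) (by positivity), ENNReal.ofReal_mul hr0.le,
    ENNReal.ofReal_mul hr0.le, ENNReal.ofReal_mul hp0.le, ENNReal.ofReal_toReal hrt,
    ENNReal.ofReal_toReal hpt, ENNReal.ofReal_toReal hqt] at this
  exact this

lemma partitionEntropy_prod_le {X α β : Type*} [MeasurableSpace X] [Countable α] [Countable β]
    (μ : Measure X) [IsProbabilityMeasure μ] (g : X → α) (hg : ∀ a, MeasurableSet (g ⁻¹' {a}))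
    (h : X → β) (hh : ∀ a, MeasurableSet (h ⁻¹' {a})) :
    partitionEntropy μ (fun x => (g x, h x)) ≤ partitionEntropy μ g + partitionEntropy μ h := by
  have hset : ∀ a b, (fun x => (g x, h x)) ⁻¹' {(a, b)} = g ⁻¹' {a} ∩ h ⁻¹' {b} := by
    intro a b; ext x; simp
  set r : α → β → ℝ≥0∞ := fun a b => μ (g ⁻¹' {a} ∩ h ⁻¹' {b}) with hr
  set p : α → ℝ≥0∞ := fun a => μ (g ⁻¹' {a})
  set q : β → ℝ≥0∞ := fun b => μ (h ⁻¹' {b})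
  have hrow : ∀ a, ∑' b, r a b = p a := fun a =>
    tsum_measure_inter_preimage_singleton μ h hh _ (hg a)
  have hcol : ∀ b, ∑' a, r a b = q b := fun b => by
    have := tsum_measure_inter_preimage_singleton μ g hg _ (hh b)
    simpa only [hr, Set.inter_comm] using this
  have hp1 : ∑' a, p a = 1 := by rw [tsum_measure_preimage_singleton μ g hg, measure_univ]
  have hq1 : ∑' a, q a = 1 := by rw [tsum_measure_preimage_singleton μ h hh, measure_univ]
  have hr1 : ∑' a, ∑' b, r a b = 1 := by simp_rw [hrow, hp1]
  have e1 : partitionEntropy μ (fun x => (g x, h x)) = ∑' a, ∑' b, etaFn (r a b) := by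
    rw [partitionEntropy_eq, ENNReal.tsum_prod']
    simp_rw [hset, hr]
  have e2 : partitionEntropy μ g
      = ∑' a, ∑' b, r a b * ENNReal.ofReal (-Real.log (p a).toReal) := by
    rw [partitionEntropy_eq]
    refine tsum_congr fun a => ?_
    rw [ENNReal.tsum_mul_right, hrow, etaFn_eq_mul prob_le_one]
  have e3 : partitionEntropy μ h
      = ∑' a, ∑' b, r a b * ENNReal.ofReal (-Real.log (q b).toReal) := by
    rw [partitionEntropy_eq, ENNReal.tsum_comm]
    refine tsum_congr fun b => ?_
    rw [ENNReal.tsum_mul_right, hcol, etaFn_eq_mul prob_le_one]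
  have e4 : ∑' a, ∑' b, p a * q b = 1 := by
    simp_rw [ENNReal.tsum_mul_left, hq1, mul_one, hp1]
  have key : (∑' a, ∑' b, etaFn (r a b)) + 1 ≤ (partitionEntropy μ g + partitionEntropy μ h) + 1 := by
    rw [e2, e3]
    nth_rw 1 [← hr1]
    rw [← e4]
    simp_rw [← ENNReal.tsum_add]
    refine ENNReal.tsum_le_tsum fun a => ENNReal.tsum_le_tsum fun b => ?_
    exact etaFn_add_le prob_le_one prob_le_one (measure_mono Set.inter_subset_left)
      (measure_mono Set.inter_subset_right)
  rw [e1]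
  exact (ENNReal.add_le_add_iff_right ENNReal.one_ne_top).1 key

lemma measurableSet_preimage_itinerary {X α : Type*} [MeasurableSpace X] {T : X → X}
    (hT : Measurable T) {g : X → α} (hg : ∀ a, MeasurableSet (g ⁻¹' {a})) (n : ℕ)
    (w : Fin n → α) : MeasurableSet ((fun x => fun i : Fin n => g (T^[i] x)) ⁻¹' {w}) := by
  have : (fun x => fun i : Fin n => g (T^[i] x)) ⁻¹' {w}
      = ⋂ i : Fin n, (T^[i]) ⁻¹' (g ⁻¹' {w i}) := by
    ext x
    simp [funext_iff]
  rw [this]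
  exact MeasurableSet.iInter fun i => (hT.iterate i) (hg _)

lemma Invariant.iterate {X : Type*} [MeasurableSpace X] {T : X → X} (hT : Measurable T)
    {μ : Measure X} (hμ : Invariant T μ) (n : ℕ) : μ.map T^[n] = μ := by
  have : MeasurePreserving T μ μ := ⟨hT, hμ⟩
  exact (this.iterate n).map_eq

lemma partitionEntropy_map {X Y α : Type*} [MeasurableSpace X] [MeasurableSpace Y] {T : X → Y}
    (hT : Measurable T) (μ : Measure X) {g : Y → α} (hg : ∀ a, MeasurableSet (g ⁻¹' {a})) :
    partitionEntropy (μ.map T) g = partitionEntropy μ (fun x => g (T x)) := by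
  simp_rw [partitionEntropy_eq]
  refine tsum_congr fun a => ?_
  rw [Measure.map_apply hT (hg a)]
  rfl

lemma partitionEntropy_itinerary_le {X α : Type*} [MeasurableSpace X] [Countable α] {T : X → X}
    (hT : Measurable T) {μ : Measure X} [IsProbabilityMeasure μ] (hμ : Invariant T μ)
    {g : X → α} (hg : ∀ a, MeasurableSet (g ⁻¹' {a})) (n : ℕ) :
    partitionEntropy μ (fun x => fun i : Fin n => g (T^[i] x)) ≤ n * partitionEntropy μ g := by
  induction n with
  | zero =>
    rw [partitionEntropy_eq]
    have : ∀ a : Fin 0 → α, (fun x => fun i : Fin 0 => g (T^[i] x)) ⁻¹' {a} = univ := by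
      exact fun a => Set.eq_univ_of_forall fun x => Subsingleton.elim _ _
    simp [etaFn, this]
  | succ n ih =>
    have h1 := partitionEntropy_comp_le μ
      (fun x => ((fun i : Fin n => g (T^[i] x)), g (T^[n] x)))
      (by
        rintro ⟨w, a⟩
        have : (fun x => ((fun i : Fin n => g (T^[i] x)), g (T^[n] x))) ⁻¹' {(w, a)}
          = ((fun x => fun i : Fin n => g (T^[i] x)) ⁻¹' {w}) ∩ (T^[n] ⁻¹' (g ⁻¹' {a})) := by
          ext x; simp
        rw [this]
        exact (measurableSet_preimage_itinerary hT hg n w).inter ((hT.iterate n) (hg a)))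
      (fun p => (Fin.snoc p.1 p.2 : Fin (n + 1) → α))
    have h2 : (fun x => (Fin.snoc (fun i : Fin n => g (T^[i] x)) (g (T^[n] x)) : Fin (n + 1) → α))
        = fun x => fun i : Fin (n + 1) => g (T^[i] x) := by
      funext x i
      refine Fin.lastCases ?_ (fun j => ?_) i
      · simp
      · simp
    simp only [h2] at h1
    refine h1.trans ((partitionEntropy_prod_le μ _ (measurableSet_preimage_itinerary hT hg n)
      (fun x => g (T^[n] x)) (fun a => (hT.iterate n) (hg a))).trans ?_)
    have h3 : partitionEntropy μ (fun x => g (T^[n] x)) = partitionEntropy μ g := by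
      rw [← partitionEntropy_map (hT.iterate n) μ hg, hμ.iterate hT]
    rw [h3]
    push_cast
    rw [add_mul, one_mul]
    gcongr

lemma etaFn_sum_ge {ι : Type*} (s : Finset ι) (c x : ι → ℝ≥0∞) (hc : ∑ i ∈ s, c i = 1)
    (hx : ∀ i ∈ s, x i ≤ 1) : ∑ i ∈ s, c i * etaFn (x i) ≤ etaFn (∑ i ∈ s, c i * x i) := by
  have hct : ∀ i ∈ s, c i ≠ ⊤ := fun i hi =>
    ((Finset.single_le_sum (f := c) (fun _ _ => bot_le) hi).trans_lt
      (hc ▸ ENNReal.one_lt_top)).ne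
  have hxt : ∀ i ∈ s, x i ≠ ⊤ := fun i hi => ((hx i hi).trans_lt ENNReal.one_lt_top).ne
  have e1 : (∑ i ∈ s, c i * x i).toReal = ∑ i ∈ s, (c i).toReal • (x i).toReal := by
    rw [ENNReal.toReal_sum fun i hi => ENNReal.mul_ne_top (hct i hi) (hxt i hi)]
    simp
  have e2 : ∑ i ∈ s, c i * etaFn (x i)
      = ENNReal.ofReal (∑ i ∈ s, (c i).toReal • Real.negMulLog (x i).toReal) := by
    rw [ENNReal.ofReal_sum_of_nonneg]
    · refine Finset.sum_congr rfl fun i hi => ?_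
      rw [smul_eq_mul, ENNReal.ofReal_mul ENNReal.toReal_nonneg, ENNReal.ofReal_toReal (hct i hi),
        Real.negMulLog, etaFn, neg_mul]
    · intro i hi
      exact mul_nonneg ENNReal.toReal_nonneg (Real.negMulLog_nonneg ENNReal.toReal_nonneg
        (ENNReal.toReal_mono ENNReal.one_ne_top (hx i hi)))
  rw [e2, etaFn, e1]
  refine ENNReal.ofReal_le_ofReal ?_
  rw [← neg_mul]
  refine Real.concaveOn_negMulLog.le_map_sum (fun _ _ => ENNReal.toReal_nonneg) ?_
    (fun _ _ => ENNReal.toReal_nonneg)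
  rw [← ENNReal.toReal_sum hct, hc, ENNReal.toReal_one]

lemma partitionEntropy_sum_ge {X α ι : Type*} [MeasurableSpace X] (s : Finset ι) (c : ι → ℝ≥0∞)
    (hc : ∑ i ∈ s, c i = 1) (μ : ι → Measure X) (hμ : ∀ i ∈ s, IsProbabilityMeasure (μ i))
    (g : X → α) :
    ∑ i ∈ s, c i * partitionEntropy (μ i) g ≤ partitionEntropy (∑ i ∈ s, c i • μ i) g := by
  simp_rw [partitionEntropy_eq, ← ENNReal.tsum_mul_left]
  rw [← Summable.tsum_finsetSum fun _ _ => ENNReal.summable]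
  refine ENNReal.tsum_le_tsum fun a => ?_
  rw [Measure.finsetSum_apply]
  simp only [Measure.smul_apply, smul_eq_mul]
  exact etaFn_sum_ge s c _ hc fun i hi => by
    have := hμ i hi
    exact prob_le_one

lemma liminf_add_liminf_le (u v : ℕ → ℝ≥0∞) :
    liminf u atTop + liminf v atTop ≤ liminf (fun n => u n + v n) atTop := by
  simp_rw [liminf_eq_iSup_iInf_of_nat]
  have hm : ∀ w : ℕ → ℝ≥0∞, Monotone fun n => ⨅ i ≥ n, w i := fun w n m hnm =>
    le_iInf₂ fun i hi => iInf₂_le i (le_trans hnm hi)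
  rw [ENNReal.iSup_add_iSup_of_monotone (hm u) (hm v)]
  exact iSup_mono fun n => le_iInf₂ fun i hi => add_le_add (iInf₂_le i hi) (iInf₂_le i hi)

/-- Kolmogorov–Sinaĭ entropy is concave. -/
lemma entropy_mix_ge {X : Type*} [MeasurableSpace X] {T : X → X} (hT : Measurable T)
    (μ ν : ProbabilityMeasure X) (t : ℝ) (h0 : 0 ≤ t) (h1 : t ≤ 1) :
    ENNReal.ofReal t * entropy T (μ : Measure X) + ENNReal.ofReal (1 - t) * entropy T (ν : Measure X)
      ≤ entropy T (mix t h0 h1 μ ν : Measure X) := by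
  conv_lhs => unfold entropy
  simp_rw [ENNReal.mul_iSup]
  have hne : ∃ p : X → ℕ, Measurable p ∧ (Set.range p).Finite :=
    ⟨fun _ => 0, measurable_const, Set.finite_range_const⟩
  refine ENNReal.biSup_add_biSup_le' hne hne ?_
  rintro p ⟨hp, hpf⟩ q ⟨hq, hqf⟩
  have hpq : Measurable (fun x => Nat.pair (p x) (q x)) :=
    (measurable_of_countable (fun z : ℕ × ℕ => Nat.pair z.1 z.2)).comp (hp.prodMk hq)
  refine le_trans ?_ (le_iSup₂_of_le (fun x => Nat.pair (p x) (q x)) ⟨hpq, ?_⟩ le_rfl)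
  · rw [← ENNReal.liminf_const_mul_of_ne_top ENNReal.ofReal_ne_top,
      ← ENNReal.liminf_const_mul_of_ne_top ENNReal.ofReal_ne_top]
    refine (liminf_add_liminf_le _ _).trans (liminf_le_liminf (Eventually.of_forall fun n => ?_))
    have hm := measurableSet_preimage_itinerary hT
      (fun a => hpq (measurableSet_singleton a)) n
    have key : ∀ θ : ProbabilityMeasure X, ∀ f : ℕ → ℕ,
        partitionEntropy (θ : Measure X)
          (fun x => fun i : Fin n => f (Nat.pair (p (T^[i] x)) (q (T^[i] x))))
        ≤ partitionEntropy (θ : Measure X)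
          (fun x => fun i : Fin n => Nat.pair (p (T^[i] x)) (q (T^[i] x))) :=
      fun θ f => partitionEntropy_comp_le (θ : Measure X) _ hm (fun w i => f (w i))
    have k1 := key μ (fun a => a.unpair.1)
    have k2 := key ν (fun a => a.unpair.2)
    simp only [Nat.unpair_pair] at k1 k2
    have k3 := partitionEntropy_sum_ge (Finset.univ : Finset Bool)
      (fun b => cond b (ENNReal.ofReal t) (ENNReal.ofReal (1 - t)))
      (by simp [← ENNReal.ofReal_add h0 (sub_nonneg.2 h1)])
      (fun b => cond b (μ : Measure X) (ν : Measure X))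
      (by rintro (_ | _) _ <;> simp <;> infer_instance)
      (fun x => fun i : Fin n => Nat.pair (p (T^[i] x)) (q (T^[i] x)))
    simp only [Fintype.sum_bool, cond_true, cond_false] at k3
    calc _ = ENNReal.ofReal (n : ℝ)⁻¹ *
          (ENNReal.ofReal t * partitionEntropy (μ : Measure X) (fun x => fun i : Fin n => p (T^[i] x))
            + ENNReal.ofReal (1 - t) *
              partitionEntropy (ν : Measure X) (fun x => fun i : Fin n => q (T^[i] x))) := by ring
      _ ≤ _ := by
        refine mul_le_mul_right (le_trans ?_ k3) _
        gcongr
  · refine (hpf.image2 Nat.pair hqf).subset ?_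
    rintro _ ⟨x, rfl⟩
    exact ⟨p x, ⟨x, rfl⟩, q x, ⟨x, rfl⟩, rfl⟩

/-! ### Product weights -/

lemma sum_prod_fin_succ {ι R : Type*} [Fintype ι] [CommSemiring R] (q : ι → R) (k : ℕ)
    (F : (Fin (k + 1) → ι) → R) :
    ∑ w : Fin (k + 1) → ι, (∏ i, q (w i)) * F w
      = ∑ a, q a * ∑ w : Fin k → ι, (∏ i, q (w i)) * F (Fin.cons a w) := by
  rw [← (Fin.consEquiv (fun _ : Fin (k + 1) => ι)).sum_comp, Fintype.sum_prod_type]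
  refine Finset.sum_congr rfl fun a _ => ?_
  rw [Finset.mul_sum]
  refine Finset.sum_congr rfl fun w _ => ?_
  simp [Fin.consEquiv, Fin.prod_univ_succ, mul_assoc]

lemma sum_prod_fin {ι : Type*} [Fintype ι] (q : ι → ℝ) (hq : ∑ a, q a = 1) (k : ℕ) :
    ∑ w : Fin k → ι, ∏ i, q (w i) = 1 := by
  induction k with
  | zero => simp
  | succ k ih =>
    have h := sum_prod_fin_succ q k (fun _ => 1)
    simp only [mul_one] at h
    rw [h, ih]
    simp [hq]

lemma sum_prod_mul_sum_fin {ι : Type*} [Fintype ι] (q : ι → ℝ) (hq : ∑ a, q a = 1) (f : ι → ℝ)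
    (k : ℕ) :
    ∑ w : Fin k → ι, (∏ i, q (w i)) * ∑ i, f (w i) = k * ∑ a, q a * f a := by
  induction k with
  | zero => simp
  | succ k ih =>
    rw [sum_prod_fin_succ]
    simp only [Fin.sum_univ_succ, Fin.cons_zero, Fin.cons_succ, mul_add, Finset.sum_add_distrib, ih,
      ← Finset.sum_mul, sum_prod_fin q hq, one_mul, hq]
    push_cast
    ring

lemma sum_prod_mul_sq_fin {ι : Type*} [Fintype ι] (q : ι → ℝ) (hq : ∑ a, q a = 1) (f : ι → ℝ)
    (hf : ∑ a, q a * f a = 0) (k : ℕ) :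
    ∑ w : Fin k → ι, (∏ i, q (w i)) * (∑ i, f (w i)) ^ 2 = k * ∑ a, q a * f a ^ 2 := by
  induction k with
  | zero => simp
  | succ k ih =>
    rw [sum_prod_fin_succ]
    have : ∀ a, ∑ w : Fin k → ι, (∏ i, q (w i)) * (∑ i, f ((Fin.cons a w : Fin (k + 1) → ι) i)) ^ 2
        = f a ^ 2 + k * ∑ a, q a * f a ^ 2 := by
      intro a
      have e : ∀ w : Fin k → ι, (∏ i, q (w i)) * (∑ i, f ((Fin.cons a w : Fin (k + 1) → ι) i)) ^ 2
          = f a ^ 2 * (∏ i, q (w i)) + 2 * f a * ((∏ i, q (w i)) * ∑ i, f (w i))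
            + (∏ i, q (w i)) * (∑ i, f (w i)) ^ 2 := by
        intro w
        rw [Fin.sum_univ_succ]
        simp only [Fin.cons_zero, Fin.cons_succ]
        ring
      simp_rw [e, Finset.sum_add_distrib, ← Finset.mul_sum]
      rw [sum_prod_fin q hq, sum_prod_mul_sum_fin q hq, ih, hf]
      ring
    simp_rw [this, mul_add, Finset.sum_add_distrib, ← Finset.sum_mul]
    rw [hq]
    push_cast
    ring

/-- Chebyshev's inequality for finite product weights. -/
lemma sum_prod_deviation_le {ι : Type*} [Fintype ι] (q : ι → ℝ) (hq0 : ∀ a, 0 ≤ q a)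
    (hq : ∑ a, q a = 1) (f : ι → ℝ) {ε : ℝ} (hε : 0 < ε) {k : ℕ} (hk : 0 < k) :
    ∑ w : Fin k → ι with ¬ |∑ i, f (w i) - k * ∑ a, q a * f a| ≤ k * ε, ∏ i, q (w i)
      ≤ (∑ a, q a * (f a - ∑ a, q a * f a) ^ 2) / (k * ε ^ 2) := by
  set m := ∑ a, q a * f a
  set f' : ι → ℝ := fun a => f a - m with hf'
  have h0 : ∑ a, q a * f' a = 0 := by
    simp [f', mul_sub, Finset.sum_sub_distrib, ← Finset.sum_mul, hq, m]
  have h := sum_prod_mul_sq_fin q hq f' h0 k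
  have hk' : (0 : ℝ) < k := by exact_mod_cast hk
  have hp : ∀ w : Fin k → ι, 0 ≤ ∏ i, q (w i) := fun w => Finset.prod_nonneg fun i _ => hq0 _
  rw [le_div_iff₀ (by positivity)]
  have h1 : (∑ w : Fin k → ι with ¬ |∑ i, f (w i) - k * m| ≤ k * ε, ∏ i, q (w i)) * (k * ε) ^ 2
      ≤ ∑ w : Fin k → ι, (∏ i, q (w i)) * (∑ i, f' (w i)) ^ 2 := by
    rw [Finset.sum_mul]
    refine (Finset.sum_le_sum fun w hw => ?_).trans
      (Finset.sum_le_sum_of_subset_of_nonneg (Finset.filter_subset _ _) fun w _ _ =>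
        mul_nonneg (hp w) (sq_nonneg _))
    have hw' := not_le.1 (Finset.mem_filter.1 hw).2
    have e : ∑ i, f' (w i) = ∑ i, f (w i) - k * m := by simp [f', Finset.sum_sub_distrib]
    rw [e, ← sq_abs (_ - _)]
    gcongr
    exact hp w
  rw [h] at h1
  have : (∑ w : Fin k → ι with ¬ |∑ i, f (w i) - k * m| ≤ k * ε, ∏ i, q (w i)) * (k * ε ^ 2) * k
      ≤ (∑ a, q a * f' a ^ 2) * k := by nlinarith
  exact le_of_mul_le_mul_right this hk'

/-- The weak law of large numbers for finite product weights, for finitely many observables. -/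
lemma eventually_sum_prod_typical {ι κ : Type*} [Fintype ι] [Fintype κ] (q : ι → ℝ)
    (hq0 : ∀ a, 0 ≤ q a) (hq : ∑ a, q a = 1) (f : κ → ι → ℝ) {ε : ℝ} (hε : 0 < ε) :
    ∀ᶠ k : ℕ in atTop, 1 / 2 ≤
      ∑ w : Fin k → ι with ∀ j, |∑ i, f j (w i) - k * ∑ a, q a * f j a| ≤ k * ε, ∏ i, q (w i) := by
  set Vr : κ → ℝ := fun j => ∑ a, q a * (f j a - ∑ a, q a * f j a) ^ 2 with hV
  have hlim : Tendsto (fun k : ℕ => ∑ j, Vr j / (k * ε ^ 2)) atTop (𝓝 0) := by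
    rw [show (0 : ℝ) = ∑ j : κ, (0 : ℝ) by simp]
    refine tendsto_finsetSum _ fun j _ => ?_
    exact tendsto_const_nhds.div_atTop
      (tendsto_natCast_atTop_atTop.atTop_mul_const (by positivity))
  filter_upwards [hlim.eventually_le_const (show (0 : ℝ) < 1 / 2 by norm_num), eventually_gt_atTop 0]
    with k hk hk0
  have hp : ∀ w : Fin k → ι, 0 ≤ ∏ i, q (w i) := fun w => Finset.prod_nonneg fun i _ => hq0 _
  have h1 := sum_prod_fin q hq k
  rw [← Finset.sum_filter_add_sum_filter_not Finset.univ
    (fun w => ∀ j, |∑ i, f j (w i) - k * ∑ a, q a * f j a| ≤ k * ε)] at h1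
  have h2 : ∑ w : Fin k → ι with ¬ ∀ j, |∑ i, f j (w i) - k * ∑ a, q a * f j a| ≤ k * ε,
      ∏ i, q (w i) ≤ ∑ j, Vr j / (k * ε ^ 2) := by
    refine le_trans ?_ (Finset.sum_le_sum fun j _ => sum_prod_deviation_le q hq0 hq (f j) hε hk0)
    simp_rw [Finset.sum_filter]
    rw [Finset.sum_comm]
    refine Finset.sum_le_sum fun w _ => ?_
    have hn : ∀ j, 0 ≤ (if ¬ |∑ i, f j (w i) - k * ∑ a, q a * f j a| ≤ k * ε
        then ∏ i, q (w i) else 0) := fun j => by split_ifs <;> simp [hp]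
    split_ifs with hw
    · exact Finset.sum_nonneg fun j _ => hn j
    · push Not at hw
      obtain ⟨j, hj⟩ := hw
      refine le_trans ?_ (Finset.single_le_sum (fun j _ => hn j) (Finset.mem_univ j))
      rw [if_pos (not_le.2 hj)]
  linarith

lemma tsum_prod_fin {ι : Type*} (f : ι → ℝ≥0∞) (k : ℕ) :
    ∑' w : Fin k → ι, ∏ i, f (w i) = (∑' a, f a) ^ k := by
  induction k with
  | zero => simp
  | succ k ih =>
    rw [← (Fin.consEquiv (fun _ : Fin (k + 1) => ι)).tsum_eq, ENNReal.tsum_prod', pow_succ',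
      ← ENNReal.tsum_mul_right]
    refine tsum_congr fun a => ?_
    rw [← ih, ← ENNReal.tsum_mul_left]
    refine tsum_congr fun w => ?_
    simp [Fin.consEquiv, Fin.prod_univ_succ]

/-! ### Topology and measurability of the shift space -/

section ShiftSpace

variable {S : Type*} {A : S → S → Prop}

/-- The first `n` coordinates of a point. -/
def pre (n : ℕ) (x : Space A) : Fin n → S := fun i => x.1 i

/-- Two points agree on their first `n` coordinates. -/
def Agree (n : ℕ) (x x' : Space A) : Prop := ∀ i < n, x.1 i = x'.1 i

lemma Agree.refl (n : ℕ) (x : Space A) : Agree n x x := fun _ _ => rfl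

lemma Agree.symm {n : ℕ} {x x' : Space A} (h : Agree n x x') : Agree n x' x :=
  fun i hi => (h i hi).symm

lemma Agree.trans {n : ℕ} {x y z : Space A} (h : Agree n x y) (h' : Agree n y z) : Agree n x z :=
  fun i hi => (h i hi).trans (h' i hi)

lemma Agree.mono {m n : ℕ} (hmn : m ≤ n) {x x' : Space A} (h : Agree n x x') : Agree m x x' :=
  fun i hi => h i (hi.trans_le hmn)

lemma pre_eq_iff {n : ℕ} {x x' : Space A} : pre n x = pre n x' ↔ Agree n x x' := by
  constructor
  · intro h i hi
    exact congrFun h ⟨i, hi⟩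
  · intro h
    funext i
    exact h i i.2

/-- The set `V` depends on the first `r` coordinates only. -/
def DepOn (r : ℕ) (V : Set (Space A)) : Prop := ∀ x x', Agree r x x' → x ∈ V → x' ∈ V

lemma DepOn.eq_preimage {r : ℕ} {V : Set (Space A)} (hV : DepOn r V) :
    V = pre r ⁻¹' (pre r '' V) := by
  refine Set.Subset.antisymm (Set.subset_preimage_image _ _) ?_
  rintro x ⟨x', hx', h⟩
  exact hV x' x (pre_eq_iff.1 h) hx'

lemma DepOn.mono {r r' : ℕ} (hr : r ≤ r') {V : Set (Space A)} (hV : DepOn r V) : DepOn r' V :=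
  fun x x' h => hV x x' (h.mono hr)

lemma depOn_preimage_pre (r : ℕ) (B : Set (Fin r → S)) : DepOn r (pre (A := A) r ⁻¹' B) := by
  intro x x' h hx
  rw [Set.mem_preimage, ← pre_eq_iff.2 h]
  exact hx

lemma shift_iterate_apply (n : ℕ) (x : Space A) (i : ℕ) : ((shift A)^[n] x).1 i = x.1 (n + i) := by
  induction n generalizing x with
  | zero => simp
  | succ n ih =>
    rw [Function.iterate_succ_apply, ih]
    rw [show n + 1 + i = n + i + 1 by omega]
    rfl

lemma agree_shift_iterate {n m : ℕ} {x x' : Space A} (h : Agree (n + m) x x') :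
    Agree m ((shift A)^[n] x) ((shift A)^[n] x') := fun i hi => by
  rw [shift_iterate_apply, shift_iterate_apply]
  exact h _ (by omega)

lemma cylinder_word (n : ℕ) (x : Space A) : cylinder A (word x n) = pre n ⁻¹' {pre n x} := by
  ext z
  simp only [cylinder, word, Set.mem_ofPred_eq, Set.mem_preimage, Set.mem_singleton_iff, pre_eq_iff]
  constructor
  · intro h i hi
    have := h ⟨i, by simpa using hi⟩
    simpa using this
  · intro h i
    have := h i (by simpa using i.2)
    simpa using this

lemma mem_cylinder_singleton {a : S} {x : Space A} : x ∈ cylinder A [a] ↔ x.1 0 = a := by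
  simp [cylinder]

variable [TopologicalSpace S]

lemma continuous_coord (i : ℕ) : Continuous (fun x : Space A => x.1 i) :=
  (continuous_apply i).comp continuous_subtype_val

lemma continuous_pre (n : ℕ) : Continuous (pre (A := A) n) :=
  continuous_pi fun i => continuous_coord i

lemma continuous_shift : Continuous (shift A) :=
  Continuous.subtype_mk (continuous_pi fun i => continuous_coord (i + 1)) _

lemma measurable_shift : Measurable (shift A) := continuous_shift.measurable

lemma exists_depOn_subset {u : Set (Space A)} (hu : IsOpen u) {x : Space A} (hx : x ∈ u) :
    ∃ n, ∀ x', Agree n x x' → x' ∈ u := by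
  obtain ⟨v, hv, rfl⟩ := isOpen_induced_iff.1 hu
  obtain ⟨I, w, hw, hsub⟩ := isOpen_pi_iff.1 hv x.1 hx
  refine ⟨I.sup id + 1, fun x' h => hsub fun i hi => ?_⟩
  rw [← h i (Nat.lt_succ_of_le (Finset.le_sup (f := id) hi))]
  exact (hw i hi).2

variable [DiscreteTopology S]

lemma DepOn.isClopen {r : ℕ} {V : Set (Space A)} (hV : DepOn r V) : IsClopen V := by
  rw [hV.eq_preimage]
  exact (isClopen_discrete _).preimage (continuous_pre r)

lemma DepOn.measurableSet {r : ℕ} {V : Set (Space A)} (hV : DepOn r V) : MeasurableSet V :=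
  hV.isClopen.isOpen.measurableSet

lemma measurableSet_preimage_pre (r : ℕ) (B : Set (Fin r → S)) :
    MeasurableSet (pre (A := A) r ⁻¹' B) := (depOn_preimage_pre r B).measurableSet

lemma isClosedEmbedding_val : Topology.IsClosedEmbedding (fun x : Space A => x.1) := by
  refine Topology.IsClosedEmbedding.subtypeVal ?_
  rw [show {x : ℕ → S | ∀ i, A (x i) (x (i + 1))}
    = ⋂ i, (fun x : ℕ → S => (x i, x (i + 1))) ⁻¹' {p | A p.1 p.2} by ext; simp]
  exact isClosed_iInter fun i => (isClosed_discrete _).preimage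
    ((continuous_apply i).prodMk (continuous_apply (i + 1)))

instance : T2Space (Space A) :=
  inferInstanceAs (T2Space {x : ℕ → S // ∀ i, A (x i) (x (i + 1))})

instance [Countable S] : SecondCountableTopology (Space A) :=
  isClosedEmbedding_val.isEmbedding.secondCountableTopology

instance [Countable S] : TopologicalSpace.PseudoMetrizableSpace (Space A) :=
  isClosedEmbedding_val.isInducing.pseudoMetrizableSpace

instance [Countable S] : HasOuterApproxClosed (Space A) := by
  let _ := TopologicalSpace.pseudoMetrizableSpacePseudoMetric (Space A)
  infer_instance

/-- Weak neighbourhoods are detected by finitely many sets depending on finitely many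
coordinates. -/
lemma exists_finset_depOn_of_mem_isOpen [Countable S] (ν : ProbabilityMeasure (Space A))
    {G : Set (ProbabilityMeasure (Space A))} (hG : IsOpen G) (hν : ν ∈ G) :
    ∃ (r : ℕ) (𝒱 : Finset (Set (Space A))) (ε : ℝ), 0 < ε ∧ (∀ V ∈ 𝒱, DepOn r V) ∧
      ∀ ν' : ProbabilityMeasure (Space A),
        (∀ V ∈ 𝒱, |(ν' : Measure (Space A)).real V - (ν : Measure (Space A)).real V| < ε) →
          ν' ∈ G := by
  classical
  set 𝒮 : Set (Set (Space A)) := {V | ∃ n, ∃ w : Fin n → S, V = pre n ⁻¹' {w}} with h𝒮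
  have hcyl : ∀ n (x : Space A), pre n ⁻¹' {pre n x} ∈ 𝒮 := fun n x => ⟨n, _, rfl⟩
  have hpi : IsPiSystem 𝒮 := by
    rintro _ ⟨n, w, rfl⟩ _ ⟨m, w', rfl⟩ ⟨x, hx, hx'⟩
    have hx : pre n x = w := hx
    have hx' : pre m x = w' := hx'
    subst hx hx'
    refine ⟨max n m, pre _ x, ?_⟩
    ext z
    simp only [Set.mem_inter_iff, Set.mem_preimage, Set.mem_singleton_iff, pre_eq_iff]
    refine ⟨fun h i hi => ?_, fun h => ⟨h.mono (le_max_left _ _), h.mono (le_max_right _ _)⟩⟩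
    rcases lt_max_iff.1 hi with hi | hi
    exacts [h.1 i hi, h.2 i hi]
  have hmeas : ∀ V ∈ 𝒮, MeasurableSet V := by
    rintro _ ⟨n, w, rfl⟩
    exact measurableSet_preimage_pre n _
  have hnhds : ∀ u : Set (Space A), IsOpen u → ∀ x ∈ u, ∃ V ∈ 𝒮, V ∈ 𝓝 x ∧ V ⊆ u := by
    intro u hu x hx
    obtain ⟨n, hn⟩ := exists_depOn_subset hu hx
    refine ⟨_, hcyl n x, ?_, fun z hz => hn z (pre_eq_iff.1 hz).symm⟩
    exact (depOn_preimage_pre n _).isClopen.isOpen.mem_nhds rfl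
  have : Nonempty (Σ n, Fin n → S) := ⟨⟨0, Fin.elim0⟩⟩
  obtain ⟨e, he⟩ := exists_surjective_nat (Σ n, Fin n → S)
  set V : ℕ → Set (Space A) := fun j => pre (e j).1 ⁻¹' {(e j).2} with hV
  have hVdep : ∀ j, DepOn (e j).1 (V j) := fun j => depOn_preimage_pre _ _
  by_contra! hcon
  have hcon' : ∀ n : ℕ, ∃ ν' : ProbabilityMeasure (Space A),
      (∀ j ≤ n, |(ν' : Measure (Space A)).real (V j) - (ν : Measure (Space A)).real (V j)|
        < 1 / (n + 1 : ℝ)) ∧ ν' ∉ G := by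
    intro n
    obtain ⟨ν', h1, h2⟩ := hcon ((Finset.range (n + 1)).sup fun j => (e j).1)
      ((Finset.range (n + 1)).image V) (1 / (n + 1 : ℝ)) (by positivity) (by
        intro V' hV'
        obtain ⟨j, hj, rfl⟩ := Finset.mem_image.1 hV'
        exact (hVdep j).mono (Finset.le_sup (f := fun j => (e j).1) hj))
    exact ⟨ν', fun j hj => h1 _ (Finset.mem_image_of_mem _ (Finset.mem_range.2 (by omega))), h2⟩
  choose ν' h1 h2 using hcon'
  have hlim : Tendsto ν' atTop (𝓝 ν) := by
    refine hpi.tendsto_probabilityMeasure_of_tendsto_of_mem hmeas hnhds ?_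
    rintro _ ⟨n, w, rfl⟩
    obtain ⟨j, hj⟩ := he ⟨n, w⟩
    have hVj : V j = pre n ⁻¹' {w} := by simp only [hV]; rw [hj]
    rw [← hVj, ← NNReal.tendsto_coe, tendsto_iff_dist_tendsto_zero]
    refine squeeze_zero' (Eventually.of_forall fun _ => dist_nonneg) ?_
      tendsto_one_div_add_atTop_nhds_zero_nat
    filter_upwards [eventually_ge_atTop j] with n hn
    exact (h1 n j hn).le
  exact (hlim.eventually (hG.mem_nhds hν)).exists.elim fun n hn => h2 n hn

lemma eventually_measureReal_near [Countable S] (ν : ProbabilityMeasure (Space A)) {r : ℕ}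
    {𝒱 : Finset (Set (Space A))} (h𝒱 : ∀ V ∈ 𝒱, DepOn r V) {ε : ℝ} (hε : 0 < ε) :
    ∀ᶠ ν' : ProbabilityMeasure (Space A) in 𝓝 ν,
      ∀ V ∈ 𝒱, |(ν' : Measure (Space A)).real V - (ν : Measure (Space A)).real V| < ε := by
  rw [eventually_all_finset]
  intro V hV
  have h := ProbabilityMeasure.tendsto_measure_of_isClopen_of_tendsto
    (tendsto_id (x := 𝓝 ν)) (h𝒱 V hV).isClopen
  rw [← NNReal.tendsto_coe] at h
  exact (Metric.tendsto_nhds.1 h ε hε)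

/-- Points whose coordinates are confined to finite sets form a compact set. -/
lemma isCompact_coord_mem (F : ℕ → Finset S) : IsCompact {x : Space A | ∀ i, x.1 i ∈ F i} := by
  have h := isCompact_univ_pi (s := fun i => (F i : Set S)) fun i => (F i).finite_toSet.isCompact
  have h2 := isClosedEmbedding_val (A := A) |>.isCompact_preimage h
  convert! h2 using 1
  ext x
  simp

end ShiftSpace

/-! ### Birkhoff sums and Gibbs states -/

section Birkhoff

variable {X : Type*} (T : X → X) (φ : X → ℝ)

lemma birkhoff_zero (x : X) : birkhoff T φ 0 x = 0 := by simp [birkhoff]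

lemma birkhoff_one (x : X) : birkhoff T φ 1 x = φ x := by simp [birkhoff]

lemma birkhoff_add (n m : ℕ) (x : X) :
    birkhoff T φ (n + m) x = birkhoff T φ n x + birkhoff T φ m (T^[n] x) := by
  simp only [birkhoff, Finset.sum_range_add]
  congr 1
  refine Finset.sum_congr rfl fun i _ => ?_
  rw [← Function.iterate_add_apply, add_comm i n]

end Birkhoff

section Gibbs

variable {S : Type*} {A : S → S → Prop}

/-- The normalized Birkhoff sum `S_n φ - P n`. -/
noncomputable def nsum (φ : Space A → ℝ) (P : ℝ) (n : ℕ) (x : Space A) : ℝ :=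
  birkhoff (shift A) φ n x - P * n

lemma nsum_zero (φ : Space A → ℝ) (P : ℝ) (x : Space A) : nsum φ P 0 x = 0 := by
  simp [nsum, birkhoff_zero]

lemma nsum_add (φ : Space A → ℝ) (P : ℝ) (n m : ℕ) (x : Space A) :
    nsum φ P (n + m) x = nsum φ P n x + nsum φ P m ((shift A)^[n] x) := by
  simp only [nsum, birkhoff_add]
  push_cast
  ring

/-- The total weight of a set of points for the normalized Birkhoff sum. -/
noncomputable def mass (φ : Space A → ℝ) (P : ℝ) (n : ℕ) (D : Set (Space A)) : ℝ≥0∞ :=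
  ∑' x : D, ENNReal.ofReal (Real.exp (nsum φ P n x))

lemma mass_mono (φ : Space A → ℝ) (P : ℝ) (n : ℕ) {D E : Set (Space A)} (h : D ⊆ E) :
    mass φ P n D ≤ mass φ P n E :=
  ENNReal.tsum_mono_subtype (fun x => ENNReal.ofReal (Real.exp (nsum φ P n x))) h

lemma sum_le_mass (φ : Space A → ℝ) (P : ℝ) (n : ℕ) {D : Set (Space A)} {ι : Type*}
    (s : Finset ι) (f : ι → Space A) (hf : ∀ i ∈ s, f i ∈ D)
    (hinj : ∀ i ∈ s, ∀ j ∈ s, f i = f j → i = j) :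
    ∑ i ∈ s, ENNReal.ofReal (Real.exp (nsum φ P n (f i))) ≤ mass φ P n D := by
  rw [← Finset.sum_coe_sort s]
  rw [← tsum_fintype (L := .unconditional _)]
  let e : s → D := fun i => ⟨f i, hf i i.2⟩
  have he : Function.Injective e := fun i j h =>
    Subtype.ext (hinj i i.2 j j.2 (congrArg Subtype.val h))
  exact ENNReal.tsum_comp_le_tsum_of_injective he
    (fun x : D => ENNReal.ofReal (Real.exp (nsum φ P n x)))

variable [TopologicalSpace S] {φ : Space A → ℝ} {μ : Measure (Space A)} {c₀ P : ℝ}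

lemma IsGibbsWith.exp_nsum_le (hc₀ : 1 ≤ c₀) (hG : IsGibbsWith A φ μ c₀ P) {n : ℕ} (hn : 1 ≤ n)
    (x : Space A) : Real.exp (nsum φ P n x) ≤ c₀ * μ.real (pre n ⁻¹' {pre n x}) := by
  have h := (hG n hn x).1
  rw [cylinder_word] at h
  rw [nsum, sub_eq_neg_add, Measure.real]
  rwa [inv_mul_le_iff₀ (by linarith)] at h

lemma IsGibbsWith.le_exp_nsum (hG : IsGibbsWith A φ μ c₀ P) {n : ℕ} (hn : 1 ≤ n)
    (x : Space A) : μ.real (pre n ⁻¹' {pre n x}) ≤ c₀ * Real.exp (nsum φ P n x) := by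
  have h := (hG n hn x).2
  rw [cylinder_word] at h
  rwa [nsum, sub_eq_neg_add, Measure.real]

lemma IsGibbsWith.nsum_le_of_agree (hc₀ : 1 ≤ c₀) (hG : IsGibbsWith A φ μ c₀ P) {n : ℕ}
    {x x' : Space A} (h : Agree n x x') : nsum φ P n x ≤ nsum φ P n x' + 2 * Real.log c₀ := by
  have hl : 0 ≤ Real.log c₀ := Real.log_nonneg hc₀
  rcases Nat.eq_zero_or_pos n with rfl | hn
  · simp only [nsum_zero]; linarith
  have h1 := hG.exp_nsum_le hc₀ hn x
  have h2 := hG.le_exp_nsum hn x'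
  rw [pre_eq_iff.2 h] at h1
  have h3 : Real.exp (nsum φ P n x) ≤ c₀ * (c₀ * Real.exp (nsum φ P n x')) :=
    h1.trans (mul_le_mul_of_nonneg_left h2 (by linarith))
  have h4 := Real.log_le_log (Real.exp_pos _) h3
  rw [Real.log_exp, Real.log_mul (by positivity) (by positivity),
    Real.log_mul (by positivity) (by positivity), Real.log_exp] at h4
  linarith

lemma IsGibbsWith.nsum_le [IsProbabilityMeasure μ] (hc₀ : 1 ≤ c₀) (hG : IsGibbsWith A φ μ c₀ P)
    (n : ℕ) (x : Space A) : nsum φ P n x ≤ Real.log c₀ := by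
  rcases Nat.eq_zero_or_pos n with rfl | hn
  · rw [nsum_zero]; exact Real.log_nonneg hc₀
  have h1 := (hG.exp_nsum_le hc₀ hn x).trans
    (mul_le_of_le_one_right (by linarith) measureReal_le_one)
  rw [← Real.log_exp (nsum φ P n x)]
  exact Real.log_le_log (Real.exp_pos _) h1

lemma IsGibbsWith.le_const [IsProbabilityMeasure μ] (hc₀ : 1 ≤ c₀) (hG : IsGibbsWith A φ μ c₀ P)
    (x : Space A) : φ x ≤ Real.log c₀ + P := by
  have h := hG.nsum_le hc₀ 1 x
  rw [nsum, birkhoff_one] at h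
  push_cast at h
  linarith

variable [DiscreteTopology S] [Countable S]

lemma IsGibbsWith.mass_le [IsProbabilityMeasure μ] (hc₀ : 1 ≤ c₀) (hG : IsGibbsWith A φ μ c₀ P)
    {n : ℕ} (hn : 1 ≤ n) {D : Set (Space A)}
    (hD : ∀ x ∈ D, ∀ x' ∈ D, Agree n x x' → x = x') : mass φ P n D ≤ ENNReal.ofReal c₀ := by
  calc mass φ P n D ≤ ∑' x : D, ENNReal.ofReal c₀ * μ (pre n ⁻¹' {pre n (x : Space A)}) := by
        refine ENNReal.tsum_le_tsum fun x => ?_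
        refine (ENNReal.ofReal_le_ofReal (hG.exp_nsum_le hc₀ hn x)).trans ?_
        rw [ENNReal.ofReal_mul (by linarith), ofReal_measureReal]
    _ = ENNReal.ofReal c₀ * ∑' x : D, μ (pre n ⁻¹' {pre n (x : Space A)}) := ENNReal.tsum_mul_left
    _ ≤ ENNReal.ofReal c₀ * ∑' w : Fin n → S, μ (pre n ⁻¹' {w}) := by
        gcongr
        have hinj : Function.Injective (fun x : D => pre n (x : Space A)) := fun x x' h =>
          Subtype.ext (hD x x.2 x' x'.2 (pre_eq_iff.1 h))
        exact ENNReal.tsum_comp_le_tsum_of_injective hinj (fun w => μ (pre n ⁻¹' {w}))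
    _ = ENNReal.ofReal c₀ := by
        rw [tsum_measure_preimage_singleton μ (pre n) fun w => measurableSet_preimage_pre n _,
          measure_univ, mul_one]

end Gibbs

/-! ### Connecting words -/

section Connect

variable {S : Type*} {A : S → S → Prop}

/-- Any two points can be concatenated, and any initial word can be closed up to a periodic point,
by means of connecting words of length `N` on which the potential is at least `-κ`. -/
structure Connects (φ : Space A → ℝ) (P : ℝ) (N : ℕ) (κ : ℝ) : Prop where
  join : ∀ (x z : Space A) (m : ℕ), 1 ≤ m → ∃ z' : Space A, Agree m z' x ∧
    (shift A)^[m + N] z' = z ∧ -κ ≤ nsum φ P N ((shift A)^[m] z')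
  per : ∀ (x : Space A) (n : ℕ), 1 ≤ n → ∃ x' : Space A, Agree n x' x ∧
    (shift A)^[n + N] x' = x' ∧ -κ ≤ nsum φ P N ((shift A)^[n] x')

lemma space_ext {x x' : Space A} (h : ∀ i, x.1 i = x'.1 i) : x = x' :=
  Subtype.ext (funext h)

lemma admissible_connect {s t : S} {l : List S} (h : Admissible A ([s] ++ l ++ [t])) :
    (∀ h0 : 0 < l.length, A s l[0]) ∧ (∀ i (hi : i + 1 < l.length), A l[i] l[i + 1]) ∧
      (∀ h0 : 0 < l.length, A l[l.length - 1] t) ∧ (l.length = 0 → A s t) := by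
  have h := (List.isChain_iff_getElem.1 h.2)
  refine ⟨fun h0 => ?_, fun i hi => ?_, fun h0 => ?_, fun h0 => ?_⟩
  · have := h 0 (by simp)
    simpa [List.getElem_append, h0] using this
  · have := h (i + 1) (by simp; omega)
    simpa [List.getElem_append, List.getElem_cons, hi, show i < l.length by omega] using this
  · have := h l.length (by simp)
    simpa [List.getElem_append, List.getElem_cons, show l.length ≠ 0 by omega, h0] using this
  · have := h 0 (by simp)
    simpa [List.getElem_append, List.getElem_cons, h0] using this

lemma exists_join {x z : Space A} {m : ℕ} (hm : 1 ≤ m) {l : List S}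
    (hl : Admissible A ([x.1 (m - 1)] ++ l ++ [z.1 0])) :
    ∃ z' : Space A, Agree m z' x ∧ (shift A)^[m + l.length] z' = z ∧
      word ((shift A)^[m] z') l.length = l := by
  obtain ⟨h1, h2, h3, h4⟩ := admissible_connect hl
  let f : ℕ → S := fun i => if i < m then x.1 i else
    if h : i - m < l.length then l[i - m] else z.1 (i - m - l.length)
  have hf : ∀ i, A (f i) (f (i + 1)) := by
    intro i
    rcases lt_or_ge (i + 1) m with hi | hi
    · simp only [f, hi, show i < m by omega, if_true]
      exact x.2 i
    rcases Nat.eq_zero_or_pos l.length with hl0 | hl0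
    · rcases hi.eq_or_lt with rfl | hi
      · simpa [f, hl0] using h4 hl0
      · have e : i + 1 - m = (i - m) + 1 := by omega
        simp only [f, hl0, show ¬ i < m by omega, show ¬ i + 1 < m by omega, if_false]
        simp only [Nat.not_lt_zero, dite_false, e, Nat.sub_zero]
        exact z.2 _
    rcases hi.eq_or_lt with rfl | hi
    · simpa [f, hl0] using h1 hl0
    have hi1 : ¬ i < m := by omega
    have hi2 : ¬ i + 1 < m := by omega
    have e : i + 1 - m = (i - m) + 1 := by omega
    simp only [f, hi1, hi2, if_false]
    rcases lt_trichotomy (i + 1 - m) l.length with hi3 | hi3 | hi3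
    · rw [dif_pos (by omega), dif_pos hi3]
      simp only [e]
      exact h2 _ (by omega)
    · rw [dif_pos (by omega), dif_neg (by omega)]
      have e1 : i - m = l.length - 1 := by omega
      simp only [e1, hi3, Nat.sub_self]
      exact h3 hl0
    · rw [dif_neg (by omega), dif_neg (by omega)]
      rw [show i + 1 - m - l.length = (i - m - l.length) + 1 by omega]
      exact z.2 _
  obtain ⟨z', hz'⟩ : ∃ z' : Space A, ∀ i, z'.1 i = f i := ⟨⟨f, hf⟩, fun _ => rfl⟩
  refine ⟨z', fun i hi => ?_, space_ext fun i => ?_, ?_⟩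
  · simp [hz', f, hi]
  · rw [shift_iterate_apply, hz']
    simp only [f]
    rw [if_neg (show ¬ m + l.length + i < m by omega),
      dif_neg (show ¬ m + l.length + i - m < l.length by omega),
      show m + l.length + i - m - l.length = i by omega]
  · refine List.ext_getElem (by simp [word]) fun i h1 h2 => ?_
    simp [word, shift_iterate_apply, hz', f]

lemma exists_periodic {x : Space A} {n : ℕ} (hn : 1 ≤ n) {l : List S}
    (hl : Admissible A ([x.1 (n - 1)] ++ l ++ [x.1 0])) :
    ∃ x' : Space A, Agree n x' x ∧ (shift A)^[n + l.length] x' = x' ∧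
      word ((shift A)^[n] x') l.length = l := by
  obtain ⟨h1, h2, h3, h4⟩ := admissible_connect hl
  set p := n + l.length with hp
  have hp0 : 0 < p := by omega
  let g : ℕ → S := fun i => if i < n then x.1 i else if h : i - n < l.length then l[i - n] else x.1 0
  have hgp : g p = g 0 := by
    simp only [g]
    rw [if_neg (by omega), dif_neg (by omega), if_pos (by omega)]
  have hg : ∀ i < p, A (g i) (g (i + 1)) := by
    intro i hip
    rcases lt_or_ge (i + 1) n with hi | hi
    · simp only [g, hi, show i < n by omega, if_true]
      exact x.2 i
    rcases Nat.eq_zero_or_pos l.length with hl0 | hl0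
    · have : n = i + 1 := by omega
      subst this
      simpa [g, hl0] using h4 hl0
    rcases hi.eq_or_lt with rfl | hi
    · simpa [g, hl0] using h1 hl0
    have hi1 : ¬ i < n := by omega
    have hi2 : ¬ i + 1 < n := by omega
    have e : i + 1 - n = (i - n) + 1 := by omega
    simp only [g, hi1, hi2, if_false]
    rcases lt_or_ge (i + 1 - n) l.length with hi3 | hi3
    · rw [dif_pos (by omega), dif_pos hi3]
      simp only [e]
      exact h2 _ (by omega)
    · rw [dif_pos (by omega), dif_neg (by omega)]
      have e1 : i - n = l.length - 1 := by omega
      simp only [e1]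
      exact h3 hl0
  let f : ℕ → S := fun i => g (i % p)
  have hf : ∀ i, A (f i) (f (i + 1)) := by
    intro i
    have hlt := Nat.mod_lt i hp0
    have := hg _ hlt
    simp only [f]
    rcases Nat.lt_or_ge (i % p + 1) p with h | h
    · rw [Nat.add_mod_eq_ite]
      have h1p : 1 % p = 1 := Nat.mod_eq_of_lt (by omega)
      rw [h1p, if_neg (by omega)]
      exact this
    · have e : i % p + 1 = p := by omega
      rw [e, hgp] at this
      have e2 : (i + 1) % p = 0 := by
        rw [Nat.add_mod, ← Nat.mod_add_mod, Nat.mod_mod]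
        simp [e]
      rwa [e2]
  obtain ⟨z', hz'⟩ : ∃ z' : Space A, ∀ i, z'.1 i = f i := ⟨⟨f, hf⟩, fun _ => rfl⟩
  refine ⟨z', fun i hi => ?_, space_ext fun i => ?_, ?_⟩
  · simp [hz', f, Nat.mod_eq_of_lt (show i < p by omega), g, hi]
  · rw [shift_iterate_apply, hz', hz']
    simp [f]
  · refine List.ext_getElem (by simp [word]) fun i h1 h2 => ?_
    simp [word, shift_iterate_apply, hz', f, Nat.mod_eq_of_lt (show n + i < p by omega), g, h2]

lemma word_eq_iff {n : ℕ} {x x' : Space A} : word x n = word x' n ↔ Agree n x x' := by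
  rw [word, word, List.ofFn_inj, ← pre_eq_iff]
  rfl

variable [TopologicalSpace S] {φ : Space A → ℝ} {μ : Measure (Space A)} {c₀ P : ℝ}

lemma exists_connects (hprim : FinitelyPrimitive A) (hc₀ : 1 ≤ c₀)
    (hG : IsGibbsWith A φ μ c₀ P) : ∃ (N : ℕ) (κ : ℝ), 0 ≤ κ ∧ Connects φ P N κ := by
  obtain ⟨Λ, ⟨N, hN⟩, hΛ⟩ := hprim
  have h1 : ∀ l : List S, ∃ κ : ℝ, 0 ≤ κ ∧ ∀ x : Space A, word x N = l → -κ ≤ nsum φ P N x := by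
    intro l
    by_cases h : ∃ x₀ : Space A, word x₀ N = l
    · obtain ⟨x₀, hx₀⟩ := h
      refine ⟨|nsum φ P N x₀| + 2 * Real.log c₀, ?_, fun x hx => ?_⟩
      · have := Real.log_nonneg hc₀
        positivity
      · have := hG.nsum_le_of_agree hc₀ (word_eq_iff.1 (hx₀.trans hx.symm))
        linarith [neg_abs_le (nsum φ P N x₀)]
    · exact ⟨0, le_rfl, fun x hx => (h ⟨x, hx⟩).elim⟩
  choose κ hκ0 hκ using h1
  have hκΛ : ∀ l ∈ Λ, κ l ≤ ∑ l ∈ Λ, κ l := fun l hl =>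
    Finset.single_le_sum (f := κ) (fun l _ => hκ0 l) hl
  have hadm : ∀ s : S, Admissible A [s] := fun s => ⟨by simp, List.isChain_singleton s⟩
  refine ⟨N, ∑ l ∈ Λ, κ l, Finset.sum_nonneg fun l _ => hκ0 l, ⟨fun x z m hm => ?_, fun x n hn => ?_⟩⟩
  · obtain ⟨l, hl, hadm⟩ := hΛ [x.1 (m - 1)] [z.1 0] (hadm _) (hadm _)
    obtain ⟨z', e1, e2, e3⟩ := exists_join hm hadm
    rw [hN l hl] at e2 e3
    exact ⟨z', e1, e2, (neg_le_neg (hκΛ l hl)).trans (hκ l _ e3)⟩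
  · obtain ⟨l, hl, hadm⟩ := hΛ [x.1 (n - 1)] [x.1 0] (hadm _) (hadm _)
    obtain ⟨z', e1, e2, e3⟩ := exists_periodic hn hadm
    rw [hN l hl] at e2 e3
    exact ⟨z', e1, e2, (neg_le_neg (hκΛ l hl)).trans (hκ l _ e3)⟩

end Connect

/-! ### Empirical measures and families of weighted points -/

section Empirical

variable {X : Type*} (T : X → X)

/-- The number of visits to `V` before time `n`. -/
noncomputable def visits (V : Set X) (n : ℕ) (x : X) : ℝ :=
  birkhoff T (V.indicator 1) n x

open Classical in
lemma visits_eq_card (V : Set X) (n : ℕ) (x : X) :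
    visits T V n x = ((Finset.range n).filter fun i => T^[i] x ∈ V).card := by
  simp [visits, birkhoff, Set.indicator_apply, Finset.sum_boole]

lemma visits_nonneg (V : Set X) (n : ℕ) (x : X) : 0 ≤ visits T V n x := by
  classical
  rw [visits_eq_card]; positivity

lemma visits_le (V : Set X) (n : ℕ) (x : X) : visits T V n x ≤ n := by
  classical
  rw [visits_eq_card]
  exact_mod_cast (Finset.card_filter_le _ _).trans_eq (Finset.card_range n)

lemma visits_add (V : Set X) (n m : ℕ) (x : X) :
    visits T V (n + m) x = visits T V n x + visits T V m (T^[n] x) := birkhoff_add _ _ _ _ _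

lemma empirical_real [MeasurableSpace X] (x : X) {n : ℕ} (hn : 1 ≤ n) {V : Set X}
    (hV : MeasurableSet V) :
    (empirical T x n : Measure X).real V = (n : ℝ)⁻¹ * visits T V n x := by
  rw [empirical, Measure.real]
  simp only [ProbabilityMeasure.coe_mk, max_eq_left hn, Measure.smul_apply,
    Measure.finsetSum_apply, smul_eq_mul, ENNReal.toReal_mul, ENNReal.toReal_inv,
    ENNReal.toReal_natCast, visits, birkhoff]
  congr 1
  rw [ENNReal.toReal_sum fun i _ => measure_ne_top _ _]
  refine Finset.sum_congr rfl fun i _ => ?_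
  rw [Measure.dirac_apply' _ hV]
  by_cases h : T^[i] x ∈ V <;> simp [h]

end Empirical

section VisitsShift

variable {S : Type*} {A : S → S → Prop}

lemma visits_eq_of_agree {r n : ℕ} {V : Set (Space A)} (hV : DepOn r V) {x x' : Space A}
    (h : Agree (n + r) x x') : visits (shift A) V n x = visits (shift A) V n x' := by
  rw [visits, visits, birkhoff, birkhoff]
  refine Finset.sum_congr rfl fun i hi => ?_
  have hi := Finset.mem_range.1 hi
  have h1 : Agree r ((shift A)^[i] x) ((shift A)^[i] x') :=
    agree_shift_iterate (h.mono (by omega))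
  have h2 : (shift A)^[i] x ∈ V ↔ (shift A)^[i] x' ∈ V := ⟨hV _ _ h1, hV _ _ h1.symm⟩
  by_cases h3 : (shift A)^[i] x ∈ V
  · simp [h3, h2.1 h3]
  · simp [h3, mt h2.2 h3]

lemma abs_visits_sub_le {r n : ℕ} {V : Set (Space A)} (hV : DepOn r V) {x x' : Space A}
    (h : Agree n x x') : |visits (shift A) V n x - visits (shift A) V n x'| ≤ r := by
  rcases le_total n r with hnr | hnr
  · have h1 := visits_nonneg (shift A) V n x
    have h2 := visits_nonneg (shift A) V n x'
    have h3 := visits_le (shift A) V n x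
    have h4 := visits_le (shift A) V n x'
    have h5 : (n : ℝ) ≤ r := by exact_mod_cast hnr
    rw [abs_le]; constructor <;> linarith
  · obtain ⟨m, rfl⟩ := Nat.exists_eq_add_of_le' hnr
    rw [visits_add, visits_add, visits_eq_of_agree hV h]
    have h1 := visits_nonneg (shift A) V r ((shift A)^[m] x)
    have h2 := visits_nonneg (shift A) V r ((shift A)^[m] x')
    have h3 := visits_le (shift A) V r ((shift A)^[m] x)
    have h4 := visits_le (shift A) V r ((shift A)^[m] x')
    rw [abs_le]; constructor <;> linarith

end VisitsShift

section Weighted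

instance {X : Type*} [MeasurableSpace X] [TopologicalSpace X] [OpensMeasurableSpace X] :
    BorelSpace (ProbabilityMeasure X) := ⟨rfl⟩

variable {S : Type*} {A : S → S → Prop}

lemma mass_eq_Zfn [TopologicalSpace S] (φ : Space A → ℝ) (P : ℝ) (n : ℕ) (D : Set (Space A)) :
    mass φ P n D = ENNReal.ofReal (Real.exp (-(P * n))) * Zfn (shift A) φ n D := by
  rw [Zfn, ← ENNReal.tsum_mul_left, mass]
  refine tsum_congr fun x => ?_
  rw [← ENNReal.ofReal_mul (Real.exp_pos _).le, ← Real.exp_add, nsum, sub_eq_neg_add]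

variable [TopologicalSpace S]

lemma weightedDistr_apply (φ : Space A → ℝ) (P : ℝ) (n : ℕ) (D : Set (Space A))
    {B : Set (ProbabilityMeasure (Space A))} (hB : MeasurableSet B) :
    weightedDistr (shift A) φ n D B
      = (mass φ P n D)⁻¹ * mass φ P n (D ∩ {x | empirical (shift A) x n ∈ B}) := by
  have h0 : ENNReal.ofReal (Real.exp (-(P * n))) ≠ 0 := by
    simp [Real.exp_pos]
  have h1 : (Measure.sum fun x : D => ENNReal.ofReal (Real.exp (birkhoff (shift A) φ n x)) •
      Measure.dirac (empirical (shift A) (x : Space A) n)) B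
      = Zfn (shift A) φ n (D ∩ {x | empirical (shift A) x n ∈ B}) := by
    rw [Measure.sum_apply _ hB, Zfn,
      tsum_subtype D (fun x => (ENNReal.ofReal (Real.exp (birkhoff (shift A) φ n x)) •
        Measure.dirac (empirical (shift A) (x : Space A) n)) B),
      tsum_subtype (D ∩ {x | empirical (shift A) x n ∈ B})
        (fun x => ENNReal.ofReal (Real.exp (birkhoff (shift A) φ n x)))]
    refine tsum_congr fun x => ?_
    rw [Set.inter_comm, ← Set.indicator_indicator]
    by_cases hx : x ∈ D <;> by_cases hx' : empirical (shift A) x n ∈ B <;>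
      simp [hx, hx', Measure.dirac_apply' _ hB]
  rw [weightedDistr, Measure.smul_apply, smul_eq_mul, h1, mass_eq_Zfn, mass_eq_Zfn,
    ENNReal.mul_inv (Or.inl h0) (Or.inl ENNReal.ofReal_ne_top)]
  calc _ = (ENNReal.ofReal (Real.exp (-(P * n))))⁻¹ * ENNReal.ofReal (Real.exp (-(P * n))) *
        ((Zfn (shift A) φ n D)⁻¹ * Zfn (shift A) φ n (D ∩ {x | empirical (shift A) x n ∈ B})) := by
        rw [ENNReal.inv_mul_cancel h0 ENNReal.ofReal_ne_top, one_mul]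
    _ = _ := by ring

end Weighted

section Families

variable {S : Type*} {A : S → S → Prop}

/-- A sequence of sets of points of `[a]` which are determined by their first `n` symbols, and
which contain an extension of every word starting with `a`. -/
structure Fam (φ : Space A → ℝ) (P : ℝ) (N : ℕ) (κ : ℝ) (a : S) (C : ℕ → Set (Space A)) :
    Prop where
  head : ∀ n, ∀ x ∈ C n, x.1 0 = a
  inj : ∀ n, 1 ≤ n → ∀ x ∈ C n, ∀ x' ∈ C n, Agree n x x' → x = x'
  ext : ∀ n, 1 ≤ n → ∀ x : Space A, x.1 0 = a → ∃ x' ∈ C (n + N), Agree n x' x ∧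
    -κ ≤ nsum φ P N ((shift A)^[n] x')
  count : ∀ i, ∃ Y : Finset S, ∀ n, 1 ≤ n → ∀ x ∈ C n, ∀ F : Set S,
    visits (shift A) {z | z.1 i ∉ F ∪ Y} n x ≤ visits (shift A) {z | z.1 0 ∉ F} n x

lemma coord_add_of_mem_perSet {n : ℕ} {x : Space A} (hx : x ∈ perSet (shift A) n) (i : ℕ) :
    x.1 (n + i) = x.1 i := by
  have hx : (shift A)^[n] x = x := hx
  rw [← shift_iterate_apply, hx]

lemma fam_perSet {φ : Space A → ℝ} {P : ℝ} {N : ℕ} {κ : ℝ} (h : Connects φ P N κ) (a : S) :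
    Fam φ P N κ a (fun n => cylinder A [a] ∩ perSet (shift A) n) := by
  classical
  refine ⟨fun n x hx => mem_cylinder_singleton.1 hx.1, fun n hn x hx x' hx' hag => ?_,
    fun n hn x hx => ?_, fun i => ⟨∅, fun n hn x hx F => ?_⟩⟩
  · refine space_ext fun i => ?_
    induction i using Nat.strong_induction_on with
    | _ i ih =>
      rcases lt_or_ge i n with hi | hi
      · exact hag i hi
      · obtain ⟨j, rfl⟩ := Nat.exists_eq_add_of_le hi
        rw [coord_add_of_mem_perSet hx.2, coord_add_of_mem_perSet hx'.2]
        exact ih j (by omega)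
  · obtain ⟨x', h1, h2, h3⟩ := h.per x n hn
    exact ⟨x', ⟨mem_cylinder_singleton.2 ((h1 0 hn).trans hx), h2⟩, h1, h3⟩
  · rw [visits_eq_card, visits_eq_card]
    have hp : Function.Periodic (fun j => x.1 j ∉ F) n := fun j => by
      simp only [add_comm j n, coord_add_of_mem_perSet hx.2]
    have h1 := Nat.filter_Ico_card_eq_of_periodic i n (fun j => x.1 j ∉ F) hp
    have h2 := Nat.filter_Ico_card_eq_of_periodic 0 n (fun j => x.1 j ∉ F) hp
    simp only [Set.mem_ofPred_eq, shift_iterate_apply, Finset.coe_empty, Set.union_empty, add_zero]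
    have h3 : ((Finset.range n).filter fun j => x.1 (j + i) ∉ F).card
        = ((Finset.Ico i (i + n)).filter fun j => x.1 j ∉ F).card := by
      refine Finset.card_bij (fun j _ => j + i) (fun j hj => ?_) (fun j _ k _ hjk => by omega)
        fun j hj => ?_
      · simp only [Finset.mem_filter, Finset.mem_range, Finset.mem_Ico] at hj ⊢
        exact ⟨by omega, hj.2⟩
      · simp only [Finset.mem_filter, Finset.mem_range, Finset.mem_Ico] at hj ⊢
        exact ⟨j - i, ⟨by omega, by rw [Nat.sub_add_cancel hj.1.1]; exact hj.2⟩, by omega⟩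
    rw [h3, h1, ← h2, zero_add, Finset.range_eq_Ico]

lemma fam_preimSet {φ : Space A → ℝ} {P : ℝ} {N : ℕ} {κ : ℝ} (h : Connects φ P N κ) (a : S)
    (y : Space A) : Fam φ P N κ a (fun n => cylinder A [a] ∩ preimSet (shift A) n y) := by
  classical
  have key : ∀ n x, x ∈ preimSet (shift A) n y → ∀ i, x.1 (n + i) = y.1 i := by
    intro n x hx i
    have hx : (shift A)^[n] x = y := hx
    rw [← shift_iterate_apply, hx]
  refine ⟨fun n x hx => mem_cylinder_singleton.1 hx.1, fun n hn x hx x' hx' hag => ?_,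
    fun n hn x hx => ?_, fun i => ⟨(Finset.range i).image y.1, fun n hn x hx F => ?_⟩⟩
  · refine space_ext fun i => ?_
    rcases lt_or_ge i n with hi | hi
    · exact hag i hi
    · obtain ⟨j, rfl⟩ := Nat.exists_eq_add_of_le hi
      rw [key _ _ hx.2, key _ _ hx'.2]
  · obtain ⟨x', h1, h2, h3⟩ := h.join x y n hn
    exact ⟨x', ⟨mem_cylinder_singleton.2 ((h1 0 hn).trans hx), h2⟩, h1, h3⟩
  · rw [visits_eq_card, visits_eq_card]
    simp only [Set.mem_ofPred_eq, shift_iterate_apply, add_zero]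
    norm_cast
    refine Finset.card_le_card_of_injOn (fun j => j + i) (fun j hj => ?_)
      fun j _ k _ hjk => by simpa using hjk
    simp only [Finset.coe_filter, Finset.mem_range, Set.mem_ofPred_eq, Set.mem_union, not_or] at hj ⊢
    refine ⟨?_, hj.2.1⟩
    by_contra hlt
    refine hj.2.2 ?_
    rw [show j + i = n + (j + i - n) by omega, key _ _ hx.2]
    simp only [Finset.coe_image, Finset.coe_range, Set.mem_image, Set.mem_Iio]
    exact ⟨_, by omega, rfl⟩

lemma exists_point (hA : NoZeroRowCol A) (a : S) : ∃ x : Space A, x.1 0 = a := by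
  choose f hf using hA.1
  exact ⟨⟨fun i => f^[i] a, fun i => by
    show A (f^[i] a) (f^[i + 1] a)
    rw [Function.iterate_succ_apply']
    exact hf _⟩, rfl⟩

variable [TopologicalSpace S] [DiscreteTopology S] [Countable S]

lemma Fam.exists_le_mass {φ : Space A → ℝ} {μ : Measure (Space A)} [IsProbabilityMeasure μ]
    {c₀ P : ℝ} (hc₀ : 1 ≤ c₀) (hG : IsGibbsWith A φ μ c₀ P) (hA : NoZeroRowCol A)
    {N : ℕ} {κ : ℝ} {a : S} {C : ℕ → Set (Space A)} (hC : Fam φ P N κ a C) :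
    ∃ δ : ℝ≥0∞, δ ≠ 0 ∧ ∀ n, 1 ≤ n → δ ≤ mass φ P (n + N) (C (n + N)) := by
  set Ca : Set (Space A) := {x | x.1 0 = a} with hCa
  have hCam : MeasurableSet Ca :=
    (isClopen_discrete {a}).preimage (continuous_coord 0) |>.isOpen.measurableSet
  have hpos : μ Ca ≠ 0 := by
    obtain ⟨x, hx⟩ := exists_point hA a
    have h1 := hG.exp_nsum_le hc₀ le_rfl x
    have h2 : pre 1 ⁻¹' {pre 1 x} ⊆ Ca := fun z hz => by
      have := pre_eq_iff.1 (Set.mem_singleton_iff.1 hz)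
      exact (this 0 one_pos).trans hx
    intro h0
    have h3 := measure_mono_null h2 h0
    rw [Measure.real, h3] at h1
    simp only [ENNReal.toReal_zero, mul_zero] at h1
    exact absurd h1 (not_le.2 (Real.exp_pos _))
  set k : ℝ := c₀ * Real.exp κ with hk
  have hk0 : 0 < k := by positivity
  refine ⟨μ Ca / ENNReal.ofReal k, ENNReal.div_ne_zero.2 ⟨hpos, ENNReal.ofReal_ne_top⟩,
    fun n hn => ENNReal.div_le_of_le_mul' ?_⟩
  let W : Set (Fin n → S) := {w | ∃ x ∈ Ca, pre n x = w}
  have hW : ∀ w : W, ∃ x' ∈ C (n + N), pre n x' = w ∧ -κ ≤ nsum φ P N ((shift A)^[n] x') := by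
    rintro ⟨w, x, hx, rfl⟩
    obtain ⟨x', h1, h2, h3⟩ := hC.ext n hn x hx
    exact ⟨x', h1, pre_eq_iff.2 h2, h3⟩
  choose f hf1 hf2 hf3 using hW
  have hinj : Function.Injective (fun w : W => (⟨f w, hf1 w⟩ : C (n + N))) := fun w w' h => by
    have h : f w = f w' := congrArg Subtype.val h
    exact Subtype.ext (by rw [← hf2 w, ← hf2 w', h])
  calc μ Ca = ∑' w : Fin n → S, μ (Ca ∩ pre n ⁻¹' {w}) :=
        (tsum_measure_inter_preimage_singleton μ (pre n)
          (fun w => measurableSet_preimage_pre n _) Ca hCam).symm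
    _ = ∑' w : W, μ (Ca ∩ pre n ⁻¹' {(w : Fin n → S)}) := by
        refine (tsum_subtype_eq_of_support_subset fun w hw => ?_).symm
        obtain ⟨x, hx⟩ := nonempty_of_measure_ne_zero (Function.mem_support.1 hw)
        exact ⟨x, hx.1, hx.2⟩
    _ ≤ ∑' w : W, ENNReal.ofReal k * ENNReal.ofReal (Real.exp (nsum φ P (n + N) (f w))) := by
        refine ENNReal.tsum_le_tsum fun w => (measure_mono Set.inter_subset_right).trans ?_
        rw [← ENNReal.ofReal_mul hk0.le, ← ofReal_measureReal, ← hf2 w]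
        refine ENNReal.ofReal_le_ofReal ((hG.le_exp_nsum hn _).trans ?_)
        rw [hk, mul_assoc, ← Real.exp_add, nsum_add]
        gcongr
        linarith [hf3 w]
    _ = ENNReal.ofReal k * ∑' w : W, ENNReal.ofReal (Real.exp (nsum φ P (n + N) (f w))) :=
        ENNReal.tsum_mul_left
    _ ≤ ENNReal.ofReal k * mass φ P (n + N) (C (n + N)) := by
        gcongr
        exact ENNReal.tsum_comp_le_tsum_of_injective hinj
          (fun x : C (n + N) => ENNReal.ofReal (Real.exp (nsum φ P (n + N) x)))

end Families

/-! ### Entropy of the partitions into cylinders -/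

section KolmogorovSinai

variable {S : Type*} {A : S → S → Prop}

lemma isSetRing_depOn : IsSetRing {V : Set (Space A) | ∃ r, DepOn r V} where
  empty_mem := ⟨0, fun _ _ _ h => h⟩
  union_mem := by
    rintro s t ⟨r, hs⟩ ⟨r', ht⟩
    refine ⟨max r r', fun x x' h hx => ?_⟩
    exact hx.imp (hs.mono (le_max_left _ _) x x' h) (ht.mono (le_max_right _ _) x x' h)
  sdiff_mem := by
    rintro s t ⟨r, hs⟩ ⟨r', ht⟩
    refine ⟨max r r', fun x x' h hx => ?_⟩
    exact ⟨hs.mono (le_max_left _ _) x x' h hx.1,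
      fun h' => hx.2 (ht.mono (le_max_right _ _) x' x h.symm h')⟩

variable [TopologicalSpace S] [DiscreteTopology S]

lemma generateFrom_depOn :
    (inferInstance : MeasurableSpace (Space A))
      = MeasurableSpace.generateFrom {V : Set (Space A) | ∃ r, DepOn r V} := by
  refine le_antisymm ?_ (MeasurableSpace.generateFrom_le ?_)
  · refine MeasurableSpace.generateFrom_le fun u hu => ?_
    have : u = ⋃ n, {x | ∀ x', Agree n x x' → x' ∈ u} := by
      refine Set.Subset.antisymm (fun x hx => ?_) ?_
      · exact Set.mem_iUnion.2 (exists_depOn_subset hu hx)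
      · refine Set.iUnion_subset fun n x hx => hx x (Agree.refl n x)
    rw [this]
    refine MeasurableSet.iUnion fun n => MeasurableSpace.measurableSet_generateFrom ⟨n, ?_⟩
    exact fun x x' h hx x'' h' => hx x'' (h.trans h')
  · rintro V ⟨r, hV⟩
    exact hV.measurableSet

lemma exists_depOn_symmDiff_lt (ν : Measure (Space A)) [IsFiniteMeasure ν] {B : Set (Space A)}
    (hB : MeasurableSet B) {ε : ℝ≥0∞} (hε : 0 < ε) :
    ∃ r V, DepOn r V ∧ ν (symmDiff V B) < ε := by
  obtain ⟨V, ⟨r, hV⟩, h⟩ := exists_measure_symmDiff_lt_of_generateFrom_isSetRing (μ := ν)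
    isSetRing_depOn ⟨{Set.univ}, Set.countable_singleton _,
      Set.singleton_subset_iff.2 ⟨0, fun _ _ _ _ => trivial⟩, by simp⟩ generateFrom_depOn hB hε
  exact ⟨r, V, hV, h⟩

lemma exists_etaFn_le {ε : ℝ≥0∞} (hε : 0 < ε) :
    ∃ δ : ℝ≥0∞, 0 < δ ∧ ∀ x : ℝ≥0∞, x ≤ 1 → (x ≤ δ ∨ 1 ≤ x + δ) → etaFn x ≤ ε := by
  obtain ⟨ε', hε', hle⟩ : ∃ ε' : ℝ, 0 < ε' ∧ ENNReal.ofReal ε' ≤ ε := by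
    rcases eq_or_ne ε ⊤ with rfl | h
    · exact ⟨1, one_pos, le_top⟩
    · exact ⟨ε.toReal, ENNReal.toReal_pos hε.ne' h, ENNReal.ofReal_toReal_le⟩
  have hc : Continuous fun x : ℝ => -(x * Real.log x) := Real.continuous_mul_log.neg
  obtain ⟨d0, hd0, h0⟩ := Metric.continuousAt_iff.1 (hc.continuousAt (x := 0)) ε' hε'
  obtain ⟨d1, hd1, h1⟩ := Metric.continuousAt_iff.1 (hc.continuousAt (x := 1)) ε' hε'
  set d := min d0 d1 / 2 with hd
  have hdpos : 0 < d := by positivity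
  refine ⟨ENNReal.ofReal d, ENNReal.ofReal_pos.2 hdpos, fun x hx hx' => le_trans ?_ hle⟩
  refine ENNReal.ofReal_le_ofReal ?_
  have hxt : x ≠ ⊤ := (hx.trans_lt ENNReal.one_lt_top).ne
  have hx1 : x.toReal ≤ 1 := ENNReal.toReal_mono ENNReal.one_ne_top hx
  have hx0 : 0 ≤ x.toReal := ENNReal.toReal_nonneg
  rcases hx' with h | h
  · have h2 : x.toReal ≤ d := ENNReal.toReal_le_of_le_ofReal hdpos.le h
    have h3 := h0 (x := x.toReal) (by
      rw [Real.dist_eq, sub_zero, abs_of_nonneg hx0]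
      have := min_le_left d0 d1; linarith)
    rw [Real.dist_eq] at h3
    simp only [Real.log_zero, mul_zero, neg_zero, sub_zero] at h3
    exact (abs_lt.1 h3).2.le
  · have h2 : 1 ≤ x.toReal + d := by
      have := ENNReal.toReal_mono (by finiteness) h
      rwa [ENNReal.toReal_add hxt ENNReal.ofReal_ne_top, ENNReal.toReal_ofReal hdpos.le,
        ENNReal.toReal_one] at this
    have h3 := h1 (x := x.toReal) (by
      rw [Real.dist_eq, abs_lt]
      have := min_le_right d0 d1; constructor <;> linarith)
    rw [Real.dist_eq] at h3
    simp only [Real.log_one, mul_zero, neg_zero, sub_zero] at h3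
    exact (abs_lt.1 h3).2.le

/-- A process which rarely differs from a given value has small entropy. -/
lemma exists_partitionEntropy_le {β : Type*} [Fintype β] {ε : ℝ≥0∞} (hε : 0 < ε) :
    ∃ δ : ℝ≥0∞, 0 < δ ∧ ∀ {X : Type _} [MeasurableSpace X] (ν : Measure X)
      [IsProbabilityMeasure ν] (e : X → β) (b₀ : β), MeasurableSet (e ⁻¹' {b₀}) →
      ν (e ⁻¹' {b₀})ᶜ ≤ δ → partitionEntropy ν e ≤ Fintype.card β * ε := by
  obtain ⟨δ, hδ, h⟩ := exists_etaFn_le hε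
  refine ⟨δ, hδ, fun ν _ e b₀ hm hle => ?_⟩
  rw [partitionEntropy_eq, tsum_fintype, ← nsmul_eq_mul]
  refine Finset.sum_le_card_nsmul _ _ _ fun b _ => h _ prob_le_one ?_
  by_cases hb : b = b₀
  · subst hb
    right
    rw [← measure_univ (μ := ν), ← measure_add_measure_compl hm]
    gcongr
  · left
    refine le_trans (measure_mono fun x hx => ?_) hle
    rw [Set.mem_preimage, Set.mem_singleton_iff] at hx
    simpa [hx] using hb

variable [Countable S]

/-- The Kolmogorov–Sinaĭ entropy is approximated by the entropies of cylinder partitions. -/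
lemma exists_le_partitionEntropy_pre (ν : Measure (Space A)) [IsProbabilityMeasure ν]
    (hν : Invariant (shift A) ν) {b : ℝ≥0∞} (hb : b < entropy (shift A) ν) (m₀ : ℕ) :
    ∃ m ≥ m₀, m * b ≤ partitionEntropy ν (pre m) := by
  simp only [entropy, lt_iSup_iff] at hb
  obtain ⟨p, ⟨hpm, hpf⟩, hb⟩ := hb
  obtain ⟨b₁, hbb₁, hb₁⟩ := exists_between hb
  obtain ⟨b₂, hbb₂, hb₂⟩ := exists_between hbb₁
  have hb₁t : b₁ ≠ ⊤ := (hb₁.trans_le le_top).ne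
  have hb₂t : b₂ ≠ ⊤ := (hb₂.trans_le hb₁.le).trans_le le_top |>.ne
  obtain ⟨K, hK⟩ : ∃ K, ∀ x, p x < K := by
    obtain ⟨K, hK⟩ := hpf.bddAbove
    exact ⟨K + 1, fun x => Nat.lt_succ_of_le (hK ⟨x, rfl⟩)⟩
  have hgap : 0 < (b₁ - b₂) / (Fintype.card (Fin K → Prop) : ℝ≥0∞) :=
    ENNReal.div_pos (tsub_pos_of_lt hb₂).ne' (by finiteness)
  obtain ⟨δ, hδ, hent⟩ := exists_partitionEntropy_le (β := Fin K → Prop) hgap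
  have hδK : 0 < δ / K := ENNReal.div_pos hδ.ne' (by finiteness)
  have hBm : ∀ i : Fin K, MeasurableSet (p ⁻¹' {(i : ℕ)}) := fun i => hpm (measurableSet_singleton _)
  choose r₀ V hV hVlt using fun i : Fin K => exists_depOn_symmDiff_lt ν (hBm i) hδK
  set r := Finset.univ.sup r₀ with hr
  have hV' : ∀ i, DepOn r (V i) := fun i => (hV i).mono (Finset.le_sup (Finset.mem_univ i))
  let g : Space A → Fin K → Prop := fun x i => x ∈ V i
  let e : Space A → Fin K → Prop := fun x i => x ∈ symmDiff (V i) (p ⁻¹' {(i : ℕ)})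
  have hem : ∀ v, MeasurableSet (e ⁻¹' {v}) := by
    intro v
    have : e ⁻¹' {v} = ⋂ i, {x | (x ∈ symmDiff (V i) (p ⁻¹' {(i : ℕ)})) = v i} := by
      ext x; simp [e, funext_iff]
    rw [this]
    refine MeasurableSet.iInter fun i => ?_
    have hm := (hV' i).measurableSet.symmDiff (hBm i)
    by_cases hv : v i
    · simpa [hv] using hm
    · have h : {x | (x ∈ symmDiff (V i) (p ⁻¹' {(i : ℕ)})) = v i}
          = (symmDiff (V i) (p ⁻¹' {(i : ℕ)}))ᶜ := by
        ext x
        rw [Set.mem_ofPred_eq, Set.mem_compl_iff, eq_false hv, eq_iff_iff, iff_false]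
      exact h ▸ hm.compl
  have hH : partitionEntropy ν e ≤ b₁ - b₂ := by
    refine (hent ν e (fun _ => False) (hem _) ?_).trans_eq ?_
    · calc ν (e ⁻¹' {fun _ => False})ᶜ ≤ ν (⋃ i, symmDiff (V i) (p ⁻¹' {(i : ℕ)})) := by
            refine measure_mono fun x hx => ?_
            by_contra h
            refine hx ?_
            rw [Set.mem_iUnion, not_exists] at h
            exact funext fun i => eq_false (h i)
        _ ≤ ∑ i, ν (symmDiff (V i) (p ⁻¹' {(i : ℕ)})) := measure_iUnion_fintype_le _ _
        _ ≤ ∑ _i : Fin K, δ / K := Finset.sum_le_sum fun i _ => (hVlt i).le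
        _ ≤ δ := by
            simp only [Finset.sum_const, Finset.card_univ, Fintype.card_fin, nsmul_eq_mul]
            exact ENNReal.mul_div_le
    · rw [ENNReal.mul_div_cancel (by simp) (by finiteness)]
  -- the symbol is determined by the approximation and the error
  have hfac : ∃ f : (Fin K → Prop) × (Fin K → Prop) → ℕ, ∀ x, p x = f (g x, e x) := by
    have h : Function.FactorsThrough p (fun x => (g x, e x)) := by
      intro x x' hxx'
      simp only [Prod.mk.injEq] at hxx'
      have h1 := congrFun hxx'.1 ⟨p x, hK x⟩
      have h2 := congrFun hxx'.2 ⟨p x, hK x⟩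
      simp only [g, e, Set.mem_symmDiff, Set.mem_preimage, Set.mem_singleton_iff, eq_iff_iff] at h1 h2
      by_contra hne
      have hne' : ¬ p x' = p x := fun h => hne h.symm
      tauto
    exact ⟨Function.extend (fun x => (g x, e x)) p 0, fun x => (h.extend_apply 0 x).symm⟩
  obtain ⟨f, hf⟩ := hfac
  have hgfac : ∃ f' : (Fin r → S) → (Fin K → Prop), ∀ x : Space A, g x = f' (pre r x) := by
    have h : Function.FactorsThrough g (pre (A := A) r) := by
      intro x x' hxx'
      refine funext fun i => propext ?_
      have := pre_eq_iff.1 hxx'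
      exact ⟨hV' i x x' this, hV' i x' x this.symm⟩
    exact ⟨Function.extend (pre (A := A) r) g (fun _ => default), fun x => (h.extend_apply _ x).symm⟩
  obtain ⟨f', hf'⟩ := hgfac
  have hmain : ∀ n : ℕ, partitionEntropy ν (fun x => fun i : Fin n => p ((shift A)^[i] x))
      ≤ partitionEntropy ν (pre (n + r)) + n * (b₁ - b₂) := by
    intro n
    have hem' := measurableSet_preimage_itinerary measurable_shift hem n
    have h1 := partitionEntropy_prod_le ν (pre (n + r)) (fun w => measurableSet_preimage_pre _ _)
      (fun x => fun i : Fin n => e ((shift A)^[i] x)) hem'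
    have h2 := partitionEntropy_itinerary_le measurable_shift hν hem n
    let Φ : (Fin (n + r) → S) × (Fin n → Fin K → Prop) → (Fin n → ℕ) :=
      fun u i => f (f' (fun j => u.1 ⟨i + j, by omega⟩), u.2 i)
    have h3 : (fun x : Space A => fun i : Fin n => p ((shift A)^[i] x))
        = fun x => Φ (pre (n + r) x, fun i : Fin n => e ((shift A)^[i] x)) := by
      funext x i
      simp only [Φ]
      rw [hf, hf']
      congr 3
      funext j
      simp only [pre, shift_iterate_apply]
    rw [h3]
    refine (partitionEntropy_comp_le ν
      (fun x => (pre (n + r) x, fun i : Fin n => e ((shift A)^[i] x))) (fun u => ?_) Φ).trans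
      (h1.trans (by gcongr; exact h2.trans (by gcongr)))
    have : (fun x => (pre (n + r) x, fun i : Fin n => e ((shift A)^[i] x))) ⁻¹' {u}
        = (pre (n + r) ⁻¹' {u.1}) ∩ ((fun x => fun i : Fin n => e ((shift A)^[i] x)) ⁻¹' {u.2}) := by
      ext x; simp [Prod.ext_iff]
    rw [this]
    exact (measurableSet_preimage_pre _ _).inter (hem' _)
  have hbt : b ≠ ⊤ := (hbb₂.trans_le le_top).ne
  have hev : ∀ᶠ n : ℕ in atTop, (n + r : ℕ) * b ≤ n * b₂ := by
    have hpos : 0 < b₂.toReal - b.toReal :=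
      sub_pos.2 ((ENNReal.toReal_lt_toReal hbt hb₂t).2 hbb₂)
    have h := (tendsto_natCast_atTop_atTop (R := ℝ)).atTop_mul_const hpos
    filter_upwards [h.eventually_ge_atTop (r * b.toReal)] with n hn
    rw [← ENNReal.ofReal_toReal hbt, ← ENNReal.ofReal_toReal hb₂t, ← ENNReal.ofReal_natCast,
      ← ENNReal.ofReal_natCast, ← ENNReal.ofReal_mul (by positivity),
      ← ENNReal.ofReal_mul (by positivity)]
    refine ENNReal.ofReal_le_ofReal ?_
    push_cast
    linarith
  obtain ⟨n, hn1, hn2, hn3, hn4⟩ := ((eventually_lt_of_lt_liminf hb₁).and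
    (hev.and ((eventually_ge_atTop m₀).and (eventually_ge_atTop 1)))).exists
  refine ⟨n + r, by omega, hn2.trans ?_⟩
  have h0 : (n : ℝ≥0∞) ≠ 0 := by exact_mod_cast (by omega : n ≠ 0)
  have h1 : (n : ℝ≥0∞) * b₁ ≤ partitionEntropy ν (pre (n + r)) + n * (b₁ - b₂) := by
    refine le_trans ?_ (hmain n)
    rw [ENNReal.ofReal_inv_of_pos (by positivity), ENNReal.ofReal_natCast] at hn1
    calc (n : ℝ≥0∞) * b₁ ≤ n * ((n : ℝ≥0∞)⁻¹ * _) := by gcongr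
      _ = _ := by rw [← mul_assoc, ENNReal.mul_inv_cancel h0 (by finiteness), one_mul]
  have h2 : (n : ℝ≥0∞) * b₂ + n * (b₁ - b₂) ≤ partitionEntropy ν (pre (n + r)) + n * (b₁ - b₂) := by
    rwa [← mul_add, add_tsub_cancel_of_le hb₂.le]
  exact ENNReal.le_of_add_le_add_right (by finiteness) h2

end KolmogorovSinai

/-! ### Concatenating blocks -/

section Blocks

variable {S : Type*} {A : S → S → Prop} [TopologicalSpace S] {φ : Space A → ℝ}
  {μ : Measure (Space A)} {c₀ P : ℝ} {N : ℕ} {κ : ℝ}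

lemma exists_chain (hc₀ : 1 ≤ c₀) (hG : IsGibbsWith A φ μ c₀ P) (h : Connects φ P N κ) {m : ℕ}
    (hm : 1 ≤ m) (z : Space A) (k : ℕ) (x : Fin k → Space A) :
    ∃ z' : Space A, (∀ i : Fin k, Agree m ((shift A)^[i * (m + N)] z') (x i)) ∧
      (shift A)^[k * (m + N)] z' = z ∧
      ∑ i, nsum φ P m (x i) - k * (2 * Real.log c₀ + κ) ≤ nsum φ P (k * (m + N)) z' ∧
      ∀ r V, DepOn r V → |visits (shift A) V (k * (m + N)) z' - ∑ i, visits (shift A) V m (x i)|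
        ≤ k * (r + N) := by
  induction k with
  | zero =>
    refine ⟨z, fun i => i.elim0, by simp, by simp [nsum_zero], fun r V _ => ?_⟩
    simp [visits, birkhoff_zero]
  | succ k ih =>
    obtain ⟨z'', h1, h2, h3, h4⟩ := ih fun i => x i.succ
    obtain ⟨z', g1, g2, g3⟩ := h.join (x 0) z'' m hm
    refine ⟨z', fun i => ?_, ?_, ?_, fun r V hV => ?_⟩
    · refine Fin.cases ?_ (fun i => ?_) i
      · simpa using g1
      · rw [Fin.val_succ, Nat.succ_mul, Function.iterate_add_apply, g2]
        exact h1 i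
    · rw [Nat.succ_mul, Function.iterate_add_apply, g2, h2]
    · rw [Nat.succ_mul, add_comm (k * _), nsum_add, nsum_add, g2, Fin.sum_univ_succ]
      have := hG.nsum_le_of_agree hc₀ g1.symm
      push_cast
      linarith
    · rw [Nat.succ_mul, add_comm (k * _), visits_add, visits_add, g2, Fin.sum_univ_succ]
      have e1 := abs_le.1 (h4 r V hV)
      have e2 := abs_le.1 (abs_visits_sub_le hV g1)
      have e3 := visits_nonneg (shift A) V N ((shift A)^[m] z')
      have e4 := visits_le (shift A) V N ((shift A)^[m] z')
      push_cast
      rw [abs_le]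
      constructor <;> linarith

lemma Fam.exists_blocks (hc₀ : 1 ≤ c₀) (hG : IsGibbsWith A φ μ c₀ P) (h : Connects φ P N κ)
    (hA : NoZeroRowCol A) {a : S} {C : ℕ → Set (Space A)} (hC : Fam φ P N κ a C) {m : ℕ}
    (hm : 1 ≤ m) :
    ∃ K : ℝ, ∀ k j : ℕ, j < m + N → ∀ x : Fin k → Space A,
      ∃ x' ∈ C (1 + N + (k * (m + N) + j) + N),
        (∀ i : Fin k, Agree m ((shift A)^[1 + N + i * (m + N)] x') (x i)) ∧
        ∑ i, nsum φ P m (x i) - k * (2 * Real.log c₀ + κ) - K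
          ≤ nsum φ P (1 + N + (k * (m + N) + j) + N) x' ∧
        ∀ r V, DepOn r V →
          |visits (shift A) V (1 + N + (k * (m + N) + j) + N) x' - ∑ i, visits (shift A) V m (x i)|
            ≤ k * (r + N) + r + K := by
  obtain ⟨xa, hxa⟩ := exists_point hA a
  set K₁ : ℝ := 4 * Real.log c₀ + 2 * |κ| + |nsum φ P 1 xa| +
    ∑ j ∈ Finset.range (m + N), |nsum φ P j xa| with hK₁
  set K₂ : ℝ := 1 + N + (m + N) + N with hK₂
  have hlog := Real.log_nonneg hc₀
  have hK₁0 : 0 ≤ K₁ := by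
    have := Finset.sum_nonneg fun j (_ : j ∈ Finset.range (m + N)) => abs_nonneg (nsum φ P j xa)
    positivity
  refine ⟨K₁ + K₂, fun k j hj x => ?_⟩
  obtain ⟨z', h1, h2, h3, h4⟩ := exists_chain hc₀ hG h hm xa k x
  obtain ⟨p, g1, g2, g3⟩ := h.join xa z' 1 le_rfl
  set n' := 1 + N + (k * (m + N) + j) with hn'
  obtain ⟨x', e1, e2, e3⟩ := hC.ext n' (by omega) p ((g1 0 one_pos).trans hxa)
  refine ⟨x', e1, fun i => ?_, ?_, fun r V hV => ?_⟩
  · have hi : (i : ℕ) * (m + N) + (m + N) ≤ k * (m + N) := by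
      rw [← Nat.succ_mul]; exact Nat.mul_le_mul_right _ i.2
    have h5 : Agree m ((shift A)^[1 + N + i * (m + N)] x') ((shift A)^[1 + N + i * (m + N)] p) :=
      agree_shift_iterate (e2.mono (by omega))
    refine h5.trans ?_
    rw [add_comm (1 + N), Function.iterate_add_apply, g2]
    exact h1 i
  · have f1 := hG.nsum_le_of_agree hc₀ e2.symm
    have f2 := hG.nsum_le_of_agree hc₀ g1.symm
    have f3 : |nsum φ P j xa| ≤ ∑ j ∈ Finset.range (m + N), |nsum φ P j xa| :=
      Finset.single_le_sum (f := fun j => |nsum φ P j xa|) (fun _ _ => abs_nonneg _)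
        (Finset.mem_range.2 hj)
    have f4 := neg_abs_le (nsum φ P j xa)
    have f5 := neg_abs_le (nsum φ P 1 xa)
    have f6 := le_abs_self κ
    have f7 : 0 ≤ K₂ := by positivity
    have f8 : nsum φ P n' p = nsum φ P 1 p + nsum φ P N ((shift A)^[1] p) +
        (nsum φ P (k * (m + N)) z' + nsum φ P j xa) := by
      rw [hn', nsum_add, nsum_add, g2, nsum_add, h2]
    rw [nsum_add]
    linarith
  · have f1 := abs_le.1 (abs_visits_sub_le hV e2)
    have f2 := abs_le.1 (h4 r V hV)
    have f8 : visits (shift A) V n' p = visits (shift A) V (1 + N) p +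
        (visits (shift A) V (k * (m + N)) z' + visits (shift A) V j xa) := by
      rw [hn', visits_add _ _ (1 + N), g2, visits_add _ _ (k * (m + N)), h2]
    have f3 := visits_nonneg (shift A) V (1 + N) p
    have f4 := visits_le (shift A) V (1 + N) p
    have f5 := visits_nonneg (shift A) V j xa
    have f6 := visits_le (shift A) V j xa
    have f7 := visits_nonneg (shift A) V N ((shift A)^[n'] x')
    have f9 := visits_le (shift A) V N ((shift A)^[n'] x')
    have f10 : (j : ℝ) ≤ m + N := by exact_mod_cast hj.le
    rw [visits_add]
    push_cast at f4
    rw [abs_le]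
    constructor <;> linarith

end Blocks

/-! ### Finite models of invariant measures -/

section Model

lemma integral_birkhoff {X : Type*} [MeasurableSpace X] {T : X → X} (hT : Measurable T)
    {ν : Measure X} (hν : Invariant T ν) {f : X → ℝ} (hf : Integrable f ν) (n : ℕ) :
    Integrable (birkhoff T f n) ν ∧ ∫ x, birkhoff T f n x ∂ν = n * ∫ x, f x ∂ν := by
  have hit : ∀ i, ν.map T^[i] = ν := fun i => hν.iterate hT i
  have h1 : ∀ i, Integrable (fun x => f (T^[i] x)) ν := fun i =>
    (show Integrable f (ν.map T^[i]) by rwa [hit i]).comp_measurable (hT.iterate i)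
  have h2 : ∀ i, ∫ x, f (T^[i] x) ∂ν = ∫ x, f x ∂ν := fun i => by
    have h := integral_map (μ := ν) (hT.iterate i).aemeasurable (f := f)
      (by rw [hit i]; exact hf.aestronglyMeasurable)
    rw [hit i] at h
    exact h.symm
  refine ⟨integrable_finsetSum _ fun i _ => h1 i, ?_⟩
  simp only [birkhoff]
  rw [integral_finsetSum _ fun i _ => h1 i]
  simp [h2]

variable {S : Type*} {A : S → S → Prop} [TopologicalSpace S] [DiscreteTopology S]

lemma sum_measureReal_mul_ge (ν : Measure (Space A)) [IsProbabilityMeasure ν] {m : ℕ}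
    (W : Finset (Fin m → S)) (x : W → Space A) (hx : ∀ w, pre m (x w) = w) {g : Space A → ℝ}
    (hg : Integrable g ν) {D U : ℝ} (hD : ∀ z z', Agree m z z' → g z ≤ g z' + D)
    (hU : ∀ z, g z ≤ U) :
    ∫ z, g z ∂ν - U * (1 - ∑ w : W, ν.real (pre m ⁻¹' {(w : Fin m → S)}))
        - D * ∑ w : W, ν.real (pre m ⁻¹' {(w : Fin m → S)})
      ≤ ∑ w : W, ν.real (pre m ⁻¹' {(w : Fin m → S)}) * g (x w) := by
  set s : W → Set (Space A) := fun w => pre m ⁻¹' {(w : Fin m → S)} with hs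
  have hsm : ∀ w, MeasurableSet (s w) := fun w => measurableSet_preimage_pre m _
  have hdisj : Pairwise (Function.onFun Disjoint s) := fun w w' hne =>
    Disjoint.preimage _ (Set.disjoint_singleton.2 fun h => hne (Subtype.ext h))
  have hEm : MeasurableSet (⋃ w, s w) := MeasurableSet.iUnion hsm
  have hE : ν.real (⋃ w, s w) = ∑ w, ν.real (s w) := by
    rw [measureReal_def, measure_iUnion hdisj hsm, tsum_fintype,
      ENNReal.toReal_sum fun _ _ => measure_ne_top _ _]
    rfl
  have h1 : ∫ z in ⋃ w, s w, g z ∂ν = ∑ w, ∫ z in s w, g z ∂ν :=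
    integral_iUnion_fintype hsm hdisj fun w => hg.integrableOn
  have h2 : ∀ w, ∫ z in s w, g z ∂ν ≤ ν.real (s w) * (g (x w) + D) := by
    intro w
    have := setIntegral_mono_on (hg.integrableOn (s := s w)) (integrableOn_const (C := g (x w) + D))
      (hsm w) fun z hz => hD z (x w) (pre_eq_iff.1 ((hx w).symm ▸ hz))
    rwa [setIntegral_const, smul_eq_mul] at this
  have h3 : ∫ z in (⋃ w, s w)ᶜ, g z ∂ν ≤ U * (1 - ∑ w, ν.real (s w)) := by
    have := setIntegral_mono_on (hg.integrableOn (s := (⋃ w, s w)ᶜ)) (integrableOn_const (C := U))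
      hEm.compl fun z _ => hU z
    rwa [setIntegral_const, smul_eq_mul, probReal_compl_eq_one_sub hEm, hE, mul_comm] at this
  have h4 := integral_add_compl hEm hg
  have h5 := Finset.sum_le_sum fun w (_ : w ∈ Finset.univ) => h2 w
  simp only [mul_add, Finset.sum_add_distrib, ← Finset.sum_mul] at h5
  linarith

variable [Countable S] {φ : Space A → ℝ} {μ : Measure (Space A)} [IsProbabilityMeasure μ]
  {c₀ P : ℝ}

/-- An invariant measure is modelled by finitely many weighted words of length `m`. -/
lemma exists_finite_model (hc₀ : 1 ≤ c₀) (hG : IsGibbsWith A φ μ c₀ P) (ν : Measure (Space A))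
    [IsProbabilityMeasure ν] (hν : Invariant (shift A) ν) (hint : Integrable φ ν) {m : ℕ}
    {c₁ : ℝ} (hH : ENNReal.ofReal (m * c₁) ≤ partitionEntropy ν (pre m)) :
    ∃ (W : Finset (Fin m → S)) (x : W → Space A) (q : W → ℝ), (∀ w, pre m (x w) = w) ∧
      (∀ w, 0 < q w) ∧ ∑ w, q w = 1 ∧
      m * (c₁ + ∫ z, φ z ∂ν - P) - 4 - 2 * Real.log c₀
        ≤ ∑ w, q w * (-Real.log (q w) + nsum φ P m (x w)) ∧
      ∀ r V, DepOn r V → |∑ w, q w * visits (shift A) V m (x w) - m * ν.real V| ≤ r + 1 := by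
  have hlog := Real.log_nonneg hc₀
  set I := ∫ z, φ z ∂ν with hI
  set R : ℝ := 1 + m * |I - P| + Real.log c₀ + 2 * m with hR
  have hR1 : 1 ≤ R := by
    have : 0 ≤ m * |I - P| := by positivity
    have : (0 : ℝ) ≤ m := by positivity
    linarith
  set ε : ℝ := 1 / (2 * R) with hε
  have hε0 : 0 < ε := by positivity
  have hεR : 2 * ε * R = 1 := by rw [hε]; field_simp
  have hε2 : ε ≤ 1 / 2 := by nlinarith
  -- choose a large finite set of words
  let v : (Fin m → S) → ℝ≥0∞ := fun w => ν (pre m ⁻¹' {w})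
  have hv1 : ∀ w, v w ≤ 1 := fun w => prob_le_one
  have hsum : ∑' w, v w = 1 := by
    rw [tsum_measure_preimage_singleton ν (pre m) fun w => measurableSet_preimage_pre m _,
      measure_univ]
  have ht1 : ∀ᶠ W : Finset (Fin m → S) in atTop, 1 - ε ≤ ∑ w ∈ W, ν.real (pre m ⁻¹' {w}) := by
    have h := (ENNReal.summable (f := v)).hasSum
    rw [hsum] at h
    have h2 : ENNReal.ofReal (1 - ε) < 1 := by
      rw [← ENNReal.ofReal_one, ENNReal.ofReal_lt_ofReal_iff one_pos]; linarith
    filter_upwards [h.eventually (lt_mem_nhds h2)] with W hW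
    have h3 := ENNReal.toReal_mono (by
      rw [ENNReal.sum_ne_top]; exact fun w _ => measure_ne_top _ _) hW.le
    rw [ENNReal.toReal_ofReal (by linarith),
      ENNReal.toReal_sum fun _ _ => measure_ne_top _ _] at h3
    exact h3
  have hetat : ∀ w, etaFn (v w) ≠ ⊤ := fun w => ENNReal.ofReal_ne_top
  have heta : ∀ w, (etaFn (v w)).toReal
      = ν.real (pre m ⁻¹' {w}) * -Real.log (ν.real (pre m ⁻¹' {w})) := by
    intro w
    rw [etaFn, ENNReal.toReal_ofReal]
    · rw [mul_neg]; rfl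
    · rw [neg_nonneg]
      exact mul_nonpos_of_nonneg_of_nonpos ENNReal.toReal_nonneg
        (Real.log_nonpos ENNReal.toReal_nonneg measureReal_le_one)
  have ht2 : ∀ᶠ W : Finset (Fin m → S) in atTop, m * c₁ - 1 ≤
      ∑ w ∈ W, ν.real (pre m ⁻¹' {w}) * -Real.log (ν.real (pre m ⁻¹' {w})) := by
    simp only [← heta]
    rcases le_or_gt (m * c₁ : ℝ) 1 with h | h
    · exact Eventually.of_forall fun W =>
        le_trans (by linarith) (Finset.sum_nonneg fun w _ => ENNReal.toReal_nonneg)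
    · have h1 : ENNReal.ofReal (m * c₁ - 1) < ∑' w, etaFn (v w) := by
        refine lt_of_lt_of_le ?_ hH
        rw [ENNReal.ofReal_lt_ofReal_iff (by linarith)]
        linarith
      filter_upwards [(ENNReal.summable (f := fun w => etaFn (v w))).hasSum.eventually
        (lt_mem_nhds h1)] with W hW
      have h3 := ENNReal.toReal_mono (by rw [ENNReal.sum_ne_top]; exact fun w _ => hetat w) hW.le
      rwa [ENNReal.toReal_ofReal (by linarith), ENNReal.toReal_sum fun w _ => hetat w] at h3
  obtain ⟨W₀, hs₀, hη₀⟩ := (ht1.and ht2).exists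
  set W := W₀.filter fun w => ν.real (pre m ⁻¹' {w}) ≠ 0 with hW
  let p : W → ℝ := fun w => ν.real (pre m ⁻¹' {(w : Fin m → S)})
  have hp0 : ∀ w, 0 < p w := fun w =>
    lt_of_le_of_ne measureReal_nonneg (Finset.mem_filter.1 w.2).2.symm
  have hs : 1 - ε ≤ ∑ w, p w := by
    rw [show ∑ w, p w = ∑ w ∈ W, ν.real (pre m ⁻¹' {w}) from
      Finset.sum_coe_sort W fun w => ν.real (pre m ⁻¹' {w}), hW,
      Finset.sum_filter_ne_zero]
    exact hs₀
  have hη : m * c₁ - 1 ≤ ∑ w, p w * -Real.log (p w) := by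
    rw [show ∑ w, p w * -Real.log (p w) = ∑ w ∈ W, ν.real (pre m ⁻¹' {w}) *
        -Real.log (ν.real (pre m ⁻¹' {w})) from
      Finset.sum_coe_sort W fun w => ν.real (pre m ⁻¹' {w}) * -Real.log (ν.real (pre m ⁻¹' {w})), hW,
      Finset.sum_filter_of_ne fun w _ h => left_ne_zero_of_mul h]
    exact hη₀
  have hη0 : 0 ≤ ∑ w, p w * -Real.log (p w) := Finset.sum_nonneg fun w _ =>
    mul_nonneg (hp0 w).le (neg_nonneg.2 (Real.log_nonpos (hp0 w).le measureReal_le_one))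
  have hx : ∀ w : W, ∃ x : Space A, pre m x = w := fun w => by
    obtain ⟨x, hx⟩ := nonempty_of_measure_ne_zero
      (μ := ν) (s := pre m ⁻¹' {(w : Fin m → S)}) fun h => (hp0 w).ne' (by simp [p, measureReal_def, h])
    exact ⟨x, hx⟩
  choose x hx using hx
  set s := ∑ w, p w with hsdef
  have hs1 : s ≤ 1 := by
    have h := Finset.sum_coe_sort W fun w => ν.real (pre m ⁻¹' {w})
    have h2 : ∑ w ∈ W, v w ≤ 1 := hsum ▸ ENNReal.sum_le_tsum W
    have h3 := ENNReal.toReal_mono ENNReal.one_ne_top h2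
    rw [ENNReal.toReal_sum fun _ _ => measure_ne_top _ _, ENNReal.toReal_one] at h3
    exact h.trans_le h3
  have hs0 : 0 < s := by linarith
  have hsinv : s⁻¹ ≤ 1 + 2 * ε := by
    rw [inv_le_iff_one_le_mul₀ hs0]; nlinarith
  have hsinv1 : 1 ≤ s⁻¹ := (one_le_inv₀ hs0).2 hs1
  have hss : s⁻¹ * s = 1 := inv_mul_cancel₀ hs0.ne'
  have key : ∀ (g : Space A → ℝ) (D U : ℝ), Integrable g ν →
      (∀ z z', Agree m z z' → g z ≤ g z' + D) → (∀ z, g z ≤ U) → 0 ≤ U →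
      2 * ε * (|∫ z, g z ∂ν| + U) ≤ 1 →
      ∫ z, g z ∂ν - 1 - D ≤ ∑ w, s⁻¹ * p w * g (x w) := by
    intro g D U hg hD hU hU0 hb
    have h1 := sum_measureReal_mul_ge ν W x hx hg hD hU
    have h2 : ∑ w, s⁻¹ * p w * g (x w) = s⁻¹ * ∑ w, p w * g (x w) := by
      rw [Finset.mul_sum]; exact Finset.sum_congr rfl fun w _ => by ring
    rw [h2]
    have h3 : ∫ z, g z ∂ν - U * (1 - s) - D * s ≤ ∑ w, p w * g (x w) := h1
    have h4 := mul_le_mul_of_nonneg_left h3 (inv_nonneg.2 hs0.le)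
    refine le_trans ?_ h4
    have h5 : s⁻¹ * (∫ z, g z ∂ν - U * (1 - s) - D * s)
        = ∫ z, g z ∂ν + (s⁻¹ - 1) * ∫ z, g z ∂ν - U * (s⁻¹ - 1) - D := by
      linear_combination (U - D) * hss
    have h6 : -(2 * ε * |∫ z, g z ∂ν|) ≤ (s⁻¹ - 1) * ∫ z, g z ∂ν := by
      have a1 := neg_abs_le (∫ z, g z ∂ν)
      have a2 := abs_nonneg (∫ z, g z ∂ν)
      nlinarith
    have h7 : U * (s⁻¹ - 1) ≤ 2 * ε * U := by nlinarith
    rw [h5]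
    linarith
  have hpR : ∀ y : ℝ, y ≤ R → 2 * ε * y ≤ 1 := fun y hy => by
    rw [← hεR]; gcongr
  refine ⟨W, x, fun w => s⁻¹ * p w, hx, fun w => mul_pos (inv_pos.2 hs0) (hp0 w), ?_, ?_,
    fun r V hV => ?_⟩
  · rw [← Finset.mul_sum, hss]
  · have hb := integral_birkhoff measurable_shift hν hint m
    have hn : Integrable (nsum φ P m) ν := hb.1.sub (integrable_const _)
    have hnI : ∫ z, nsum φ P m z ∂ν = m * (I - P) := by
      simp only [nsum]
      rw [integral_sub hb.1 (integrable_const _), hb.2, integral_const, probReal_univ, one_smul]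
      ring
    have h1 := key (nsum φ P m) (2 * Real.log c₀) (Real.log c₀) hn
      (fun z z' h => hG.nsum_le_of_agree hc₀ h) (fun z => hG.nsum_le hc₀ m z) hlog
      (hpR _ (by
        rw [hnI, abs_mul, abs_of_nonneg (by positivity : (0 : ℝ) ≤ m)]
        have : (0 : ℝ) ≤ m := by positivity
        linarith))
    rw [hnI] at h1
    have h2 : ∑ w, s⁻¹ * p w * (-Real.log (s⁻¹ * p w) + nsum φ P m (x w))
        = s⁻¹ * ∑ w, p w * -Real.log (p w) + Real.log s + ∑ w, s⁻¹ * p w * nsum φ P m (x w) := by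
      have h3 : ∀ w, s⁻¹ * p w * (-Real.log (s⁻¹ * p w) + nsum φ P m (x w))
          = s⁻¹ * (p w * -Real.log (p w)) + s⁻¹ * Real.log s * p w
            + s⁻¹ * p w * nsum φ P m (x w) := fun w => by
        rw [Real.log_mul (inv_pos.2 hs0).ne' (hp0 w).ne', Real.log_inv]
        ring
      simp only [h3, Finset.sum_add_distrib, ← Finset.mul_sum, ← hsdef]
      linear_combination Real.log s * hss
    rw [h2]
    have h3 : -1 ≤ Real.log s := by
      have := Real.one_sub_inv_le_log_of_pos hs0
      linarith
    have h4 : m * c₁ - 1 ≤ s⁻¹ * ∑ w, p w * -Real.log (p w) :=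
      hη.trans (le_mul_of_one_le_left hη0 hsinv1)
    linarith
  · have hVm := hV.measurableSet
    have hind : Integrable (V.indicator (1 : Space A → ℝ)) ν :=
      (integrable_indicator_iff hVm).2 (integrableOn_const (C := (1 : ℝ)))
    have hb := integral_birkhoff measurable_shift hν hind m
    rw [integral_indicator_one hVm] at hb
    have hm0 : (0 : ℝ) ≤ m := by positivity
    have hVle : m * ν.real V ≤ m := mul_le_of_le_one_right hm0 measureReal_le_one
    have hV0 : 0 ≤ m * ν.real V := by positivity
    have hvI : ∫ z, visits (shift A) V m z ∂ν = m * ν.real V := hb.2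
    have hlow : 0 ≤ m * |I - P| := by positivity
    have h1 := key (visits (shift A) V m) r m hb.1
      (fun z z' h => by have := (abs_le.1 (abs_visits_sub_le hV h)).2; linarith)
      (fun z => visits_le _ _ _ _) hm0
      (hpR _ (by rw [hvI, abs_of_nonneg hV0]; linarith))
    have h2 := key (fun z => -visits (shift A) V m z) r 0 hb.1.neg
      (fun z z' h => by have := (abs_le.1 (abs_visits_sub_le hV h)).1; linarith)
      (fun z => neg_nonpos.2 (visits_nonneg _ _ _ _)) le_rfl
      (hpR _ (by rw [integral_neg, hvI, abs_neg, abs_of_nonneg hV0]; linarith))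
    rw [integral_neg, hvI] at h2
    rw [hvI] at h1
    simp only [mul_neg, Finset.sum_neg_distrib] at h2
    rw [abs_le]
    constructor <;> linarith

end Model

/-! ### The lower bound -/

section LowerBound

lemma integrable_of_integralGtBot {X : Type*} [MeasurableSpace X] {φ : X → ℝ} (hφ : Measurable φ)
    {B : ℝ} (hB : ∀ x, φ x ≤ B) {ν : Measure X} [IsFiniteMeasure ν] (h : IntegralGtBot φ ν) :
    Integrable φ ν ∧ eintegral φ ν = ((∫ x, φ x ∂ν : ℝ) : EReal) := by
  have h1 : ∫⁻ x, ENNReal.ofReal (φ x) ∂ν ≠ ⊤ := by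
    refine ne_top_of_le_ne_top ?_ (lintegral_mono fun x => ENNReal.ofReal_le_ofReal (hB x))
    rw [lintegral_const]
    finiteness
  have hint : Integrable φ ν := by
    refine ⟨hφ.aestronglyMeasurable, ?_⟩
    rw [hasFiniteIntegral_iff_norm]
    calc ∫⁻ x, ENNReal.ofReal ‖φ x‖ ∂ν
        ≤ ∫⁻ x, (ENNReal.ofReal (φ x) + ENNReal.ofReal (-φ x)) ∂ν := by
          refine lintegral_mono fun x => ?_
          rcases le_total 0 (φ x) with hx | hx
          · rw [Real.norm_of_nonneg hx]; exact le_self_add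
          · rw [Real.norm_of_nonpos hx]; exact le_add_self
      _ = ∫⁻ x, ENNReal.ofReal (φ x) ∂ν + ∫⁻ x, ENNReal.ofReal (-φ x) ∂ν :=
          lintegral_add_left hφ.ennreal_ofReal _
      _ < ⊤ := ENNReal.add_lt_top.2 ⟨h1.lt_top, h.lt_top⟩
  refine ⟨hint, ?_⟩
  rw [integral_eq_lintegral_pos_part_sub_lintegral_neg_part hint, eintegral, EReal.coe_sub,
    EReal.coe_ennreal_toReal h1, EReal.coe_ennreal_toReal h]

variable {S : Type*} {A : S → S → Prop} [TopologicalSpace S] [DiscreteTopology S] [Countable S]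
  {φ : Space A → ℝ} {μ : Measure (Space A)} [IsProbabilityMeasure μ] {c₀ P : ℝ} {N : ℕ} {κ : ℝ}

lemma exists_of_lt_freeEnergy (hφ : Measurable φ) {B : ℝ} (hB : ∀ x, φ x ≤ B)
    (ν : ProbabilityMeasure (Space A)) {c : ℝ} (hc : (c : EReal) < freeEnergy (shift A) φ P ν) :
    Invariant (shift A) (ν : Measure (Space A)) ∧ Integrable φ (ν : Measure (Space A)) ∧
      ∃ c₁ : ℝ, c < c₁ + ∫ z, φ z ∂(ν : Measure (Space A)) - P ∧ ∀ m₀ : ℕ, ∃ m ≥ m₀,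
        ENNReal.ofReal (m * c₁) ≤ partitionEntropy (ν : Measure (Space A)) (pre m) := by
  have hinv : Invariant (shift A) (ν : Measure (Space A)) ∧
      IntegralGtBot φ (ν : Measure (Space A)) := by
    by_contra h
    rw [freeEnergy, if_neg h] at hc
    exact not_lt_bot hc
  obtain ⟨hint, heq⟩ := integrable_of_integralGtBot hφ hB hinv.2
  rw [freeEnergy, if_pos hinv, heq] at hc
  refine ⟨hinv.1, hint, ?_⟩
  set I := ∫ z, φ z ∂(ν : Measure (Space A)) with hI
  rcases lt_or_ge c (I - P) with h | h
  · exact ⟨0, by linarith, fun m₀ => ⟨m₀, le_rfl, by simp⟩⟩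
  · have h1 : ENNReal.ofReal (c - I + P) < entropy (shift A) (ν : Measure (Space A)) := by
      by_contra! hle
      refine hc.not_ge ?_
      have h2 := EReal.coe_ennreal_le_coe_ennreal_iff.2 hle
      rw [EReal.coe_ennreal_ofReal, max_eq_left (by linarith)] at h2
      calc _ ≤ ((c - I + P : ℝ) : EReal) + (I : EReal) - (P : EReal) :=
            EReal.sub_le_sub (add_le_add h2 le_rfl) le_rfl
        _ = (c : EReal) := by
            rw [← EReal.coe_add, ← EReal.coe_sub]; congr 1; ring
    obtain ⟨b, hb1, hb2⟩ := exists_between h1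
    have hbt : b ≠ ⊤ := (hb2.trans_le le_top).ne
    refine ⟨b.toReal, ?_, fun m₀ => ?_⟩
    · have := (ENNReal.ofReal_lt_iff_lt_toReal (by linarith) hbt).1 hb1
      linarith
    · obtain ⟨m, hm, hle⟩ := exists_le_partitionEntropy_pre _ hinv.1 hb2 m₀
      refine ⟨m, hm, le_trans (le_of_eq ?_) hle⟩
      rw [ENNReal.ofReal_mul (by positivity), ENNReal.ofReal_natCast, ENNReal.ofReal_toReal hbt]

/-- The weight of points whose empirical measures are close to an invariant measure is at least
exponential in its free energy. -/
lemma Fam.eventually_le_mass (hφ : Measurable φ) (hc₀ : 1 ≤ c₀) (hG : IsGibbsWith A φ μ c₀ P)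
    (h : Connects φ P N κ) (hA : NoZeroRowCol A) {a : S} {C : ℕ → Set (Space A)}
    (hC : Fam φ P N κ a C) (ν : ProbabilityMeasure (Space A))
    {G : Set (ProbabilityMeasure (Space A))} (hGo : IsOpen G) (hν : ν ∈ G) {c : ℝ}
    (hc : (c : EReal) < freeEnergy (shift A) φ P ν) :
    ∀ᶠ n : ℕ in atTop, ENNReal.ofReal (Real.exp (c * n))
      ≤ mass φ P n (C n ∩ {x | empirical (shift A) x n ∈ G}) := by
  classical
  obtain ⟨r, 𝒱, ε, hε, h𝒱, hnear⟩ := exists_finset_depOn_of_mem_isOpen ν hGo hν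
  obtain ⟨hinv, hint, c₁, hc₁, hent⟩ := exists_of_lt_freeEnergy hφ (hG.le_const hc₀) ν hc
  set I := ∫ z, φ z ∂(ν : Measure (Space A)) with hI
  set D := 2 * Real.log c₀ with hD
  set α := c₁ + I - P - c with hα
  have hα0 : 0 < α := by linarith
  obtain ⟨m₁, hm₁⟩ := exists_nat_ge ((7 + 2 * D + κ + c * N) / α)
  obtain ⟨m₂, hm₂⟩ := exists_nat_ge (2 * (2 * r + 2 * N + 2) / ε)
  obtain ⟨m, hm, hH⟩ := hent (m₁ + m₂ + 1)
  have hm1 : 1 ≤ m := by omega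
  have hmα : 7 + 2 * D + κ + c * N ≤ m * α := by
    rw [div_le_iff₀ hα0] at hm₁
    refine hm₁.trans (mul_le_mul_of_nonneg_right ?_ hα0.le)
    exact_mod_cast (by omega : m₁ ≤ m)
  have hmε : 2 * (2 * r + 2 * N + 2) ≤ m * ε := by
    rw [div_le_iff₀ hε] at hm₂
    refine hm₂.trans (mul_le_mul_of_nonneg_right ?_ hε.le)
    exact_mod_cast (by omega : m₂ ≤ m)
  obtain ⟨W, x, q, hxW, hq0, hq1, hE, hVis⟩ := exists_finite_model hc₀ hG
    (ν : Measure (Space A)) hinv hint hH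
  obtain ⟨K, hK⟩ := hC.exists_blocks hc₀ hG h hA hm1
  let f₀ : W → ℝ := fun w => -Real.log (q w) + nsum φ P m (x w)
  let F : Option 𝒱 → W → ℝ := fun o => o.elim f₀ fun V w => visits (shift A) V m (x w)
  have htyp := eventually_sum_prod_typical q (fun w => (hq0 w).le) hq1 F one_pos
  obtain ⟨k₀, hk₀⟩ := eventually_atTop.1 htyp
  obtain ⟨k₁, hk₁⟩ := exists_nat_gt (r + K + 1 + 3 * N + m)
  obtain ⟨k₂, hk₂⟩ := exists_nat_gt (K + |c| * (m + 3 * N + 1) + 1)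
  filter_upwards [eventually_ge_atTop (1 + 2 * N + (k₀ + k₁ + k₂ + 1) * (m + N))] with n hn
  obtain ⟨k, j, hkk, hj, hnk⟩ : ∃ k j, k₀ + k₁ + k₂ + 1 ≤ k ∧ j < m + N ∧
      n = 1 + N + (k * (m + N) + j) + N := by
    refine ⟨(n - (1 + 2 * N)) / (m + N), (n - (1 + 2 * N)) % (m + N), ?_,
      Nat.mod_lt _ (by omega), ?_⟩
    · rw [Nat.le_div_iff_mul_le (by omega)]; omega
    · have := Nat.div_add_mod' (n - (1 + 2 * N)) (m + N); omega
  have hkR1 : r + K + 1 + 3 * N + m < k := hk₁.trans_le (by exact_mod_cast (by omega : k₁ ≤ k))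
  have hkR2 : K + |c| * (m + 3 * N + 1) + 1 < k :=
    hk₂.trans_le (by exact_mod_cast (by omega : k₂ ≤ k))
  have hjR : (j : ℝ) ≤ m + N := by exact_mod_cast hj.le
  have hnR : (n : ℝ) = 1 + N + (k * (m + N) + j) + N := by rw [hnk]; push_cast; ring
  have hn1 : 1 ≤ n := by omega
  choose y hyC hyA hyS hyV using fun t : Fin k → W => hK k j hj fun i => x (t i)
  rw [← hnk] at hyC hyS hyV
  set T : Finset (Fin k → W) := Finset.univ.filter fun t =>
    ∀ o, |∑ i, F o (t i) - k * ∑ a, q a * F o a| ≤ k * 1 with hT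
  have hTsum : 1 / 2 ≤ ∑ t ∈ T, ∏ i, q (t i) := hk₀ k (by omega)
  have hTmem : ∀ t ∈ T, ∀ o, |∑ i, F o (t i) - k * ∑ a, q a * F o a| ≤ k * 1 := fun t ht =>
    (Finset.mem_filter.1 ht).2
  have hyinj : ∀ t ∈ T, ∀ t' ∈ T, y t = y t' → t = t' := by
    intro t _ t' _ htt
    funext i
    refine Subtype.ext ?_
    rw [← hxW (t i), ← hxW (t' i), pre_eq_iff]
    exact (hyA t i).symm.trans (htt ▸ hyA t' i)
  have hyG : ∀ t ∈ T, y t ∈ C n ∩ {x | empirical (shift A) x n ∈ G} := by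
    refine fun t ht => ⟨hyC t, hnear _ fun V hV => ?_⟩
    have e1 := abs_le.1 (hyV t r V (h𝒱 V hV))
    have e2 := abs_le.1 (hTmem t ht (some ⟨V, hV⟩))
    have e3 := abs_le.1 (hVis r V (h𝒱 V hV))
    simp only [F, Option.elim_some] at e2
    rw [empirical_real _ _ hn1 (h𝒱 V hV).measurableSet]
    have hnpos : (0 : ℝ) < n := by exact_mod_cast hn1
    set νV := (ν : Measure (Space A)).real V with hνV
    have hν0 : 0 ≤ νV := measureReal_nonneg
    have hν1 : νV ≤ 1 := measureReal_le_one
    have hk0 : (0 : ℝ) ≤ k := by positivity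
    set Q := ∑ w, q w * visits (shift A) V m (x w) with hQ
    have e4 : k * Q ≤ k * (m * νV + r + 1) := mul_le_mul_of_nonneg_left (by linarith) hk0
    have e5 : k * (m * νV - r - 1) ≤ k * Q := mul_le_mul_of_nonneg_left (by linarith) hk0
    have e6 : n * νV - k * m * νV ≤ 1 + 2 * N + (m + N) + k * N := by
      have : n * νV - k * m * νV = (n - k * m) * νV := by ring
      rw [this]
      have h0 : 0 ≤ (n - k * m : ℝ) := by rw [hnR]; ring_nf; positivity
      refine (mul_le_of_le_one_right h0 hν1).trans ?_
      rw [hnR]; linarith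
    have e7 : 0 ≤ n * νV - k * m * νV := by
      have : n * νV - k * m * νV = (n - k * m) * νV := by ring
      rw [this]
      refine mul_nonneg ?_ hν0
      rw [hnR]; ring_nf; positivity
    have e8 : k * (2 * (2 * r + 2 * N + 2)) ≤ k * (m * ε) := mul_le_mul_of_nonneg_left hmε hk0
    have e9 : k * m * ε ≤ n * ε := by
      refine mul_le_mul_of_nonneg_right ?_ hε.le
      rw [hnR]; ring_nf
      have : (0 : ℝ) ≤ 1 + N * 2 + N * k + j := by positivity
      linarith
    have e10 : (0 : ℝ) ≤ k * r := by positivity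
    have e11 : (0 : ℝ) ≤ k * N := by positivity
    have e12 : |visits (shift A) V n (y t) - n * νV| < n * ε := by
      rw [abs_lt]
      constructor <;> linarith
    have e13 : (n : ℝ)⁻¹ * visits (shift A) V n (y t) - νV
        = (n : ℝ)⁻¹ * (visits (shift A) V n (y t) - n * νV) := by
      field_simp
    rw [e13, abs_mul, abs_of_pos (inv_pos.2 hnpos), inv_mul_lt_iff₀ hnpos]
    exact e12
  refine le_trans ?_ (sum_le_mass φ P n T y hyG hyinj)
  rw [← ENNReal.ofReal_sum_of_nonneg fun t _ => (Real.exp_pos _).le]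
  refine ENNReal.ofReal_le_ofReal ?_
  have hE' : Real.exp (c * n + 1) * ∑ t ∈ T, ∏ i, q (t i) ≤ ∑ t ∈ T, Real.exp (nsum φ P n (y t)) := by
    rw [Finset.mul_sum]
    refine Finset.sum_le_sum fun t ht => ?_
    have e1 := (abs_le.1 (hTmem t ht none)).1
    simp only [F, Option.elim_none, f₀, Finset.sum_add_distrib, Finset.sum_neg_distrib] at e1
    have e2 : ∏ i, q (t i) = Real.exp (∑ i, Real.log (q (t i))) := by
      rw [Real.exp_sum]
      exact Finset.prod_congr rfl fun i _ => (Real.exp_log (hq0 _)).symm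
    rw [e2, ← Real.exp_add]
    refine Real.exp_le_exp.2 ?_
    have e3 := hyS t
    have hk0 : (0 : ℝ) ≤ k := by positivity
    have e4 := mul_le_mul_of_nonneg_left hE hk0
    have e5 := mul_le_mul_of_nonneg_left hmα hk0
    have e6 : c * n ≤ c * (k * (m + N)) + |c| * (m + 3 * N + 1) := by
      have h1 : c * (1 + 2 * N + j) ≤ |c| * (m + 3 * N + 1) :=
        mul_le_mul (le_abs_self c) (by linarith) (by positivity) (abs_nonneg c)
      rw [hnR]
      linarith
    rw [← hD] at e3 e4
    have e7 : k * (m * (c₁ + I - P) - 4 - D) = k * (m * α) + c * (k * m) - k * (4 + D) := by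
      rw [hα]; ring
    linarith
  refine le_trans ?_ hE'
  refine le_trans ?_ (mul_le_mul_of_nonneg_left hTsum (Real.exp_pos _).le)
  rw [Real.exp_add]
  have := Real.add_one_le_exp (1 : ℝ)
  have := Real.exp_pos (c * n)
  nlinarith

end LowerBound

/-! ### Bernoulli measures -/

section Bernoulli

variable {ι : Type*} [MeasurableSpace ι] (ρ : Measure ι) [IsProbabilityMeasure ρ]

/-- The Bernoulli measure with marginal `ρ`. -/
noncomputable def bernoulliMeasure : Measure (ℕ → ι) := Measure.infinitePi fun _ => ρ

instance : IsProbabilityMeasure (bernoulliMeasure ρ) := by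
  unfold bernoulliMeasure; infer_instance

lemma bernoulliMeasure_map_tail :
    (bernoulliMeasure ρ).map (fun ω i => ω (i + 1)) = bernoulliMeasure ρ := by
  refine Measure.eq_infinitePi _ fun s t ht => ?_
  rw [Measure.map_apply (by fun_prop) (MeasurableSet.pi s.countable_toSet fun i _ => ht i)]
  have : (fun (ω : ℕ → ι) i => ω (i + 1)) ⁻¹' Set.pi s t
      = Set.pi (s.map (addRightEmbedding 1)) fun i => t (i - 1) := by
    ext ω; simp
  rw [this, bernoulliMeasure, Measure.infinitePi_pi _ fun i _ => ht _]
  simp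

lemma bernoulliMeasure_map_eval : (bernoulliMeasure ρ).map (fun ω => ω 0) = ρ :=
  Measure.infinitePi_map_eval (fun _ => ρ) 0

variable [DiscreteMeasurableSpace ι]

lemma bernoulliMeasure_block (j : ℕ) (w : Fin j → ι) :
    bernoulliMeasure ρ ((fun ω => fun i : Fin j => ω (i + 1)) ⁻¹' {w}) = ∏ i, ρ {w i} := by
  classical
  let t : ℕ → Set ι := fun n => if h : n - 1 < j then {w ⟨n - 1, h⟩} else Set.univ
  have ht : ∀ i : Fin j, t (i + 1) = {w i} := fun i => by simp [t]
  let e : Fin j ↪ ℕ := ⟨fun i => i + 1, fun i i' h => Fin.ext (by simpa using h)⟩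
  have : (fun (ω : ℕ → ι) => fun i : Fin j => ω (i + 1)) ⁻¹' {w}
      = Set.pi (Finset.univ.map e) t := by
    ext ω
    simp only [Set.mem_preimage, Set.mem_singleton_iff, funext_iff, Set.mem_pi, Finset.coe_map,
      Finset.coe_univ, Set.image_univ, Set.forall_mem_range]
    refine forall_congr' fun i => ?_
    change _ ↔ ω (i + 1) ∈ t (i + 1)
    rw [ht, Set.mem_singleton_iff]
  rw [this, bernoulliMeasure, Measure.infinitePi_pi _ fun i _ => MeasurableSet.of_discrete,
    Finset.prod_map]
  exact Finset.prod_congr rfl fun i _ => by rw [← ht i]; rfl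

variable [Fintype ι]

lemma partitionEntropy_bernoulliMeasure_block (hρ : ∀ a, 0 < ρ.real {a}) (j : ℕ) :
    partitionEntropy (bernoulliMeasure ρ) (fun ω => fun i : Fin j => ω (i + 1))
      = ENNReal.ofReal (j * ∑ a, ρ.real {a} * -Real.log (ρ.real {a})) := by
  have h1 : ∑ a, ρ.real {a} = 1 := by
    rw [sum_measureReal_singleton]; simp
  rw [← sum_prod_mul_sum_fin _ h1, partitionEntropy, tsum_fintype, ENNReal.ofReal_sum_of_nonneg]
  · refine Finset.sum_congr rfl fun w _ => ?_
    rw [bernoulliMeasure_block, ENNReal.toReal_prod]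
    change ENNReal.ofReal (-((∏ i, ρ.real {w i}) * Real.log (∏ i, ρ.real {w i}))) = _
    rw [Real.log_prod fun i _ => (hρ _).ne']
    simp
  · intro w _
    refine mul_nonneg (Finset.prod_nonneg fun i _ => (hρ _).le) (Finset.sum_nonneg fun i _ => ?_)
    exact neg_nonneg.2 (Real.log_nonpos (hρ _).le measureReal_le_one)

end Bernoulli

/-! ### Averaging along orbits -/

section OrbitAverage

variable {X : Type*} [MeasurableSpace X] {T : X → X} {ν₀ : Measure X}

/-- The average of the images of a measure under the first `p` iterates. -/
noncomputable def orbitAverage (T : X → X) (p : ℕ) (ν₀ : Measure X) : Measure X :=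
  ∑ i ∈ Finset.range p, (p : ℝ≥0∞)⁻¹ • ν₀.map T^[i]

lemma isProbabilityMeasure_orbitAverage (hT : Measurable T) {p : ℕ} (hp : 1 ≤ p)
    [IsProbabilityMeasure ν₀] : IsProbabilityMeasure (orbitAverage T p ν₀) := by
  have h : ∀ i, IsProbabilityMeasure (ν₀.map T^[i]) := fun i =>
    Measure.isProbabilityMeasure_map (hT.iterate i).aemeasurable
  refine ⟨?_⟩
  simp only [orbitAverage, Measure.finsetSum_apply, Measure.smul_apply, measure_univ, smul_eq_mul,
    mul_one, Finset.sum_const, Finset.card_range, nsmul_eq_mul]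
  exact ENNReal.mul_inv_cancel (by exact_mod_cast (by omega : p ≠ 0)) (by finiteness)

lemma invariant_orbitAverage (hT : Measurable T) {p : ℕ} (h : ν₀.map T^[p] = ν₀) :
    Invariant T (orbitAverage T p ν₀) := by
  refine Measure.ext fun s hs => ?_
  have hstep : ∀ i, (ν₀.map T^[i]) (T ⁻¹' s) = (ν₀.map T^[i + 1]) s := fun i => by
    rw [← Measure.map_apply hT hs, Measure.map_map hT (hT.iterate i), Function.iterate_succ']
  rw [Measure.map_apply hT hs, orbitAverage]
  simp only [Measure.finsetSum_apply, Measure.smul_apply, hstep, ← Finset.smul_sum]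
  congr 1
  rcases p with _ | p
  · simp
  rw [Finset.sum_range_succ, h, Finset.sum_range_succ']
  simp

lemma integral_orbitAverage (hT : Measurable T) (p : ℕ) {f : X → ℝ} (hf : Measurable f)
    (hint : ∀ i < p, Integrable (fun x => f (T^[i] x)) ν₀) :
    Integrable f (orbitAverage T p ν₀) ∧ Integrable (birkhoff T f p) ν₀ ∧
      ∫ x, f x ∂(orbitAverage T p ν₀) = (p : ℝ)⁻¹ * ∫ x, birkhoff T f p x ∂ν₀ := by
  rcases Nat.eq_zero_or_pos p with rfl | hp
  · have : birkhoff T f 0 = fun _ => 0 := funext fun x => by simp [birkhoff]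
    simp [orbitAverage, this]
  have hpt : ((p : ℝ≥0∞)⁻¹) ≠ ⊤ := by
    simp; omega
  have hint' : ∀ i ∈ Finset.range p, Integrable f ((p : ℝ≥0∞)⁻¹ • ν₀.map T^[i]) := fun i hi =>
    ((integrable_map_measure hf.aestronglyMeasurable (hT.iterate i).aemeasurable).2
      (hint i (Finset.mem_range.1 hi))).smul_measure hpt
  refine ⟨integrable_finsetSum_measure.2 hint', integrable_finsetSum _ fun i hi =>
    hint i (Finset.mem_range.1 hi), ?_⟩
  rw [orbitAverage, integral_finsetSum_measure hint']
  simp only [birkhoff]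
  rw [integral_finsetSum _ fun i hi => hint i (Finset.mem_range.1 hi), Finset.mul_sum]
  refine Finset.sum_congr rfl fun i _ => ?_
  rw [integral_smul_measure, integral_map (hT.iterate i).aemeasurable hf.aestronglyMeasurable]
  simp

end OrbitAverage

/-! ### Horseshoes made of periodic points -/

section Horseshoe

variable {S : Type*} {A : S → S → Prop} {ι : Type*} {p : ℕ} {a : S} {x : ι → Space A}

/-- A finite family of distinct `p`-periodic points starting with the same symbol. -/
structure PeriodicFamily (p : ℕ) (a : S) (x : ι → Space A) : Prop where
  pos : 1 ≤ p
  per : ∀ w, (shift A)^[p] (x w) = x w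
  head : ∀ w, (x w).1 0 = a
  inj : ∀ w w', Agree p (x w) (x w') → w = w'

namespace PeriodicFamily

/-- Concatenation of periodic blocks. -/
def concat (h : PeriodicFamily p a x) (ω : ℕ → ι) : Space A :=
  ⟨fun i => (x (ω (i / p))).1 (i % p), fun i => by
    have hp := h.pos
    have hv : i % p < p := Nat.mod_lt _ hp
    have hi := Nat.div_add_mod i p
    set u := i / p
    set v := i % p
    have hA := (x (ω u)).2 v
    change A ((x (ω u)).1 v) ((x (ω ((i + 1) / p))).1 ((i + 1) % p))
    rcases Nat.lt_or_ge (v + 1) p with h1 | h1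
    · have h2 : (i + 1) / p = u := by
        rw [← hi, add_assoc, Nat.mul_add_div hp, Nat.div_eq_of_lt h1, add_zero]
      have h3 : (i + 1) % p = v + 1 := by
        rw [← hi, add_assoc, Nat.mul_add_mod, Nat.mod_eq_of_lt h1]
      rwa [h2, h3]
    · have h4 : v + 1 = p := by omega
      have h2 : (i + 1) / p = u + 1 := by
        rw [← hi, add_assoc, h4, Nat.mul_add_div hp, Nat.div_self hp]
      have h3 : (i + 1) % p = 0 := by
        rw [← hi, add_assoc, h4, Nat.mul_add_mod, Nat.mod_self]
      rw [h2, h3, h.head, ← h.head (ω u)]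
      rw [h4] at hA
      have h5 := shift_iterate_apply p (x (ω u)) 0
      rw [h.per] at h5
      rwa [h5]⟩

lemma concat_apply (h : PeriodicFamily p a x) (ω : ℕ → ι) (u : ℕ) {v : ℕ} (hv : v < p) :
    (h.concat ω).1 (p * u + v) = (x (ω u)).1 v := by
  have h2 : (p * u + v) / p = u := by
    rw [Nat.mul_add_div h.pos, Nat.div_eq_of_lt hv, add_zero]
  have h3 : (p * u + v) % p = v := by
    rw [Nat.mul_add_mod, Nat.mod_eq_of_lt hv]
  simp only [concat, h2, h3]

lemma agree_concat (h : PeriodicFamily p a x) (ω : ℕ → ι) : Agree p (h.concat ω) (x (ω 0)) :=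
  fun i hi => by simpa using h.concat_apply ω 0 hi

lemma shift_concat (h : PeriodicFamily p a x) (ω : ℕ → ι) :
    (shift A)^[p] (h.concat ω) = h.concat fun i => ω (i + 1) := by
  refine space_ext fun i => ?_
  rw [shift_iterate_apply, ← Nat.div_add_mod i p,
    h.concat_apply (fun i => ω (i + 1)) _ (Nat.mod_lt _ h.pos), ← add_assoc, add_comm p,
    ← Nat.mul_add_one,     h.concat_apply _ _ (Nat.mod_lt _ h.pos)]

variable [TopologicalSpace S] [DiscreteTopology S] [Countable S]

lemma measurable_concat [MeasurableSpace ι] [DiscreteMeasurableSpace ι]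
    (h : PeriodicFamily p a x) : Measurable h.concat := by
  refine Measurable.mono (measurable_generateFrom (s := {V | ∃ r, DepOn r V}) ?_) le_rfl
    generateFrom_depOn.le
  rintro V ⟨r, hV⟩
  rw [hV.eq_preimage, ← Set.preimage_comp]
  let _ : MeasurableSpace S := ⊤
  have hm : Measurable (pre r ∘ h.concat) := by
    refine measurable_pi_lambda _ fun i => ?_
    exact (Measurable.of_discrete (f := fun w => (x w).1 (i % p))).comp
      (measurable_pi_apply (i / p : ℕ))
  exact hm (Set.to_countable _).measurableSet

/-- The stationary process obtained by concatenating independent random blocks. -/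
noncomputable def process [MeasurableSpace ι] (h : PeriodicFamily p a x) (ρ : Measure ι)
    [IsProbabilityMeasure ρ] : Measure (Space A) :=
  orbitAverage (shift A) p ((bernoulliMeasure ρ).map h.concat)

section

variable [MeasurableSpace ι] [DiscreteMeasurableSpace ι] (h : PeriodicFamily p a x)
  (ρ : Measure ι) [IsProbabilityMeasure ρ]

instance : IsProbabilityMeasure (h.process ρ) :=
  have := Measure.isProbabilityMeasure_map (μ := bernoulliMeasure ρ) h.measurable_concat.aemeasurable
  isProbabilityMeasure_orbitAverage measurable_shift h.pos

lemma invariant_process : Invariant (shift A) (h.process ρ) := by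
  refine invariant_orbitAverage measurable_shift ?_
  rw [Measure.map_map (measurable_shift.iterate p) h.measurable_concat]
  have : (shift A)^[p] ∘ h.concat = h.concat ∘ fun ω i => ω (i + 1) := funext h.shift_concat
  rw [this, ← Measure.map_map h.measurable_concat (by fun_prop), bernoulliMeasure_map_tail]

lemma abs_integral_process_sub_le [Fintype ι] {f : Space A → ℝ} (hf : Measurable f) {C D : ℝ}
    (hC : ∀ ω, ∀ i < p, |f ((shift A)^[i] (h.concat ω))| ≤ C)
    (hD : ∀ ω, |birkhoff (shift A) f p (h.concat ω) - birkhoff (shift A) f p (x (ω 0))| ≤ D) :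
    Integrable f (h.process ρ) ∧
      |∫ z, f z ∂h.process ρ - (p : ℝ)⁻¹ * ∑ w, ρ.real {w} * birkhoff (shift A) f p (x w)|
        ≤ (p : ℝ)⁻¹ * D := by
  have hΘ := h.measurable_concat
  have hint : ∀ i < p,
      Integrable (fun z => f ((shift A)^[i] z)) ((bernoulliMeasure ρ).map h.concat) := by
    intro i hi
    have hm : Measurable fun z => f ((shift A)^[i] z) := hf.comp (measurable_shift.iterate i)
    rw [integrable_map_measure hm.aestronglyMeasurable hΘ.aemeasurable]
    exact Integrable.of_bound (hm.comp hΘ).aestronglyMeasurable C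
      (ae_of_all _ fun ω => hC ω i hi)
  obtain ⟨h1, h2, h3⟩ := integral_orbitAverage measurable_shift p hf hint
  refine ⟨h1, ?_⟩
  have h0 : Measurable fun ω : ℕ → ι => ω 0 := measurable_pi_apply 0
  have h4 : ∑ w, ρ.real {w} * birkhoff (shift A) f p (x w)
      = ∫ ω, birkhoff (shift A) f p (x (ω 0)) ∂bernoulliMeasure ρ := by
    have h5 := integral_map (μ := bernoulliMeasure ρ) h0.aemeasurable
      (f := fun w => birkhoff (shift A) f p (x w)) (Measurable.of_discrete).aestronglyMeasurable
    rw [← h5, bernoulliMeasure_map_eval, integral_fintype (Integrable.of_finite)]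
    rfl
  have h6 : Integrable (fun ω => birkhoff (shift A) f p (h.concat ω)) (bernoulliMeasure ρ) :=
    h2.comp_measurable hΘ
  have h7 : Integrable (fun ω : ℕ → ι => birkhoff (shift A) f p (x (ω 0))) (bernoulliMeasure ρ) :=
    Integrable.comp_measurable (g := fun w => birkhoff (shift A) f p (x w)) Integrable.of_finite h0
  rw [process, h3, h4, integral_map hΘ.aemeasurable h2.aestronglyMeasurable, ← mul_sub,
    ← integral_sub h6 h7, abs_mul, abs_of_nonneg (by positivity)]
  refine mul_le_mul_of_nonneg_left ?_ (by positivity)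
  have h8 := norm_integral_le_of_norm_le_const (μ := bernoulliMeasure ρ) (C := D)
    (f := fun ω => birkhoff (shift A) f p (h.concat ω) - birkhoff (shift A) f p (x (ω 0)))
    (ae_of_all _ fun ω => hD ω)
  simpa using h8

lemma le_entropy_process [Fintype ι] [Nonempty ι] (hρ : ∀ w, 0 < ρ.real {w}) :
    ENNReal.ofReal ((p : ℝ)⁻¹ * ∑ w, ρ.real {w} * -Real.log (ρ.real {w}))
      ≤ entropy (shift A) (h.process ρ) := by
  classical
  have hΘ := h.measurable_concat
  set H := ∑ w, ρ.real {w} * -Real.log (ρ.real {w}) with hH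
  have hH0 : 0 ≤ H := Finset.sum_nonneg fun w _ =>
    mul_nonneg (hρ w).le (neg_nonneg.2 (Real.log_nonpos (hρ w).le measureReal_le_one))
  obtain ⟨enc, henc⟩ := exists_injective_nat S
  let F : Finset S := Finset.univ.biUnion fun w : ι => (Finset.range p).image (x w).1
  let code₀ : S → ℕ := fun s => if s ∈ F then enc s + 1 else 0
  let code : Space A → ℕ := fun z => code₀ (z.1 0)
  have hcode_inj : ∀ s ∈ F, ∀ s' ∈ F, code₀ s = code₀ s' → s = s' := by
    intro s hs s' hs' hss
    simp only [code₀, if_pos hs, if_pos hs'] at hss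
    exact henc (by omega)
  have hF : ∀ w, ∀ v < p, (x w).1 v ∈ F := fun w v hv =>
    Finset.mem_biUnion.2 ⟨w, Finset.mem_univ _, Finset.mem_image_of_mem _ (Finset.mem_range.2 hv)⟩
  have hcode : Measurable code :=
    ((continuous_of_discreteTopology (f := code₀)).comp (continuous_coord 0)).measurable
  have hrange : (Set.range code).Finite := by
    refine (((F.image fun s => enc s + 1) ∪ {0}).finite_toSet).subset ?_
    rintro _ ⟨z, rfl⟩
    simp only [code, code₀]
    split_ifs with hz
    · exact Finset.mem_coe.2 (Finset.mem_union_left _ (Finset.mem_image_of_mem _ hz))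
    · simp
  have hblock : ∀ i < p, ∀ n : ℕ, ENNReal.ofReal ((n / p - 1 : ℕ) * H)
      ≤ partitionEntropy (((bernoulliMeasure ρ).map h.concat).map (shift A)^[i])
        (fun z => fun j : Fin n => code ((shift A)^[j] z)) := by
    intro i hi n
    have hmeas : ∀ w : Fin n → ℕ, MeasurableSet
        ((fun z : Space A => fun j : Fin n => code ((shift A)^[j] z)) ⁻¹' {w}) :=
      measurableSet_preimage_itinerary measurable_shift
        (fun a => hcode (measurableSet_singleton a)) n
    have hmΘ : Measurable ((shift A)^[i] ∘ h.concat) :=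
      (measurable_shift.iterate i).comp hΘ
    rw [Measure.map_map (measurable_shift.iterate i) hΘ, partitionEntropy_map hmΘ _ hmeas,
      ← partitionEntropy_bernoulliMeasure_block ρ hρ]
    set g : (ℕ → ι) → Fin n → ℕ := fun ω j => code ((shift A)^[j] ((shift A)^[i] (h.concat ω)))
      with hg
    have hcoord : ∀ ω, ∀ j : Fin n, g ω j = code₀ ((h.concat ω).1 (i + j)) := fun ω j => by
      simp only [g, code, shift_iterate_apply, add_zero]
    have hfac : Function.FactorsThrough
        (fun (ω : ℕ → ι) => fun l : Fin (n / p - 1) => ω (l + 1)) g := by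
      intro ω ω' hωω
      funext l
      refine h.inj _ _ fun v hv => ?_
      have hl : (l : ℕ) + 2 ≤ n / p := by omega
      have hl2 : p * (l + 2) ≤ n := (Nat.mul_le_mul_left p hl).trans (Nat.mul_div_le n p)
      have hl3 : p * (l + 2) = p * (l + 1) + p := by ring
      have hl4 : p ≤ p * (l + 1) := Nat.le_mul_of_pos_right _ (by omega)
      have h1 := congrFun hωω ⟨p * (l + 1) + v - i, by omega⟩
      rw [hcoord, hcoord] at h1
      simp only [show i + (p * (l + 1) + v - i) = p * (l + 1) + v by omega,
        h.concat_apply _ _ hv] at h1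
      exact hcode_inj _ (hF _ _ hv) _ (hF _ _ hv) h1
    have := partitionEntropy_comp_le (bernoulliMeasure ρ) g (fun w => hmΘ (hmeas w))
      (Function.extend g (fun (ω : ℕ → ι) => fun l : Fin (n / p - 1) => ω (l + 1))
        fun _ _ => Classical.arbitrary ι)
    simp only [hfac.extend_apply] at this
    exact this
  have hpos := h.pos
  have hppos : (0 : ℝ) < p := by exact_mod_cast hpos
  have hlow : ∀ n : ℕ, ENNReal.ofReal ((n / p - 1 : ℕ) * H)
      ≤ partitionEntropy (h.process ρ) (fun z => fun j : Fin n => code ((shift A)^[j] z)) := by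
    intro n
    have hprob : ∀ i ∈ Finset.range p,
        IsProbabilityMeasure (((bernoulliMeasure ρ).map h.concat).map (shift A)^[i]) := fun i _ =>
      have := Measure.isProbabilityMeasure_map (μ := bernoulliMeasure ρ) hΘ.aemeasurable
      Measure.isProbabilityMeasure_map (measurable_shift.iterate i).aemeasurable
    have hsum : ∑ i ∈ Finset.range p, (p : ℝ≥0∞)⁻¹ = 1 := by
      rw [Finset.sum_const, Finset.card_range, nsmul_eq_mul,
        ENNReal.mul_inv_cancel (by exact_mod_cast (by omega : p ≠ 0)) (by finiteness)]
    refine le_trans ?_ (partitionEntropy_sum_ge (Finset.range p) (fun _ => (p : ℝ≥0∞)⁻¹) hsum _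
      hprob _)
    calc ENNReal.ofReal ((n / p - 1 : ℕ) * H)
        = ∑ i ∈ Finset.range p, (p : ℝ≥0∞)⁻¹ * ENNReal.ofReal ((n / p - 1 : ℕ) * H) := by
          rw [← Finset.sum_mul, hsum, one_mul]
      _ ≤ _ := Finset.sum_le_sum fun i hi => by
          gcongr
          exact hblock i (Finset.mem_range.1 hi) n
  refine le_trans ?_ (le_iSup₂ (f := fun (p : Space A → ℕ) (_ : Measurable p ∧ (Set.range p).Finite) =>
    atTop.liminf fun n : ℕ => ENNReal.ofReal ((n : ℝ)⁻¹) *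
      partitionEntropy (h.process ρ) (fun x => fun i : Fin n => p ((shift A)^[i] x)))
    code ⟨hcode, hrange⟩)
  have hlim : Tendsto (fun n : ℕ => ENNReal.ofReal ((p : ℝ)⁻¹ * H - 2 * H * (n : ℝ)⁻¹)) atTop
      (𝓝 (ENNReal.ofReal ((p : ℝ)⁻¹ * H))) := by
    refine ENNReal.tendsto_ofReal ?_
    have h1 := (tendsto_inv_atTop_nhds_zero_nat (𝕜 := ℝ)).const_mul (2 * H)
    simpa using h1.const_sub ((p : ℝ)⁻¹ * H)
  rw [← hlim.liminf_eq]
  refine liminf_le_liminf ?_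
  filter_upwards [eventually_ge_atTop 1] with n hn
  refine le_trans ?_ (mul_le_mul_right (hlow n) _)
  have hn0 : (0 : ℝ) < n := by exact_mod_cast hn
  rw [← ENNReal.ofReal_mul (by positivity)]
  refine ENNReal.ofReal_le_ofReal ?_
  have h1 : (n : ℝ) / p - 2 ≤ (n / p - 1 : ℕ) := by
    have h2 : (n : ℝ) / p < (n / p : ℕ) + 1 := by
      rw [div_lt_iff₀ hppos]
      have h3 := Nat.div_add_mod n p
      have h4 := Nat.mod_lt n hpos
      have h5 : (n / p + 1) * p = p * (n / p) + p := by ring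
      exact_mod_cast (by omega : n < (n / p + 1) * p)
    have h3 : ((n / p : ℕ) : ℝ) ≤ (n / p - 1 : ℕ) + 1 := by exact_mod_cast (by omega)
    linarith
  calc (p : ℝ)⁻¹ * H - 2 * H * (n : ℝ)⁻¹ = (n : ℝ)⁻¹ * ((n / p - 2) * H) := by
        field_simp
    _ ≤ _ := by gcongr

end

end PeriodicFamily

end Horseshoe

/-! ### The upper bound -/

section UpperBound

lemma exists_lt_sum_of_lt_mass {S : Type*} {A : S → S → Prop} {φ : Space A → ℝ} {P : ℝ}
    {n : ℕ} {D : Set (Space A)} {t : ℝ≥0∞} (h : t < mass φ P n D) :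
    ∃ W : Finset D, t < ∑ x ∈ W, ENNReal.ofReal (Real.exp (nsum φ P n x)) := by
  rw [mass, ENNReal.tsum_eq_iSup_sum] at h
  exact lt_iSup_iff.1 h

variable {S : Type*} {A : S → S → Prop} [TopologicalSpace S] [DiscreteTopology S] [Countable S]
  {φ : Space A → ℝ} {μ : Measure (Space A)} [IsProbabilityMeasure μ] {c₀ P : ℝ} {N : ℕ} {κ : ℝ}

lemma measure_sum_dirac_real {ι : Type*} [Fintype ι] [MeasurableSpace ι] [DiscreteMeasurableSpace ι]
    {q : ι → ℝ} (hq : ∀ w, 0 ≤ q w) (w : ι) :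
    (∑ w, ENNReal.ofReal (q w) • Measure.dirac w).real {w} = q w := by
  classical
  rw [Measure.real, Measure.finsetSum_apply]
  simp [Set.indicator_apply, hq w]

lemma isProbabilityMeasure_sum_dirac {ι : Type*} [Fintype ι] [MeasurableSpace ι] {q : ι → ℝ}
    (hq : ∀ w, 0 ≤ q w) (hq1 : ∑ w, q w = 1) :
    IsProbabilityMeasure (∑ w, ENNReal.ofReal (q w) • Measure.dirac w : Measure ι) := by
  refine ⟨?_⟩
  rw [Measure.finsetSum_apply]
  simp only [Measure.smul_apply, measure_univ, smul_eq_mul, mul_one]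
  rw [← ENNReal.ofReal_sum_of_nonneg fun w _ => hq w, hq1, ENNReal.ofReal_one]

/-- A finite family of periodic points carries an invariant measure whose free energy is close to
the exponential growth rate of the weights of the family. -/
lemma PeriodicFamily.exists_measure (hφ : Measurable φ) (hc₀ : 1 ≤ c₀)
    (hG : IsGibbsWith A φ μ c₀ P) {ι : Type*} [Fintype ι] [Nonempty ι] {p : ℕ} {a : S}
    {x : ι → Space A} (h : PeriodicFamily p a x) :
    ∃ (ν : ProbabilityMeasure (Space A)) (q : ι → ℝ), (∀ w, 0 < q w) ∧ ∑ w, q w = 1 ∧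
      (∀ r V, DepOn r V → |(ν : Measure (Space A)).real V
        - (p : ℝ)⁻¹ * ∑ w, q w * visits (shift A) V p (x w)| ≤ (p : ℝ)⁻¹ * r) ∧
      (((p : ℝ)⁻¹ * (Real.log (∑ w, Real.exp (nsum φ P p (x w))) - 2 * Real.log c₀) : ℝ) : EReal)
        ≤ freeEnergy (shift A) φ P ν := by
  let _ : MeasurableSpace ι := ⊤
  have hp0 : (0 : ℝ) < p := by exact_mod_cast h.pos
  set Z := ∑ w, Real.exp (nsum φ P p (x w)) with hZ
  have hZ0 : 0 < Z := Finset.sum_pos (fun w _ => Real.exp_pos _) Finset.univ_nonempty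
  set q : ι → ℝ := fun w => Real.exp (nsum φ P p (x w)) / Z with hq
  have hq0 : ∀ w, 0 < q w := fun w => div_pos (Real.exp_pos _) hZ0
  have hq1 : ∑ w, q w = 1 := by rw [hq, ← Finset.sum_div, div_self hZ0.ne']
  set ρ : Measure ι := ∑ w, ENNReal.ofReal (q w) • Measure.dirac w with hρ
  have : IsProbabilityMeasure ρ := isProbabilityMeasure_sum_dirac (fun w => (hq0 w).le) hq1
  have hρq : ∀ w, ρ.real {w} = q w := measure_sum_dirac_real fun w => (hq0 w).le
  refine ⟨⟨h.process ρ, inferInstance⟩, q, hq0, hq1, fun r V hV => ?_, ?_⟩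
  · have h1 := (h.abs_integral_process_sub_le ρ (f := V.indicator 1) (C := 1) (D := r)
      (measurable_one.indicator hV.measurableSet) (fun ω i _ => ?_)
      (fun ω => abs_visits_sub_le hV (h.agree_concat ω))).2
    · rw [integral_indicator_one hV.measurableSet] at h1
      simp only [hρq] at h1
      exact h1
    · by_cases hz : (shift A)^[i] (h.concat ω) ∈ V <;> simp [hz]
  · have hB := hG.le_const hc₀
    set B := Real.log c₀ + P with hBdef
    obtain ⟨C, hC⟩ : ∃ C, ∀ (w : ι), ∀ i < p, |φ ((shift A)^[i] (x w))| ≤ C := by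
      refine ⟨∑ w, ∑ i ∈ Finset.range p, |φ ((shift A)^[i] (x w))|, fun w i hi => ?_⟩
      refine le_trans ?_ (Finset.single_le_sum (f := fun w => ∑ i ∈ Finset.range p,
        |φ ((shift A)^[i] (x w))|) (fun w _ => Finset.sum_nonneg fun i _ => abs_nonneg _)
        (Finset.mem_univ w))
      exact Finset.single_le_sum (f := fun i => |φ ((shift A)^[i] (x w))|)
        (fun i _ => abs_nonneg _) (Finset.mem_range.2 hi)
    have hnsum1 : ∀ z, nsum φ P 1 z = φ z - P := fun z => by simp [nsum, birkhoff_one]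
    have hbd : ∀ ω, ∀ i < p, |φ ((shift A)^[i] (h.concat ω))| ≤ C + 2 * Real.log c₀ := by
      intro ω i hi
      have hag : Agree 1 ((shift A)^[i] (h.concat ω)) ((shift A)^[i] (x (ω 0))) :=
        agree_shift_iterate ((h.agree_concat ω).mono (by omega))
      have h1 := hG.nsum_le_of_agree hc₀ hag
      have h2 := hG.nsum_le_of_agree hc₀ hag.symm
      rw [hnsum1, hnsum1] at h1 h2
      have h3 := abs_le.1 (hC (ω 0) i hi)
      rw [abs_le]
      constructor <;> linarith
    have hdiff : ∀ ω, |birkhoff (shift A) φ p (h.concat ω) - birkhoff (shift A) φ p (x (ω 0))|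
        ≤ 2 * Real.log c₀ := by
      intro ω
      have h1 := hG.nsum_le_of_agree hc₀ (h.agree_concat ω)
      have h2 := hG.nsum_le_of_agree hc₀ (h.agree_concat ω).symm
      simp only [nsum] at h1 h2
      rw [abs_le]
      constructor <;> linarith
    obtain ⟨hint, habs⟩ := h.abs_integral_process_sub_le ρ hφ hbd hdiff
    simp only [hρq] at habs
    have hgt : IntegralGtBot φ (h.process ρ) := hint.neg.lintegral_lt_top.ne
    have hent := h.le_entropy_process ρ fun w => by rw [hρq]; exact hq0 w
    simp only [hρq] at hent
    have hF : freeEnergy (shift A) φ P ⟨h.process ρ, inferInstance⟩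
        = (entropy (shift A) (h.process ρ) : EReal) + eintegral φ (h.process ρ) - (P : EReal) :=
      if_pos ⟨h.invariant_process ρ, hgt⟩
    rw [hF, (integrable_of_integralGtBot hφ hB hgt).2]
    set I := ∫ z, φ z ∂h.process ρ
    set H := ∑ w, q w * -Real.log (q w) with hH
    have hent' := EReal.coe_ennreal_le_coe_ennreal_iff.2 hent
    have hH1 : (((p : ℝ)⁻¹ * H : ℝ) : EReal) ≤ ((ENNReal.ofReal ((p : ℝ)⁻¹ * H) : ℝ≥0∞) : EReal) := by
      rw [EReal.coe_ennreal_ofReal]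
      exact_mod_cast le_max_left _ _
    calc (((p : ℝ)⁻¹ * (Real.log Z - 2 * Real.log c₀) : ℝ) : EReal)
        ≤ (((p : ℝ)⁻¹ * H + I - P : ℝ) : EReal) := by
          rw [EReal.coe_le_coe_iff]
          have h1 : ∑ w, q w * birkhoff (shift A) φ p (x w) = Real.log Z - H + P * p := by
            have h2 : ∀ w, q w * birkhoff (shift A) φ p (x w)
                = q w * Real.log Z - q w * -Real.log (q w) + q w * (P * p) := fun w => by
              have h3 : Real.log (q w) = nsum φ P p (x w) - Real.log Z := by
                rw [hq, Real.log_div (Real.exp_pos _).ne' hZ0.ne', Real.log_exp]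
              rw [h3, nsum]
              ring
            simp only [h2, Finset.sum_add_distrib, Finset.sum_sub_distrib, ← Finset.sum_mul, hq1,
              one_mul, hH]
          rw [h1] at habs
          have h4 := (abs_le.1 habs).1
          have h5 : (p : ℝ)⁻¹ * (Real.log Z - H + P * p) = (p : ℝ)⁻¹ * (Real.log Z - H) + P := by
            field_simp
          rw [h5] at h4
          linarith
      _ = (((p : ℝ)⁻¹ * H : ℝ) : EReal) + (I : EReal) - (P : EReal) := by
          rw [EReal.coe_sub, EReal.coe_add]
      _ ≤ _ := EReal.sub_le_sub (add_le_add (hH1.trans hent') le_rfl) le_rfl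

/-- The local large deviations upper bound. -/
lemma Fam.exists_isOpen_mass_le (hφ : Measurable φ) (hc₀ : 1 ≤ c₀) (hG : IsGibbsWith A φ μ c₀ P)
    (h : Connects φ P N κ) {a : S} {C : ℕ → Set (Space A)} (hC : Fam φ P N κ a C)
    (ν₀ : ProbabilityMeasure (Space A)) {G : Set (ProbabilityMeasure (Space A))} (hGo : IsOpen G)
    (hν₀ : ν₀ ∈ G) {c : ℝ} (hc : ⨆ ν ∈ G, freeEnergy (shift A) φ P ν < (c : EReal)) :
    ∃ G' : Set (ProbabilityMeasure (Space A)), IsOpen G' ∧ ν₀ ∈ G' ∧ ∀ᶠ n : ℕ in atTop,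
      mass φ P n (C n ∩ {x | empirical (shift A) x n ∈ G'}) ≤ ENNReal.ofReal (Real.exp (c * n)) := by
  obtain ⟨r, 𝒱, ε, hε, h𝒱, hnear⟩ := exists_finset_depOn_of_mem_isOpen ν₀ hGo hν₀
  obtain ⟨G', hG'sub, hG'o, hν₀G'⟩ := eventually_nhds_iff.1
    (eventually_measureReal_near ν₀ h𝒱 (half_pos hε))
  obtain ⟨b, hb1, hb2⟩ := EReal.lt_iff_exists_real_btwn.1 hc
  have hbc : b < c := by exact_mod_cast hb2
  have hlog := Real.log_nonneg hc₀
  refine ⟨G', hG'o, hν₀G', ?_⟩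
  obtain ⟨n₁, hn₁⟩ := exists_nat_gt (2 * (2 * r + 2 * N) / ε)
  obtain ⟨n₂, hn₂⟩ := exists_nat_gt ((4 * Real.log c₀ + κ + b * N) / (c - b))
  filter_upwards [eventually_ge_atTop (n₁ + n₂ + 1)] with n hn
  have hn1 : 1 ≤ n := by omega
  have hnpos : (0 : ℝ) < n := by exact_mod_cast hn1
  by_contra! hlt
  obtain ⟨W, hW⟩ := exists_lt_sum_of_lt_mass hlt
  have hne : Nonempty W := by
    by_contra hemp
    rw [nonempty_subtype, not_exists] at hemp
    rw [Finset.eq_empty_of_forall_notMem hemp] at hW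
    simp at hW
  rw [← ENNReal.ofReal_sum_of_nonneg fun t _ => (Real.exp_pos _).le,
    ENNReal.ofReal_lt_ofReal_iff_of_nonneg (Real.exp_pos _).le, ← Finset.sum_coe_sort] at hW
  choose y hyA hyper hyN using fun w : W => h.per (w : Space A) n hn1
  have hfam : PeriodicFamily (n + N) a y := by
    refine ⟨by omega, hyper, fun w => ?_, fun w w' hww => ?_⟩
    · rw [hyA w 0 (by omega)]
      exact hC.head n _ w.1.2.1
    · refine Subtype.ext (Subtype.ext (hC.inj n hn1 _ w.1.2.1 _ w'.1.2.1 ?_))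
      exact (hyA w).symm.trans ((hww.mono (by omega)).trans (hyA w'))
  obtain ⟨ν, q, hq0, hq1, hνV, hνF⟩ := hfam.exists_measure hφ hc₀ hG
  have hp0 : (0 : ℝ) < (n + N : ℕ) := by exact_mod_cast (by omega : 0 < n + N)
  have hνG : ν ∈ G := by
    refine hnear ν fun V hV => ?_
    have h1 := hνV r V (h𝒱 V hV)
    set v := (ν : Measure (Space A)).real V
    set v₀ := (ν₀ : Measure (Space A)).real V with hv₀
    have hv₀0 : 0 ≤ v₀ := measureReal_nonneg
    have hv₀1 : v₀ ≤ 1 := measureReal_le_one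
    have h2 : ∀ w, |visits (shift A) V (n + N) (y w) - n * v₀| ≤ r + N + n * (ε / 2) := by
      intro w
      have h3 := hG'sub _ w.1.2.2 V hV
      rw [empirical_real _ _ hn1 (h𝒱 V hV).measurableSet, ← hv₀] at h3
      have h4 := abs_le.1 (abs_visits_sub_le (h𝒱 V hV) (hyA w))
      have h5 := visits_add (shift A) V n N (y w)
      have h6 := visits_nonneg (shift A) V N ((shift A)^[n] (y w))
      have h7 := visits_le (shift A) V N ((shift A)^[n] (y w))
      have h8 : |visits (shift A) V n (w : Space A) - n * v₀| ≤ n * (ε / 2) := by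
        have : visits (shift A) V n (w : Space A) - n * v₀
            = n * ((n : ℝ)⁻¹ * visits (shift A) V n (w : Space A) - v₀) := by field_simp
        rw [this, abs_mul, abs_of_pos hnpos]
        exact mul_le_mul_of_nonneg_left h3.le hnpos.le
      have h9 := abs_le.1 h8
      rw [abs_le]
      constructor <;> linarith
    have h3 : |∑ w, q w * visits (shift A) V (n + N) (y w) - n * v₀| ≤ r + N + n * (ε / 2) := by
      have : ∑ w, q w * visits (shift A) V (n + N) (y w) - n * v₀
          = ∑ w, q w * (visits (shift A) V (n + N) (y w) - n * v₀) := by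
        simp only [mul_sub, Finset.sum_sub_distrib, ← Finset.sum_mul, hq1, one_mul]
      rw [this]
      calc _ ≤ ∑ w, |q w * (visits (shift A) V (n + N) (y w) - n * v₀)| :=
            Finset.abs_sum_le_sum_abs _ _
        _ ≤ ∑ w, q w * (r + N + n * (ε / 2)) := Finset.sum_le_sum fun w _ => by
            rw [abs_mul, abs_of_pos (hq0 w)]
            exact mul_le_mul_of_nonneg_left (h2 w) (hq0 w).le
        _ = _ := by rw [← Finset.sum_mul, hq1, one_mul]
    set Q := ∑ w, q w * visits (shift A) V (n + N) (y w)
    have h4 : |(n + N : ℕ) * v - Q| ≤ r := by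
      have : (n + N : ℕ) * v - Q = (n + N : ℕ) * (v - ((n + N : ℕ) : ℝ)⁻¹ * Q) := by
        field_simp
      rw [this, abs_mul, abs_of_pos hp0]
      refine (mul_le_mul_of_nonneg_left h1 hp0.le).trans (le_of_eq ?_)
      field_simp
    have h5 : |(n + N : ℕ) * (v - v₀)| < (n + N : ℕ) * ε := by
      have e1 := abs_le.1 h3
      have e2 := abs_le.1 h4
      rw [div_lt_iff₀ hε] at hn₁
      have e3 : (n₁ : ℝ) * ε ≤ n * ε :=
        mul_le_mul_of_nonneg_right (by exact_mod_cast (by omega)) hε.le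
      have e4 : N * v₀ ≤ N := mul_le_of_le_one_right (by positivity) hv₀1
      have e5 : 0 ≤ N * v₀ := by positivity
      have e6 : 0 ≤ N * ε := by positivity
      push_cast at e2 ⊢
      rw [abs_lt]
      constructor <;> linarith
    rw [abs_mul, abs_of_pos hp0] at h5
    exact lt_of_mul_lt_mul_left h5 hp0.le
  have hFlt : freeEnergy (shift A) φ P ν < (b : EReal) :=
    (le_iSup₂ (f := fun ν (_ : ν ∈ G) => freeEnergy (shift A) φ P ν) ν hνG).trans_lt hb1
  have hlt' := hνF.trans_lt hFlt
  rw [EReal.coe_lt_coe_iff, inv_mul_lt_iff₀ hp0] at hlt'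
  have hZ : Real.exp (c * n - 2 * Real.log c₀ - κ) ≤ ∑ w, Real.exp (nsum φ P (n + N) (y w)) := by
    rw [sub_sub, Real.exp_sub, div_le_iff₀ (Real.exp_pos _), Finset.sum_mul]
    refine hW.le.trans (Finset.sum_le_sum fun w _ => ?_)
    rw [← Real.exp_add]
    refine Real.exp_le_exp.2 ?_
    have h1 := hG.nsum_le_of_agree hc₀ (hyA w).symm
    have h2 := hyN w
    rw [nsum_add]
    linarith
  have hlogZ := Real.log_le_log (Real.exp_pos _) hZ
  rw [Real.log_exp] at hlogZ
  rw [div_lt_iff₀ (by linarith)] at hn₂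
  have h1 : (n₂ : ℝ) * (c - b) ≤ n * (c - b) :=
    mul_le_mul_of_nonneg_right (by exact_mod_cast (by omega)) (by linarith)
  push_cast at hlt'
  linarith

end UpperBound

/-! ### Exponential tightness -/

section Tightness

variable {S : Type*} {A : S → S → Prop} [TopologicalSpace S] [DiscreteTopology S]

lemma measurableSet_coord (i : ℕ) (F : Set S) : MeasurableSet {z : Space A | z.1 i ∈ F} :=
  ((isClopen_discrete F).preimage (continuous_coord i)).isOpen.measurableSet

variable [Countable S] {φ : Space A → ℝ} {μ : Measure (Space A)} [IsProbabilityMeasure μ]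
  {c₀ P : ℝ}

/-- A Chernoff bound for the number of visits to the complement of a set of symbols. -/
lemma IsGibbsWith.mass_visits_le (hc₀ : 1 ≤ c₀) (hG : IsGibbsWith A φ μ c₀ P) {F : Set S} {θ : ℝ}
    (hθ : 0 ≤ θ) (hF : ENNReal.ofReal (Real.exp θ) * μ {z | z.1 0 ∉ F} ≤ 1) {n : ℕ}
    {D : Set (Space A)} (hD : ∀ x ∈ D, ∀ x' ∈ D, Agree n x x' → x = x') (t : ℝ) :
    mass φ P n (D ∩ {x | t ≤ visits (shift A) {z | z.1 0 ∉ F} n x})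
      ≤ ENNReal.ofReal (Real.exp (-(θ * t))) * ENNReal.ofReal (2 * c₀) ^ n := by
  set B : Set (Space A) := {z | z.1 0 ∉ F} with hB
  have hBm : MeasurableSet B := measurableSet_coord 0 Fᶜ
  have hsm : ∀ s : S, MeasurableSet ((fun z : Space A => z.1 0) ⁻¹' {s}) := fun s =>
    measurableSet_coord 0 {s}
  set g : S → ℝ≥0∞ := fun s => ENNReal.ofReal c₀ * (μ ((fun z : Space A => z.1 0) ⁻¹' {s})
    + ENNReal.ofReal (Real.exp θ) * μ (B ∩ (fun z : Space A => z.1 0) ⁻¹' {s})) with hg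
  have hgsum : ∑' s, g s ≤ ENNReal.ofReal (2 * c₀) := by
    rw [hg, ENNReal.tsum_mul_left, ENNReal.tsum_add, ENNReal.tsum_mul_left,
      tsum_measure_preimage_singleton μ (fun z : Space A => z.1 0) hsm,
      tsum_measure_inter_preimage_singleton μ (fun z : Space A => z.1 0) hsm B hBm, measure_univ,
      mul_comm 2 c₀, ENNReal.ofReal_mul (by linarith)]
    gcongr
    calc 1 + ENNReal.ofReal (Real.exp θ) * μ B ≤ 1 + 1 := by gcongr
      _ = ENNReal.ofReal 2 := by norm_num
  have hone : ∀ z : Space A,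
      ENNReal.ofReal (Real.exp (nsum φ P 1 z + θ * visits (shift A) B 1 z)) ≤ g (z.1 0) := by
    intro z
    have h1 : ENNReal.ofReal (Real.exp (nsum φ P 1 z))
        ≤ ENNReal.ofReal c₀ * μ ((fun z : Space A => z.1 0) ⁻¹' {z.1 0}) := by
      refine (ENNReal.ofReal_le_ofReal (hG.exp_nsum_le hc₀ le_rfl z)).trans ?_
      rw [ENNReal.ofReal_mul (by linarith), ofReal_measureReal]
      gcongr
      intro z' hz'
      exact pre_eq_iff.1 hz' 0 one_pos
    have h2 : visits (shift A) B 1 z = B.indicator 1 z := birkhoff_one _ _ _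
    rw [Real.exp_add, ENNReal.ofReal_mul (Real.exp_pos _).le, h2]
    by_cases hz : z ∈ B
    · have h3 : B ∩ (fun z : Space A => z.1 0) ⁻¹' {z.1 0}
          = (fun z : Space A => z.1 0) ⁻¹' {z.1 0} := by
        refine Set.inter_eq_right.2 fun z' hz' => ?_
        have hz' : z'.1 0 = z.1 0 := hz'
        show z'.1 0 ∉ F
        rwa [hz']
      simp only [hg, h3, Set.indicator_of_mem hz, Pi.one_apply, mul_one]
      calc _ ≤ ENNReal.ofReal c₀ * μ ((fun z : Space A => z.1 0) ⁻¹' {z.1 0}) *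
            ENNReal.ofReal (Real.exp θ) := by gcongr
        _ = ENNReal.ofReal c₀ * (ENNReal.ofReal (Real.exp θ) *
            μ ((fun z : Space A => z.1 0) ⁻¹' {z.1 0})) := by ring
        _ ≤ _ := by gcongr; exact le_add_self
    · simp only [Set.indicator_of_notMem hz, mul_zero, Real.exp_zero, ENNReal.ofReal_one, mul_one]
      exact h1.trans (mul_le_mul_right le_self_add _)
  have hprod : ∀ n (x : Space A),
      ENNReal.ofReal (Real.exp (nsum φ P n x + θ * visits (shift A) B n x))
        ≤ ∏ i, g (pre n x i) := by
    intro n x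
    induction n with
    | zero => simp [nsum_zero, visits, birkhoff_zero]
    | succ n ih =>
      rw [Fin.prod_univ_castSucc, nsum_add, visits_add,
        show nsum φ P n x + nsum φ P 1 ((shift A)^[n] x) + θ * (visits (shift A) B n x +
          visits (shift A) B 1 ((shift A)^[n] x)) = (nsum φ P n x + θ * visits (shift A) B n x) +
          (nsum φ P 1 ((shift A)^[n] x) + θ * visits (shift A) B 1 ((shift A)^[n] x)) by ring,
        Real.exp_add, ENNReal.ofReal_mul (Real.exp_pos _).le]
      refine mul_le_mul' ih ((hone _).trans_eq ?_)
      rw [shift_iterate_apply]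
      rfl
  set D' := D ∩ {x | t ≤ visits (shift A) B n x}
  calc mass φ P n D' ≤ ∑' x : D', ENNReal.ofReal (Real.exp (-(θ * t))) *
        ∏ i, g (pre n (x : Space A) i) := by
        refine ENNReal.tsum_le_tsum fun x => ?_
        refine le_trans ?_ (mul_le_mul_right (hprod n x) _)
        rw [← ENNReal.ofReal_mul (Real.exp_pos _).le, ← Real.exp_add]
        gcongr
        have := mul_le_mul_of_nonneg_left x.2.2 hθ
        linarith
    _ = ENNReal.ofReal (Real.exp (-(θ * t))) * ∑' x : D', ∏ i, g (pre n (x : Space A) i) :=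
        ENNReal.tsum_mul_left
    _ ≤ ENNReal.ofReal (Real.exp (-(θ * t))) * ∑' w : Fin n → S, ∏ i, g (w i) := by
        gcongr
        have hinj : Function.Injective (fun x : D' => pre n (x : Space A)) := fun x x' h =>
          Subtype.ext (hD x x.2.1 x' x'.2.1 (pre_eq_iff.1 h))
        exact ENNReal.tsum_comp_le_tsum_of_injective hinj (fun w => ∏ i, g (w i))
    _ ≤ ENNReal.ofReal (Real.exp (-(θ * t))) * ENNReal.ofReal (2 * c₀) ^ n := by
        rw [tsum_prod_fin]
        gcongr

lemma exists_finset_measure_coord_notMem_le (μ : Measure (Space A)) [IsProbabilityMeasure μ]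
    {ε : ℝ≥0∞} (hε : 0 < ε) : ∃ F : Finset S, μ {z | z.1 0 ∉ F} ≤ ε := by
  have hsm : ∀ s : S, MeasurableSet ((fun z : Space A => z.1 0) ⁻¹' {s}) := fun s =>
    measurableSet_coord 0 {s}
  have hsum := tsum_measure_preimage_singleton μ (fun z : Space A => z.1 0) hsm
  have hlim := ENNReal.tendsto_tsum_compl_atTop_zero
    (f := fun s => μ ((fun z : Space A => z.1 0) ⁻¹' {s})) (by rw [hsum]; exact measure_ne_top _ _)
  obtain ⟨F, hF⟩ := (hlim.eventually (gt_mem_nhds hε)).exists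
  refine ⟨F, le_trans ?_ hF.le⟩
  refine (measure_mono fun z hz => ?_).trans (measure_iUnion_le _)
  exact Set.mem_iUnion.2 ⟨⟨z.1 0, hz⟩, rfl⟩

/-- Up to an exponentially small mass, the empirical measures of the points of a family lie in a
compact set. -/
lemma Fam.exists_isCompact_mass_le (hc₀ : 1 ≤ c₀) (hG : IsGibbsWith A φ μ c₀ P)
    {N : ℕ} {κ : ℝ} {a : S} {C : ℕ → Set (Space A)} (hC : Fam φ P N κ a C) (L : ℝ) :
    ∃ K : Set (ProbabilityMeasure (Space A)), IsCompact K ∧ ∃ M : ℝ≥0∞, M ≠ ⊤ ∧ ∀ n, 1 ≤ n →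
      mass φ P n (C n ∩ {x | empirical (shift A) x n ∈ Kᶜ})
        ≤ M * ENNReal.ofReal (Real.exp (-(L * n))) := by
  set θ : ℕ → ℝ := fun s => 2 ^ s * (|L| + s + Real.log (2 * c₀)) with hθ
  have hlog : 0 ≤ Real.log (2 * c₀) := Real.log_nonneg (by linarith)
  have hθ0 : ∀ s, 0 ≤ θ s := fun s => by positivity
  have hF : ∀ s, ∃ F : Finset S, ENNReal.ofReal (Real.exp (θ s)) * μ {z | z.1 0 ∉ F} ≤ 1 := by
    intro s
    obtain ⟨F, hF⟩ := exists_finset_measure_coord_notMem_le μ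
      (ENNReal.inv_pos.2 (ENNReal.ofReal_ne_top (r := Real.exp (θ s))))
    exact ⟨F, (mul_le_mul_right hF _).trans (ENNReal.mul_inv_le_one _)⟩
  choose F hF using hF
  choose Y hY using hC.count
  set K₀ : Set (ProbabilityMeasure (Space A)) := {ν | ∀ r i : ℕ,
    (ν : Measure (Space A)) {z | z.1 i ∉ (F (r + i) : Set S) ∪ Y i} ≤ 2⁻¹ ^ (r + i)} with hK₀
  have hm : ∀ r i : ℕ, MeasurableSet {z : Space A | z.1 i ∉ (F (r + i) : Set S) ∪ Y i} :=
    fun r i => measurableSet_coord i ((F (r + i) : Set S) ∪ Y i)ᶜ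
  have hcomp : IsCompact (closure K₀) := by
    classical
    refine isCompact_closure_of_isTightMeasureSet
      (isTightMeasureSet_iff_exists_isCompact_measure_compl_le.2 fun ε hε => ?_)
    have hlim : Tendsto (fun r : ℕ => (2⁻¹ : ℝ≥0∞) ^ r * 2) atTop (𝓝 0) := by
      have := ENNReal.Tendsto.mul_const (b := 2)
        (ENNReal.tendsto_pow_atTop_nhds_zero_of_lt_one (r := 2⁻¹) (by simp)) (Or.inr (by simp))
      rwa [zero_mul] at this
    obtain ⟨r, hr⟩ := (hlim.eventually (gt_mem_nhds hε)).exists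
    refine ⟨_, isCompact_coord_mem (A := A) fun i => F (r + i) ∪ Y i, ?_⟩
    rintro _ ⟨ν, hν, rfl⟩
    calc (ν : Measure (Space A)) {x | ∀ i, x.1 i ∈ F (r + i) ∪ Y i}ᶜ
        ≤ (ν : Measure (Space A)) (⋃ i, {z | z.1 i ∉ (F (r + i) : Set S) ∪ Y i}) := by
          refine measure_mono fun x hx => ?_
          simpa using hx
      _ ≤ ∑' i, (ν : Measure (Space A)) {z | z.1 i ∉ (F (r + i) : Set S) ∪ Y i} :=
          measure_iUnion_le _
      _ ≤ ∑' i, (2⁻¹ : ℝ≥0∞) ^ r * 2⁻¹ ^ i :=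
          ENNReal.tsum_le_tsum fun i => (hν r i).trans_eq (pow_add _ _ _)
      _ = 2⁻¹ ^ r * 2 := by
          rw [ENNReal.tsum_mul_left, ENNReal.tsum_geometric, ENNReal.one_sub_inv_two, inv_inv]
      _ ≤ ε := hr.le
  refine ⟨closure K₀, hcomp, ∑' s : ℕ, ENNReal.ofReal (Real.exp (-s)),
    Real.summable_exp_neg_nat.tsum_ofReal_ne_top, fun n hn => ?_⟩
  have hn0 : (0 : ℝ) < n := by exact_mod_cast hn
  have hsub : C n ∩ {x | empirical (shift A) x n ∈ (closure K₀)ᶜ} ⊆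
      ⋃ s : ℕ, C n ∩ {x | n * (1 / 2) ^ s ≤ visits (shift A) {z | z.1 0 ∉ (F s : Set S)} n x} := by
    rintro x ⟨hx, hx'⟩
    have hx' : empirical (shift A) x n ∉ K₀ := fun h => hx' (subset_closure h)
    simp only [hK₀, Set.mem_ofPred_eq, not_forall, not_le] at hx'
    obtain ⟨r, i, hri⟩ := hx'
    refine Set.mem_iUnion.2 ⟨r + i, hx, ?_⟩
    have h1 : (1 / 2 : ℝ) ^ (r + i) < (n : ℝ)⁻¹ *
        visits (shift A) {z | z.1 i ∉ (F (r + i) : Set S) ∪ Y i} n x := by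
      rw [← empirical_real (shift A) x hn (hm r i)]
      have := (ENNReal.toReal_lt_toReal (by simp) (measure_ne_top _ _)).2 hri
      simpa [Measure.real] using this
    rw [inv_mul_eq_div, lt_div_iff₀ hn0, mul_comm] at h1
    exact h1.le.trans (hY i n hn x hx (F (r + i)))
  calc mass φ P n (C n ∩ {x | empirical (shift A) x n ∈ (closure K₀)ᶜ})
      ≤ ∑' s : ℕ, mass φ P n (C n ∩
        {x | n * (1 / 2) ^ s ≤ visits (shift A) {z | z.1 0 ∉ (F s : Set S)} n x}) :=
        (mass_mono φ P n hsub).trans (ENNReal.tsum_iUnion_le_tsum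
          (fun x => ENNReal.ofReal (Real.exp (nsum φ P n x))) _)
    _ ≤ ∑' s : ℕ, ENNReal.ofReal (Real.exp (-s)) * ENNReal.ofReal (Real.exp (-(L * n))) := by
        refine ENNReal.tsum_le_tsum fun s => ?_
        refine (hG.mass_visits_le hc₀ (hθ0 s) (hF s) (hC.inj n hn) _).trans ?_
        rw [← Real.exp_log (show 0 < 2 * c₀ by linarith), ← ENNReal.ofReal_pow (Real.exp_pos _).le,
          ← Real.exp_nat_mul, ← ENNReal.ofReal_mul (Real.exp_pos _).le,
          ← ENNReal.ofReal_mul (Real.exp_pos _).le, ← Real.exp_add, ← Real.exp_add]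
        refine ENNReal.ofReal_le_ofReal (Real.exp_le_exp.2 ?_)
        have e : θ s * (n * (1 / 2) ^ s) = n * (|L| + s + Real.log (2 * c₀)) := by
          rw [hθ, one_div, inv_pow]
          field_simp
        rw [e]
        have h1 : (s : ℝ) ≤ n * s :=
          le_mul_of_one_le_left (Nat.cast_nonneg s) (by exact_mod_cast hn)
        have h2 : L * n ≤ n * |L| := by
          rw [mul_comm]
          exact mul_le_mul_of_nonneg_left (le_abs_self L) hn0.le
        linarith
    _ = _ := ENNReal.tsum_mul_right

end Tightness

/-! ### Exponential rates -/

section Rates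

/-- The exponential rate `n⁻¹ log u` at time `n`. -/
noncomputable abbrev rate (u : ℕ → ℝ≥0∞) (n : ℕ) : EReal :=
  (((n : ℝ)⁻¹ : ℝ) : EReal) * ENNReal.log (u n)

lemma rate_mono {u v : ℕ → ℝ≥0∞} {n : ℕ} (h : u n ≤ v n) : rate u n ≤ rate v n :=
  mul_le_mul_of_nonneg_left (ENNReal.log_monotone h) (by
    rw [← EReal.coe_zero, EReal.coe_le_coe_iff]; positivity)

lemma tendsto_rate_exp (b c : ℝ) :
    Tendsto (rate fun n : ℕ => ENNReal.ofReal (Real.exp (b + c * n))) atTop (𝓝 (c : EReal)) := by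
  have h1 : Tendsto (fun n : ℕ => (n : ℝ)⁻¹ * b + c) atTop (𝓝 c) := by
    have := ((tendsto_natCast_atTop_atTop (R := ℝ)).inv_tendsto_atTop.mul_const b).add_const c
    simpa using this
  refine ((continuous_coe_real_ereal.tendsto c).comp h1).congr' ?_
  filter_upwards [eventually_ge_atTop 1] with n hn
  have hn0 : (n : ℝ) ≠ 0 := by positivity
  simp only [rate, Function.comp]
  rw [ENNReal.log_ofReal_of_pos (Real.exp_pos _), Real.log_exp, ← EReal.coe_mul]
  congr 1
  field_simp

lemma limsup_rate_le {u : ℕ → ℝ≥0∞} {M : ℝ≥0∞} (hM : M ≠ ⊤) {c : ℝ}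
    (h : ∀ᶠ n : ℕ in atTop, u n ≤ M * ENNReal.ofReal (Real.exp (c * n))) :
    limsup (rate u) atTop ≤ c := by
  rw [← (tendsto_rate_exp M.toReal c).limsup_eq]
  refine limsup_le_limsup (h.mono fun n hn => rate_mono (hn.trans ?_))
  rw [Real.exp_add, ENNReal.ofReal_mul (Real.exp_pos _).le]
  gcongr
  rw [← ENNReal.ofReal_toReal hM]
  refine ENNReal.ofReal_le_ofReal ?_
  rw [ENNReal.toReal_ofReal ENNReal.toReal_nonneg]
  linarith [Real.add_one_le_exp M.toReal]

lemma le_liminf_rate {u : ℕ → ℝ≥0∞} {M : ℝ≥0∞} (hM : M ≠ 0) {c : ℝ}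
    (h : ∀ᶠ n : ℕ in atTop, M * ENNReal.ofReal (Real.exp (c * n)) ≤ u n) :
    c ≤ liminf (rate u) atTop := by
  obtain ⟨b, hb⟩ : ∃ b : ℝ, ENNReal.ofReal (Real.exp b) ≤ M := by
    rcases eq_or_ne M ⊤ with rfl | hM'
    · exact ⟨0, le_top⟩
    · refine ⟨Real.log M.toReal, ?_⟩
      rw [Real.exp_log (ENNReal.toReal_pos hM hM'), ENNReal.ofReal_toReal hM']
  rw [← (tendsto_rate_exp b c).liminf_eq]
  refine liminf_le_liminf (h.mono fun n hn => rate_mono (le_trans ?_ hn))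
  rw [Real.exp_add, ENNReal.ofReal_mul (Real.exp_pos _).le]
  gcongr

end Rates

section RateFunction

variable {Y : Type*} [TopologicalSpace Y] {F : Y → EReal}

lemma exists_isOpen_of_lt_rateOf {ν : Y} {b : EReal} (h : b < rateOf F ν) :
    ∃ G, IsOpen G ∧ ν ∈ G ∧ ⨆ ν' ∈ G, F ν' < -b := by
  rw [rateOf, EReal.lt_neg_comm, iInf_lt_iff] at h
  obtain ⟨G, hG⟩ := h
  obtain ⟨⟨hGo, hν⟩, hlt⟩ := iInf_lt_iff.1 hG
  exact ⟨G, hGo, hν, hlt⟩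

lemma neg_iSup_le_rateOf {G : Set Y} (hG : IsOpen G) {ν : Y} (hν : ν ∈ G) :
    -(⨆ ν' ∈ G, F ν') ≤ rateOf F ν :=
  EReal.neg_le_neg_iff.2 (iInf₂_le G ⟨hG, hν⟩)

lemma lowerSemicontinuous_rateOf (F : Y → EReal) : LowerSemicontinuous (rateOf F) := by
  intro ν b hb
  obtain ⟨G, hGo, hν, hlt⟩ := exists_isOpen_of_lt_rateOf hb
  filter_upwards [hGo.mem_nhds hν] with ν' hν'
  exact (EReal.lt_neg_comm.1 hlt).trans_le (neg_iSup_le_rateOf hGo hν')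

end RateFunction

/-! ### The large deviation principle for weighted families -/

section LargeDeviations

lemma mass_union_le {S : Type*} {A : S → S → Prop} (φ : Space A → ℝ) (P : ℝ) (n : ℕ)
    (D E : Set (Space A)) :
    mass φ P n (D ∪ E) ≤ mass φ P n D + mass φ P n E :=
  ENNReal.tsum_union_le (fun x => ENNReal.ofReal (Real.exp (nsum φ P n x))) D E

variable {S : Type*} {A : S → S → Prop} [TopologicalSpace S] [DiscreteTopology S] [Countable S]
  {φ : Space A → ℝ} {μ : Measure (Space A)} [IsProbabilityMeasure μ] {c₀ P : ℝ} {N : ℕ} {κ : ℝ}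
  {a : S} {C : ℕ → Set (Space A)}

lemma Fam.iSup_freeEnergy_le (hφ : Measurable φ) (hc₀ : 1 ≤ c₀) (hG : IsGibbsWith A φ μ c₀ P)
    (h : Connects φ P N κ) (hA : NoZeroRowCol A) (hC : Fam φ P N κ a C)
    {G : Set (ProbabilityMeasure (Space A))} (hGo : IsOpen G) {M : ℝ≥0∞} (hM : M ≠ ⊤) {c : ℝ}
    (hle : ∀ᶠ n : ℕ in atTop, mass φ P n (C n ∩ {x | empirical (shift A) x n ∈ G})
      ≤ M * ENNReal.ofReal (Real.exp (c * n))) :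
    ⨆ ν ∈ G, freeEnergy (shift A) φ P ν ≤ c := by
  refine iSup₂_le fun ν hν => EReal.ge_of_forall_gt_iff_ge.1 fun b hb => ?_
  refine (le_liminf_rate one_ne_zero ?_).trans (le_trans liminf_le_limsup (limsup_rate_le hM hle))
  simp only [one_mul]
  exact hC.eventually_le_mass hφ hc₀ hG h hA ν hGo hν hb

lemma Fam.iSup_freeEnergy_nonpos (hφ : Measurable φ) (hc₀ : 1 ≤ c₀) (hG : IsGibbsWith A φ μ c₀ P)
    (h : Connects φ P N κ) (hA : NoZeroRowCol A) (hC : Fam φ P N κ a C)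
    (G : Set (ProbabilityMeasure (Space A))) :
    ⨆ ν ∈ G, freeEnergy (shift A) φ P ν ≤ 0 := by
  refine (biSup_mono fun _ _ => Set.mem_univ _).trans
    (hC.iSup_freeEnergy_le hφ hc₀ hG h hA isOpen_univ (ENNReal.ofReal_ne_top (r := c₀)) (c := 0) ?_)
  filter_upwards [eventually_ge_atTop 1] with n hn
  simpa using hG.mass_le hc₀ hn (D := C n) (hC.inj n hn)

lemma Fam.rateOf_nonneg (hφ : Measurable φ) (hc₀ : 1 ≤ c₀) (hG : IsGibbsWith A φ μ c₀ P)
    (h : Connects φ P N κ) (hA : NoZeroRowCol A) (hC : Fam φ P N κ a C)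
    (ν : ProbabilityMeasure (Space A)) : 0 ≤ rateOf (freeEnergy (shift A) φ P) ν := by
  refine le_trans ?_ (neg_iSup_le_rateOf isOpen_univ (Set.mem_univ ν))
  rw [EReal.le_neg, neg_zero]
  exact hC.iSup_freeEnergy_nonpos hφ hc₀ hG h hA _

lemma Fam.goodRate (hφ : Measurable φ) (hc₀ : 1 ≤ c₀) (hG : IsGibbsWith A φ μ c₀ P)
    (h : Connects φ P N κ) (hA : NoZeroRowCol A) (hC : Fam φ P N κ a C) :
    GoodRate (rateOf (freeEnergy (shift A) φ P)) := by
  refine ⟨lowerSemicontinuous_rateOf _, fun α _ => ?_⟩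
  obtain ⟨K, hK, M, hM, hle⟩ := hC.exists_isCompact_mass_le hc₀ hG (α + 1)
  refine hK.of_isClosed_subset ((lowerSemicontinuous_rateOf _).isClosed_preimage _)
    fun ν hν => by_contra fun hνK => ?_
  have h1 := hC.iSup_freeEnergy_le hφ hc₀ hG h hA hK.isClosed.isOpen_compl hM (c := -(α + 1)) (by
    filter_upwards [eventually_ge_atTop 1] with n hn
    simpa only [neg_mul] using hle n hn)
  have h2 : ((α + 1 : ℝ) : EReal) ≤ α := by
    refine le_trans ?_ ((neg_iSup_le_rateOf hK.isClosed.isOpen_compl hνK).trans hν)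
    rwa [EReal.le_neg]
  rw [EReal.coe_le_coe_iff] at h2
  linarith

lemma Fam.eventually_mass_mem (hc₀ : 1 ≤ c₀) (hG : IsGibbsWith A φ μ c₀ P) (hA : NoZeroRowCol A)
    (hC : Fam φ P N κ a C) : ∃ δ : ℝ≥0∞, δ ≠ 0 ∧ ∀ᶠ n in atTop,
      δ ≤ mass φ P n (C n) ∧ mass φ P n (C n) ≤ ENNReal.ofReal c₀ := by
  obtain ⟨δ, hδ, hle⟩ := hC.exists_le_mass hc₀ hG hA
  refine ⟨δ, hδ, ?_⟩
  filter_upwards [eventually_ge_atTop (1 + N)] with n hn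
  obtain ⟨m, rfl⟩ := Nat.exists_eq_add_of_le' (Nat.le_of_add_left_le hn)
  exact ⟨hle m (by omega), hG.mass_le hc₀ (by omega) (hC.inj _ (by omega))⟩

lemma Fam.limsup_weightedDistr_le (hc₀ : 1 ≤ c₀) (hG : IsGibbsWith A φ μ c₀ P)
    (hA : NoZeroRowCol A) (hC : Fam φ P N κ a C) {B : Set (ProbabilityMeasure (Space A))}
    (hB : MeasurableSet B) {M : ℝ≥0∞} (hM : M ≠ ⊤) {c : ℝ}
    (hle : ∀ᶠ n : ℕ in atTop, mass φ P n (C n ∩ {x | empirical (shift A) x n ∈ B})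
      ≤ M * ENNReal.ofReal (Real.exp (c * n))) :
    limsup (rate fun n => weightedDistr (shift A) φ n (C n) B) atTop ≤ c := by
  obtain ⟨δ, hδ, hδle⟩ := hC.eventually_mass_mem hc₀ hG hA
  refine limsup_rate_le (M := δ⁻¹ * M) (ENNReal.mul_ne_top (ENNReal.inv_ne_top.2 hδ) hM) ?_
  filter_upwards [hδle, hle] with n h1 h2
  rw [weightedDistr_apply φ P n (C n) hB, mul_assoc]
  exact mul_le_mul' (ENNReal.inv_le_inv.2 h1.1) h2

lemma Fam.le_liminf_weightedDistr (hc₀ : 1 ≤ c₀) (hG : IsGibbsWith A φ μ c₀ P)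
    (hA : NoZeroRowCol A) (hC : Fam φ P N κ a C) {B : Set (ProbabilityMeasure (Space A))}
    (hB : MeasurableSet B) {c : ℝ}
    (hle : ∀ᶠ n : ℕ in atTop, ENNReal.ofReal (Real.exp (c * n))
      ≤ mass φ P n (C n ∩ {x | empirical (shift A) x n ∈ B})) :
    c ≤ liminf (rate fun n => weightedDistr (shift A) φ n (C n) B) atTop := by
  obtain ⟨δ, -, hδle⟩ := hC.eventually_mass_mem hc₀ hG hA
  refine le_liminf_rate (M := (ENNReal.ofReal c₀)⁻¹)
    (ENNReal.inv_ne_zero.2 ENNReal.ofReal_ne_top) ?_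
  filter_upwards [hδle, hle] with n h1 h2
  rw [weightedDistr_apply φ P n (C n) hB]
  exact mul_le_mul' (ENNReal.inv_le_inv.2 h1.2) h2

lemma Fam.expTight (hc₀ : 1 ≤ c₀) (hG : IsGibbsWith A φ μ c₀ P) (hA : NoZeroRowCol A)
    (hC : Fam φ P N κ a C) : ExpTight (fun n => weightedDistr (shift A) φ n (C n)) := by
  intro L _
  obtain ⟨K, hK, M, hM, hle⟩ := hC.exists_isCompact_mass_le hc₀ hG L
  refine ⟨K, hK, hC.limsup_weightedDistr_le hc₀ hG hA hK.isClosed.measurableSet.compl hM ?_⟩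
  filter_upwards [eventually_ge_atTop 1] with n hn
  simpa only [neg_mul] using hle n hn

lemma Fam.exists_mass_le_of_isCompact (hφ : Measurable φ) (hc₀ : 1 ≤ c₀)
    (hG : IsGibbsWith A φ μ c₀ P) (h : Connects φ P N κ) (hC : Fam φ P N κ a C)
    {K : Set (ProbabilityMeasure (Space A))} (hK : IsCompact K) {c : ℝ}
    (hc : ∀ ν ∈ K, ((-c : ℝ) : EReal) < rateOf (freeEnergy (shift A) φ P) ν) :
    ∃ M : ℝ≥0∞, M ≠ ⊤ ∧ ∀ᶠ n : ℕ in atTop,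
      mass φ P n (C n ∩ {x | empirical (shift A) x n ∈ K})
        ≤ M * ENNReal.ofReal (Real.exp (c * n)) := by
  refine hK.induction_on (p := fun B => ∃ M : ℝ≥0∞, M ≠ ⊤ ∧ ∀ᶠ n : ℕ in atTop,
      mass φ P n (C n ∩ {x | empirical (shift A) x n ∈ B})
        ≤ M * ENNReal.ofReal (Real.exp (c * n))) ?_ ?_ ?_ ?_
  · exact ⟨0, ENNReal.zero_ne_top, Eventually.of_forall fun n => by simp [mass]⟩
  · rintro s t hst ⟨M, hM, hle⟩
    exact ⟨M, hM, hle.mono fun n hn =>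
      (mass_mono φ P n (Set.inter_subset_inter_right _ fun x hx => hst hx)).trans hn⟩
  · rintro s t ⟨M, hM, hle⟩ ⟨M', hM', hle'⟩
    refine ⟨M + M', ENNReal.add_ne_top.2 ⟨hM, hM'⟩, ?_⟩
    filter_upwards [hle, hle'] with n h1 h2
    rw [add_mul, show C n ∩ {x | empirical (shift A) x n ∈ s ∪ t}
      = C n ∩ {x | empirical (shift A) x n ∈ s} ∪ C n ∩ {x | empirical (shift A) x n ∈ t} by
        rw [← Set.inter_union_distrib_left]; rfl]
    exact (mass_union_le φ P n _ _).trans (add_le_add h1 h2)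
  · intro ν hν
    obtain ⟨G, hGo, hνG, hlt⟩ := exists_isOpen_of_lt_rateOf (hc ν hν)
    rw [EReal.coe_neg, neg_neg] at hlt
    obtain ⟨G', hGo', hνG', hle⟩ := hC.exists_isOpen_mass_le hφ hc₀ hG h ν hGo hνG hlt
    exact ⟨G', mem_nhdsWithin_of_mem_nhds (hGo'.mem_nhds hνG'), 1, ENNReal.one_ne_top,
      by simpa only [one_mul] using hle⟩

lemma Fam.hasLDP (hφ : Measurable φ) (hc₀ : 1 ≤ c₀) (hG : IsGibbsWith A φ μ c₀ P)
    (h : Connects φ P N κ) (hA : NoZeroRowCol A) (hC : Fam φ P N κ a C) :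
    HasLDP (fun n => weightedDistr (shift A) φ n (C n)) (rateOf (freeEnergy (shift A) φ P)) := by
  refine ⟨fun G hGo => ?_, fun K hK => ?_⟩
  · rw [EReal.neg_le]
    refine le_iInf₂ fun ν hν => ?_
    refine le_trans (EReal.neg_le_neg_iff.2 ?_) (neg_iSup_le_rateOf hGo hν)
    refine iSup₂_le fun ν' hν' => EReal.ge_of_forall_gt_iff_ge.1 fun b hb => ?_
    exact hC.le_liminf_weightedDistr hc₀ hG hA hGo.measurableSet
      (hC.eventually_le_mass hφ hc₀ hG h hA ν' hGo hν' hb)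
  · refine EReal.le_of_forall_lt_iff_le.1 fun c hc => ?_
    obtain ⟨K', hK', M', hM', hle'⟩ := hC.exists_isCompact_mass_le hc₀ hG (-c)
    obtain ⟨M, hM, hle⟩ := hC.exists_mass_le_of_isCompact hφ hc₀ hG h (hK'.inter_left hK)
      (c := c) fun ν hν => by
        rw [EReal.coe_neg]
        exact (EReal.neg_lt_comm.1 hc).trans_le (iInf₂_le ν hν.1)
    refine hC.limsup_weightedDistr_le hc₀ hG hA hK.measurableSet
      (ENNReal.add_ne_top.2 ⟨hM, hM'⟩) ?_
    filter_upwards [hle, eventually_ge_atTop 1] with n h1 hn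
    have h2 := hle' n hn
    rw [neg_mul, neg_neg] at h2
    rw [add_mul]
    refine (mass_mono φ P n fun x hx => ?_).trans
      ((mass_union_le φ P n _ _).trans (add_le_add h1 h2))
    by_cases hxK : empirical (shift A) x n ∈ K'
    exacts [Or.inl ⟨hx.1, hx.2, hxK⟩, Or.inr ⟨hx.1, hxK⟩]

end LargeDeviations

/-! ### Convexity of the rate function -/

section Convexity

variable {X : Type*} [MeasurableSpace X]

lemma coe_mix (t : ℝ) (h0 : 0 ≤ t) (h1 : t ≤ 1) (μ ν : ProbabilityMeasure X) :
    (mix t h0 h1 μ ν : Measure X)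
      = ENNReal.ofReal t • (μ : Measure X) + ENNReal.ofReal (1 - t) • (ν : Measure X) := rfl

lemma mix_zero (μ ν : ProbabilityMeasure X) : mix 0 le_rfl zero_le_one μ ν = ν :=
  Subtype.ext (by
    show (mix 0 le_rfl zero_le_one μ ν : Measure X) = ν
    simp [coe_mix])

lemma mix_one (μ ν : ProbabilityMeasure X) : mix 1 zero_le_one le_rfl μ ν = μ :=
  Subtype.ext (by
    show (mix 1 zero_le_one le_rfl μ ν : Measure X) = μ
    simp [coe_mix])

lemma integral_mix {t : ℝ} (h0 : 0 ≤ t) (h1 : t ≤ 1) {μ ν : ProbabilityMeasure X} {f : X → ℝ}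
    (hμ : Integrable f (μ : Measure X)) (hν : Integrable f (ν : Measure X)) :
    ∫ x, f x ∂(mix t h0 h1 μ ν : Measure X)
      = t * ∫ x, f x ∂(μ : Measure X) + (1 - t) * ∫ x, f x ∂(ν : Measure X) := by
  rw [coe_mix, integral_add_measure (hμ.smul_measure ENNReal.ofReal_ne_top)
    (hν.smul_measure ENNReal.ofReal_ne_top), integral_smul_measure, integral_smul_measure,
    ENNReal.toReal_ofReal h0, ENNReal.toReal_ofReal (by linarith), smul_eq_mul, smul_eq_mul]

lemma continuous_mix [TopologicalSpace X] [OpensMeasurableSpace X] {t : ℝ} (h0 : 0 ≤ t)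
    (h1 : t ≤ 1) :
    Continuous fun p : ProbabilityMeasure X × ProbabilityMeasure X => mix t h0 h1 p.1 p.2 := by
  refine continuous_iff_continuousAt.2 fun p => ?_
  refine ProbabilityMeasure.tendsto_iff_forall_integral_tendsto.2 fun f => ?_
  have hint : ∀ ν : ProbabilityMeasure X, Integrable f (ν : Measure X) := fun ν => f.integrable _
  simp only [integral_mix h0 h1 (hint _) (hint _)]
  have h2 := ProbabilityMeasure.tendsto_iff_forall_integral_tendsto.1 (continuous_fst.tendsto p) f
  have h3 := ProbabilityMeasure.tendsto_iff_forall_integral_tendsto.1 (continuous_snd.tendsto p) f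
  exact (h2.const_mul t).add (h3.const_mul (1 - t))

/-- The free energy is concave. -/
lemma le_freeEnergy_mix {T : X → X} (hT : Measurable T) {φ : X → ℝ} (hφ : Measurable φ) {B : ℝ}
    (hB : ∀ x, φ x ≤ B) {P : ℝ} {t : ℝ} (h0 : 0 ≤ t) (h1 : t ≤ 1) {μ ν : ProbabilityMeasure X}
    {b c : ℝ} (hb : (b : EReal) < freeEnergy T φ P μ) (hc : (c : EReal) < freeEnergy T φ P ν) :
    ((t * b + (1 - t) * c : ℝ) : EReal) ≤ freeEnergy T φ P (mix t h0 h1 μ ν) := by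
  have key : ∀ {ν : ProbabilityMeasure X} {c : ℝ}, (c : EReal) < freeEnergy T φ P ν →
      Invariant T (ν : Measure X) ∧ Integrable φ (ν : Measure X) ∧
        ENNReal.ofReal (c - ∫ x, φ x ∂(ν : Measure X) + P) ≤ entropy T (ν : Measure X) := by
    intro ν c hc
    have hinv : Invariant T (ν : Measure X) ∧ IntegralGtBot φ (ν : Measure X) := by
      by_contra h
      rw [freeEnergy, if_neg h] at hc
      exact not_lt_bot hc
    obtain ⟨hint, heq⟩ := integrable_of_integralGtBot hφ hB hinv.2
    rw [freeEnergy, if_pos hinv, heq] at hc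
    refine ⟨hinv.1, hint, ?_⟩
    by_contra! hlt
    refine hc.not_ge ?_
    lift entropy T (ν : Measure X) to ℝ≥0 using hlt.ne_top with e
    rw [← ENNReal.ofReal_coe_nnreal] at hlt
    have hlt := (ENNReal.ofReal_lt_ofReal_iff_of_nonneg e.coe_nonneg).1 hlt
    show (((e : ℝ) + (∫ x, φ x ∂(ν : Measure X)) - P : ℝ) : EReal) ≤ c
    rw [EReal.coe_le_coe_iff]
    linarith
  obtain ⟨hμi, hμ, hμe⟩ := key hb
  obtain ⟨hνi, hν, hνe⟩ := key hc
  have hmint : Integrable φ (mix t h0 h1 μ ν : Measure X) :=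
    (hμ.smul_measure ENNReal.ofReal_ne_top).add_measure (hν.smul_measure ENNReal.ofReal_ne_top)
  have hinv : Invariant T (mix t h0 h1 μ ν : Measure X) ∧
      IntegralGtBot φ (mix t h0 h1 μ ν : Measure X) := by
    constructor
    · have hμi : Measure.map T (μ : Measure X) = μ := hμi
      have hνi : Measure.map T (ν : Measure X) = ν := hνi
      rw [Invariant, coe_mix, Measure.map_add _ _ hT, Measure.map_smul, Measure.map_smul, hμi, hνi]
    · exact (hmint.neg.lintegral_lt_top).ne
  obtain ⟨-, heq⟩ := integrable_of_integralGtBot hφ hB hinv.2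
  rw [freeEnergy, if_pos hinv, heq, integral_mix h0 h1 hμ hν]
  set I := ∫ x, φ x ∂(μ : Measure X)
  set J := ∫ x, φ x ∂(ν : Measure X)
  have hent : ENNReal.ofReal (t * (b - I + P) + (1 - t) * (c - J + P))
      ≤ entropy T (mix t h0 h1 μ ν : Measure X) := by
    refine le_trans ?_ (entropy_mix_ge hT μ ν t h0 h1)
    refine ENNReal.ofReal_add_le.trans ?_
    rw [ENNReal.ofReal_mul h0, ENNReal.ofReal_mul (by linarith : 0 ≤ 1 - t)]
    gcongr
  have h2 : ((t * (b - I + P) + (1 - t) * (c - J + P) : ℝ) : EReal)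
      ≤ (entropy T (mix t h0 h1 μ ν : Measure X) : EReal) :=
    le_trans (by rw [EReal.coe_ennreal_ofReal, EReal.coe_le_coe_iff]; exact le_max_left _ _)
      (EReal.coe_ennreal_le_coe_ennreal_iff.2 hent)
  calc ((t * b + (1 - t) * c : ℝ) : EReal)
      = ((t * (b - I + P) + (1 - t) * (c - J + P) : ℝ) : EReal)
        + ((t * I + (1 - t) * J : ℝ) : EReal) - (P : EReal) := by
        norm_cast
        ring
    _ ≤ _ := EReal.sub_le_sub (add_le_add h2 le_rfl) le_rfl

lemma exists_lt_of_rateOf_lt {Y : Type*} [TopologicalSpace Y] {F : Y → EReal} {ν : Y} {b : ℝ}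
    (h : rateOf F ν < b) {G : Set Y} (hG : IsOpen G) (hν : ν ∈ G) :
    ∃ ν' ∈ G, ((-b : ℝ) : EReal) < F ν' := by
  have h1 := EReal.neg_lt_comm.1 ((neg_iSup_le_rateOf hG hν).trans_lt h)
  rw [← EReal.coe_neg] at h1
  simpa only [lt_iSup_iff, exists_prop] using h1

lemma convexRate_rateOf [TopologicalSpace X] [OpensMeasurableSpace X] {T : X → X}
    (hT : Measurable T) {φ : X → ℝ} (hφ : Measurable φ) {B : ℝ} (hB : ∀ x, φ x ≤ B) {P : ℝ}
    (hnonneg : ∀ ν, 0 ≤ rateOf (freeEnergy T φ P) ν) :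
    ConvexRate (rateOf (freeEnergy T φ P)) := by
  intro μ ν t h0 h1
  set J := rateOf (freeEnergy T φ P) with hJ
  rcases h0.eq_or_lt with rfl | ht0
  · simp [mix_zero]
  rcases h1.eq_or_lt with rfl | ht1
  · simp [mix_one]
  have hpos : ∀ {s : ℝ}, 0 ≤ s → ∀ ν, 0 ≤ (s : EReal) * J ν := fun hs ν =>
    mul_nonneg (EReal.coe_nonneg.2 hs) (hnonneg ν)
  rcases eq_or_ne (J μ) ⊤ with hμ | hμ
  · rw [hμ, EReal.coe_mul_top_of_pos ht0, EReal.top_add_of_ne_bot]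
    · exact le_top
    · exact ((EReal.bot_lt_zero).trans_le (hpos (by linarith) ν)).ne'
  rcases eq_or_ne (J ν) ⊤ with hν | hν
  · rw [hν, EReal.coe_mul_top_of_pos (by linarith : 0 < 1 - t), EReal.add_top_of_ne_bot]
    · exact le_top
    · exact ((EReal.bot_lt_zero).trans_le (hpos h0 μ)).ne'
  obtain ⟨p, hp⟩ : ∃ p : ℝ, J μ = p :=
    ⟨_, (EReal.coe_toReal hμ (EReal.bot_lt_zero.trans_le (hnonneg μ)).ne').symm⟩
  obtain ⟨q, hq⟩ : ∃ q : ℝ, J ν = q :=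
    ⟨_, (EReal.coe_toReal hν (EReal.bot_lt_zero.trans_le (hnonneg ν)).ne').symm⟩
  rw [hp, hq, ← EReal.coe_mul, ← EReal.coe_mul, ← EReal.coe_add]
  refine EReal.ge_of_forall_gt_iff_ge.1 fun b hb => ?_
  rw [EReal.coe_le_coe_iff]
  refine le_of_forall_pos_le_add fun ε hε => ?_
  obtain ⟨G, hGo, hmix, hlt⟩ := exists_isOpen_of_lt_rateOf hb
  obtain ⟨U, V, hU, hV, hμU, hνV, hUV⟩ :=
    isOpen_prod_iff.1 (hGo.preimage (continuous_mix h0 h1)) μ ν hmix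
  obtain ⟨μ', hμ', hbμ⟩ := exists_lt_of_rateOf_lt (b := p + ε) (ν := μ)
    (by rw [← hJ, hp, EReal.coe_lt_coe_iff]; linarith) hU hμU
  obtain ⟨ν', hν', hbν⟩ := exists_lt_of_rateOf_lt (b := q + ε) (ν := ν)
    (by rw [← hJ, hq, EReal.coe_lt_coe_iff]; linarith) hV hνV
  have h2 := (le_freeEnergy_mix hT hφ hB h0 h1 hbμ hbν).trans_lt
    ((le_iSup₂ (f := fun ν _ => freeEnergy T φ P ν) _
      (hUV (show (μ', ν') ∈ U ×ˢ V from ⟨hμ', hν'⟩))).trans_lt hlt)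
  rw [← EReal.coe_neg, EReal.coe_lt_coe_iff] at h2
  linarith

end Convexity

end CMS

open CMS in
/-- **Theorem C.** For a finitely primitive countable Markov shift with a Gibbs state for a
measurable potential `φ`, any symbol `a` and any `y ∈ X`, the conditioned distributions
`η_{a,n}` (over `[a] ∩ Per_n(σ)`) and `ζ_{a,y,n}` (over `[a] ∩ σ^{-n}y`) are exponentially
tight and satisfy the LDP with the convex good rate function of Theorem A. -/
theorem theoremC {S : Type*} [Countable S] [TopologicalSpace S] [DiscreteTopology S]
    (A : S → S → Prop) (hA : NoZeroRowCol A) (hprim : FinitelyPrimitive A)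
    (φ : Space A → ℝ) (hφ : Measurable φ)
    (μφ : ProbabilityMeasure (Space A)) (c₀ P : ℝ) (hc₀ : 1 ≤ c₀)
    (hGibbs : IsGibbsWith A φ (μφ : Measure (Space A)) c₀ P)
    (a : S) (y : Space A) :
    (ExpTight (fun n => weightedDistr (shift A) φ n (cylinder A [a] ∩ perSet (shift A) n)) ∧
      HasLDP (fun n => weightedDistr (shift A) φ n (cylinder A [a] ∩ perSet (shift A) n))
        (rateOf (freeEnergy (shift A) φ P))) ∧
    (ExpTight (fun n => weightedDistr (shift A) φ n (cylinder A [a] ∩ preimSet (shift A) n y)) ∧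
      HasLDP (fun n => weightedDistr (shift A) φ n (cylinder A [a] ∩ preimSet (shift A) n y))
        (rateOf (freeEnergy (shift A) φ P))) ∧
    GoodRate (rateOf (freeEnergy (shift A) φ P)) ∧
    ConvexRate (rateOf (freeEnergy (shift A) φ P)) := by
  obtain ⟨N, κ, -, h⟩ := exists_connects hprim hc₀ hGibbs
  have hper := fam_perSet h a
  have hpre := fam_preimSet h a y
  exact ⟨⟨hper.expTight hc₀ hGibbs hA, hper.hasLDP hφ hc₀ hGibbs h hA⟩,
    ⟨hpre.expTight hc₀ hGibbs hA, hpre.hasLDP hφ hc₀ hGibbs h hA⟩,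
    hper.goodRate hφ hc₀ hGibbs h hA,
    convexRate_rateOf measurable_shift hφ (hGibbs.le_const hc₀)
      (hper.rateOf_nonneg hφ hc₀ hGibbs h hA)⟩
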